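/- arXiv:2208.02204 — 9 statements merged into one kernel-verified Lean document; each statement's English description precedes it below -/
import Mathlib

section
/- Let X ⊆ ℝ^d and Y ⊆ ℝ^m be nonempty convex compact sets, and let f : ℝ^d × ℝ^m → ℝ be differentiable on an open neighborhood of X×Y, L-Lipschitz on X×Y and ℓ-smooth on X×Y for some L, ℓ > 0. Suppose in addition 0 ≤ f(x,y) ≤ C for all (x,y) ∈ X×Y, for some C > 0. Fix ε > 0, set η := ε²·ℓ/L², and let T be a positive integer with T ≥ C·L²/(ε⁴·ℓ³). For GDmax iterates x^(0), x^(1), …, x^(T) started at any x^(0) ∈ X with learning rate η, there exists an iterate t* with 0 ≤ t* ≤ T−1 such that ‖x^(t*) − x̃^(t*)‖ ≤ ε, where x̃^(t*) := prox_{φ/(2ℓ)}(x^(t*)). (With the constants of an adversarial team Markov game—L = √(ΣA_k+B)/(1−γ)², ℓ = 2(ΣA_k+B)/(1−γ)³, C = 1/(1−γ)—this yields η = 2ε²(1−γ) and T = (1−γ)⁴/(8ε⁴(ΣA_k+B)²).) -/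
section Helpers

open scoped InnerProductSpace

variable {E : Type*} [NormedAddCommGroup E] [InnerProductSpace ℝ E]

lemma aux_limit (A B K : ℝ) (h : ∀ s : ℝ, 0 < s → s ≤ 1 → A ≤ B + s * K) : A ≤ B := by
  by_contra hc
  push Not at hc
  have hK : 0 < |K| + 1 := by positivity
  have hs1 : 0 < min 1 ((A - B) / (2 * (|K| + 1))) := by
    apply lt_min one_pos
    apply div_pos <;> linarith
  have h1 := h _ hs1 (min_le_left _ _)
  have h2 : min 1 ((A - B) / (2 * (|K| + 1))) ≤ (A - B) / (2 * (|K| + 1)) := min_le_right _ _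
  generalize min 1 ((A - B) / (2 * (|K| + 1))) = s at *
  rw [le_div_iff₀ (by positivity)] at h2
  nlinarith [le_abs_self K]

lemma aux_lower [CompleteSpace E] (X : Set E) (hX : Convex ℝ X) (F : E → ℝ) (G : E → E) (l : ℝ)
    (hG : ∀ x ∈ X, HasGradientAt F (G x) x)
    (hl : ∀ x ∈ X, ∀ x' ∈ X, ‖G x - G x'‖ ≤ l * ‖x - x'‖)
    (x w : E) (hx : x ∈ X) (hw : w ∈ X) :
    F x + ⟪G x, w - x⟫_ℝ - l / 2 * ‖w - x‖ ^ 2 ≤ F w := by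
  have hmem : ∀ s : ℝ, 0 ≤ s → s ≤ 1 → x + s • (w - x) ∈ X := fun s h0 h1 =>
    hX.add_smul_sub_mem hx hw ⟨h0, h1⟩
  have hder : ∀ s : ℝ, s ∈ Set.Icc (0:ℝ) 1 → HasDerivAt
      (fun s : ℝ => F (x + s • (w - x)) + l / 2 * ‖w - x‖ ^ 2 * s ^ 2 - s * ⟪G x, w - x⟫_ℝ)
      (⟪G (x + s • (w - x)), w - x⟫_ℝ + l / 2 * ‖w - x‖ ^ 2 * (2 * s) - ⟪G x, w - x⟫_ℝ) s := by
    intro s hs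
    have h1 := (hG _ (hmem s hs.1 hs.2)).hasFDerivAt
    have h2 : HasDerivAt (fun s : ℝ => x + s • (w - x)) (w - x) s := by
      simpa using ((hasDerivAt_id s).smul_const (w - x)).const_add x
    have h3 := h1.comp_hasDerivAt s h2
    have h4 : HasDerivAt (fun s : ℝ => l / 2 * ‖w - x‖ ^ 2 * s ^ 2)
        (l / 2 * ‖w - x‖ ^ 2 * (2 * s)) s := by
      simpa using (hasDerivAt_pow 2 s).const_mul (l / 2 * ‖w - x‖ ^ 2)
    have h5 : HasDerivAt (fun s : ℝ => s * ⟪G x, w - x⟫_ℝ) (⟪G x, w - x⟫_ℝ) s := by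
      simpa using (hasDerivAt_id s).mul_const (⟪G x, w - x⟫_ℝ)
    have h6 := (h3.add h4).sub h5
    simp only [InnerProductSpace.toDual_apply_apply] at h6
    exact h6
  have hmono := monotoneOn_of_deriv_nonneg (convex_Icc (0:ℝ) 1)
    (fun s hs => (hder s hs).continuousAt.continuousWithinAt)
    (fun s hs => (hder s (interior_subset hs)).differentiableAt.differentiableWithinAt)
    (fun s hs => by
      have hs' := interior_subset hs
      rw [(hder s hs').deriv]
      have h1 := hl _ (hmem s hs'.1 hs'.2) x hx
      have h2 : ‖x + s • (w - x) - x‖ = s * ‖w - x‖ := by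
        rw [add_sub_cancel_left, norm_smul, Real.norm_of_nonneg hs'.1]
      rw [h2] at h1
      have h3 := neg_le_of_abs_le (abs_real_inner_le_norm (G (x + s • (w - x)) - G x) (w - x))
      rw [inner_sub_left] at h3
      have h4 := mul_le_mul_of_nonneg_right h1 (norm_nonneg (w - x))
      nlinarith)
  have := hmono (Set.left_mem_Icc.2 zero_le_one) (Set.right_mem_Icc.2 zero_le_one) zero_le_one
  simp at this
  linarith

lemma aux_dir [CompleteSpace E] (X : Set E) (hX : Convex ℝ X) (F : E → ℝ) (G : E → E) (l L : ℝ)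
    (hG : ∀ x ∈ X, HasGradientAt F (G x) x)
    (hl : ∀ x ∈ X, ∀ x' ∈ X, ‖G x - G x'‖ ≤ l * ‖x - x'‖)
    (hL : ∀ x ∈ X, ∀ x' ∈ X, |F x - F x'| ≤ L * ‖x - x'‖)
    (x w : E) (hx : x ∈ X) (hw : w ∈ X) :
    -(L * ‖w - x‖) ≤ ⟪G x, w - x⟫_ℝ := by
  apply aux_limit _ _ (l / 2 * ‖w - x‖ ^ 2)
  intro s h0 h1
  have hm : x + s • (w - x) ∈ X := hX.add_smul_sub_mem hx hw ⟨h0.le, h1⟩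
  have h := aux_lower X hX (fun x => - F x) (fun x => - G x) l
    (fun x hx => by
      have := (hG x hx).hasFDerivAt.neg
      rw [hasGradientAt_iff_hasFDerivAt]
      rw [map_neg]
      exact this)
    (fun x hx x' hx' => by
      have := hl x hx x' hx'
      rwa [← norm_neg, neg_sub', ] at this) x _ hx hm
  have h2 := le_of_abs_le (hL x hx _ hm)
  have h3 : ‖x + s • (w - x) - x‖ = s * ‖w - x‖ := by
    rw [add_sub_cancel_left, norm_smul, Real.norm_of_nonneg h0.le]
  rw [norm_sub_rev, h3] at h2
  rw [h3, add_sub_cancel_left, inner_neg_left, real_inner_smul_right] at h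
  have : s * -(L * ‖w - x‖) ≤ s * (⟪G x, w - x⟫_ℝ + s * (l / 2 * ‖w - x‖ ^ 2)) := by nlinarith
  exact le_of_mul_le_mul_left this h0

lemma aux_weak [CompleteSpace E] (X : Set E) (hX : Convex ℝ X) (F : E → ℝ) (G : E → E) (l : ℝ)
    (hG : ∀ x ∈ X, HasGradientAt F (G x) x)
    (hl : ∀ x ∈ X, ∀ x' ∈ X, ‖G x - G x'‖ ≤ l * ‖x - x'‖)
    (x w : E) (hx : x ∈ X) (hw : w ∈ X) (s : ℝ) (h0 : 0 ≤ s) (h1 : s ≤ 1) :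
    F (x + s • (w - x)) ≤ (1 - s) * F x + s * F w + l / 2 * (s * (1 - s)) * ‖w - x‖ ^ 2 := by
  have hm : x + s • (w - x) ∈ X := hX.add_smul_sub_mem hx hw ⟨h0, h1⟩
  have ha := aux_lower X hX F G l hG hl _ x hm hx
  have hb := aux_lower X hX F G l hG hl _ w hm hw
  have e1 : x - (x + s • (w - x)) = (-s) • (w - x) := by module
  have e2 : w - (x + s • (w - x)) = (1 - s) • (w - x) := by module
  rw [e1, norm_smul, real_inner_smul_right, mul_pow, Real.norm_eq_abs, sq_abs] at ha
  rw [e2, norm_smul, real_inner_smul_right, mul_pow, Real.norm_eq_abs, sq_abs] at hb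
  have ha' := mul_le_mul_of_nonneg_left ha (sub_nonneg.2 h1)
  have hb' := mul_le_mul_of_nonneg_left hb h0
  nlinarith

lemma aux_proj (X : Set E) (hX : Convex ℝ X) (z p w : E) (hp : p ∈ X) (hw : w ∈ X)
    (h : ∀ x' ∈ X, ‖p - z‖ ≤ ‖x' - z‖) : 0 ≤ ⟪p - z, w - p⟫_ℝ := by
  apply aux_limit _ _ (‖w - p‖ ^ 2 / 2)
  intro s h0 h1
  have hm : p + s • (w - p) ∈ X := hX.add_smul_sub_mem hp hw ⟨h0.le, h1⟩
  have h2 := h _ hm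
  have h3 : ‖p - z‖ ^ 2 ≤ ‖p + s • (w - p) - z‖ ^ 2 := by gcongr
  have e : p + s • (w - p) - z = (p - z) + s • (w - p) := by abel
  rw [e, norm_add_sq_real, norm_smul, real_inner_smul_right, mul_pow, Real.norm_eq_abs, sq_abs] at h3
  have : s * 0 ≤ s * (⟪p - z, w - p⟫_ℝ + s * (‖w - p‖ ^ 2 / 2)) := by nlinarith
  exact le_of_mul_le_mul_left this h0

lemma aux_step (X : Set E) (hX : Convex ℝ X) (x g p w : E) (η L : ℝ) (hη : 0 ≤ η)
    (hp : p ∈ X) (hw : w ∈ X)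
    (h : ∀ x' ∈ X, ‖p - (x - η • g)‖ ≤ ‖x' - (x - η • g)‖)
    (hg : -(L * ‖p - x‖) ≤ ⟪g, p - x⟫_ℝ) :
    ‖p - w‖ ^ 2 ≤ ‖x - w‖ ^ 2 + η ^ 2 * L ^ 2 + 2 * η * ⟪g, w - x⟫_ℝ := by
  have h1 := aux_proj X hX _ p w hp hw h
  have e1 : p - (x - η • g) = (p - x) + η • g := by abel
  have e2 : w - p = (w - x) - (p - x) := by abel
  have e3 : p - w = (p - x) - (w - x) := by abel
  have e4 : ‖x - w‖ = ‖w - x‖ := norm_sub_rev _ _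
  rw [e4, e3, norm_sub_sq_real]
  rw [e1, e2, inner_sub_right, inner_add_left, inner_add_left, real_inner_smul_left,
    real_inner_smul_left, real_inner_self_eq_norm_sq] at h1
  have := mul_le_mul_of_nonneg_left hg hη
  nlinarith [sq_nonneg (‖p - x‖ - η * L)]

end Helpers


noncomputable section

/-- `φ(x) := max_{y ∈ Y} f(x, y)` (as a supremum of the image of `Y`). -/
def phiMax {d m : ℕ} (f : EuclideanSpace ℝ (Fin d) → EuclideanSpace ℝ (Fin m) → ℝ)
    (Y : Set (EuclideanSpace ℝ (Fin m))) (x : EuclideanSpace ℝ (Fin d)) : ℝ :=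
  sSup ((fun y => f x y) '' Y)

/-- The Moreau envelope `φ_{1/(2ℓ)}(u) := min_{x' ∈ X} (φ(x') + ℓ‖u − x'‖²)`. -/
def moreauEnv {d m : ℕ} (f : EuclideanSpace ℝ (Fin d) → EuclideanSpace ℝ (Fin m) → ℝ)
    (X : Set (EuclideanSpace ℝ (Fin d))) (Y : Set (EuclideanSpace ℝ (Fin m)))
    (l : ℝ) (u : EuclideanSpace ℝ (Fin d)) : ℝ :=
  sInf ((fun x' => phiMax f Y x' + l * ‖u - x'‖ ^ 2) '' X)

end

/-- GDmax with learning rate `η = ε²ℓ/L²` run for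
`T ≥ C·L²/(ε⁴ℓ³)` iterations produces some iterate `x^(t*)`, `0 ≤ t* ≤ T−1`, that is an
`ε`-nearly stationary point of `φ(x) = max_{y ∈ Y} f(x,y)`:
`‖x^(t*) − prox_{φ/(2ℓ)}(x^(t*))‖ ≤ ε`. -/
theorem gdmax_best_iterate_nearly_stationary
    {d m : ℕ}
    (X : Set (EuclideanSpace ℝ (Fin d))) (Y : Set (EuclideanSpace ℝ (Fin m)))
    (hXne : X.Nonempty) (hXconv : Convex ℝ X) (hXcomp : IsCompact X)
    (hYne : Y.Nonempty) (hYconv : Convex ℝ Y) (hYcomp : IsCompact Y)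
    (f : EuclideanSpace ℝ (Fin d) → EuclideanSpace ℝ (Fin m) → ℝ)
    (L l C : ℝ) (hL : 0 < L) (hl : 0 < l) (hC : 0 < C)
    -- differentiability on an open neighborhood of X × Y
    (hdiff : ∃ U : Set (EuclideanSpace ℝ (Fin d) × EuclideanSpace ℝ (Fin m)),
      IsOpen U ∧ X ×ˢ Y ⊆ U ∧ DifferentiableOn ℝ (fun p => f p.1 p.2) U)
    -- L-Lipschitz continuity on X × Y
    (hLip : ∀ x ∈ X, ∀ x' ∈ X, ∀ y ∈ Y, ∀ y' ∈ Y,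
      |f x y - f x' y'| ≤ L * Real.sqrt (‖x - x'‖ ^ 2 + ‖y - y'‖ ^ 2))
    -- ℓ-smoothness on X × Y (the full gradient is ℓ-Lipschitz)
    (hSmooth : ∀ x ∈ X, ∀ x' ∈ X, ∀ y ∈ Y, ∀ y' ∈ Y,
      Real.sqrt (‖gradient (fun u => f u y) x - gradient (fun u => f u y') x'‖ ^ 2
          + ‖gradient (fun v => f x v) y - gradient (fun v => f x' v) y'‖ ^ 2)
        ≤ l * Real.sqrt (‖x - x'‖ ^ 2 + ‖y - y'‖ ^ 2))
    -- boundedness 0 ≤ f ≤ C on X × Y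
    (hbound : ∀ x ∈ X, ∀ y ∈ Y, 0 ≤ f x y ∧ f x y ≤ C)
    (ε : ℝ) (hε : 0 < ε)
    (η : ℝ) (hη : η = ε ^ 2 * l / L ^ 2)
    (T : ℕ) (hTpos : 0 < T) (hT : C * L ^ 2 / (ε ^ 4 * l ^ 3) ≤ (T : ℝ))
    -- the GDmax iterates
    (xs : ℕ → EuclideanSpace ℝ (Fin d)) (ys : ℕ → EuclideanSpace ℝ (Fin m))
    (hx0 : xs 0 ∈ X)
    (hys : ∀ t, ys (t + 1) ∈ Y ∧ ∀ y' ∈ Y, f (xs t) y' ≤ f (xs t) (ys (t + 1)))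
    (hxs : ∀ t, xs (t + 1) ∈ X ∧ ∀ x' ∈ X,
      ‖xs (t + 1) - (xs t - η • gradient (fun u => f u (ys (t + 1))) (xs t))‖ ≤
        ‖x' - (xs t - η • gradient (fun u => f u (ys (t + 1))) (xs t))‖) :
    ∃ t < T, ∃ xt ∈ X,
      (∀ x' ∈ X, phiMax f Y xt + l * ‖xs t - xt‖ ^ 2 ≤
        phiMax f Y x' + l * ‖xs t - x'‖ ^ 2) ∧
      ‖xs t - xt‖ ≤ ε := by
  classical
  obtain ⟨U, hUo, hUsub, hUd⟩ := hdiff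
  have hG : ∀ y ∈ Y, ∀ x ∈ X,
      HasGradientAt (fun u => f u y) (gradient (fun u => f u y) x) x := by
    intro y hy x hx
    have hxy : (x, y) ∈ U := hUsub ⟨hx, hy⟩
    have h1 : DifferentiableAt ℝ (fun p : EuclideanSpace ℝ (Fin d) × EuclideanSpace ℝ (Fin m) =>
        f p.1 p.2) (x, y) := (hUd _ hxy).differentiableAt (hUo.mem_nhds hxy)
    have h2 : DifferentiableAt ℝ (fun u : EuclideanSpace ℝ (Fin d) => (u, y)) x := by fun_prop
    have h3 : DifferentiableAt ℝ (fun u => f u y) x :=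
      DifferentiableAt.comp (g := fun p : EuclideanSpace ℝ (Fin d) × EuclideanSpace ℝ (Fin m) =>
        f p.1 p.2) x h1 h2
    exact h3.hasGradientAt
  have hS : ∀ y ∈ Y, ∀ x ∈ X, ∀ x' ∈ X,
      ‖gradient (fun u => f u y) x - gradient (fun u => f u y) x'‖ ≤ l * ‖x - x'‖ := by
    intro y hy x hx x' hx'
    have h := hSmooth x hx x' hx' y hy y hy
    have e : Real.sqrt (‖x - x'‖ ^ 2 + ‖y - y‖ ^ 2) = ‖x - x'‖ := by simp
    rw [e] at h
    refine le_trans ?_ h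
    apply Real.le_sqrt_of_sq_le
    nlinarith [sq_nonneg ‖gradient (fun v => f x v) y - gradient (fun v => f x' v) y‖]
  have hLx : ∀ y ∈ Y, ∀ x ∈ X, ∀ x' ∈ X, |f x y - f x' y| ≤ L * ‖x - x'‖ := by
    intro y hy x hx x' hx'
    have h := hLip x hx x' hx' y hy y hy
    have e : Real.sqrt (‖x - x'‖ ^ 2 + ‖y - y‖ ^ 2) = ‖x - x'‖ := by simp
    rwa [e] at h
  have hle : ∀ x ∈ X, ∀ y ∈ Y, f x y ≤ phiMax f Y x := by
    intro x hx y hy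
    refine le_csSup ⟨C, ?_⟩ ⟨y, hy, rfl⟩
    rintro _ ⟨y', hy', rfl⟩
    exact (hbound x hx y' hy').2
  have hub : ∀ x b, (∀ y ∈ Y, f x y ≤ b) → phiMax f Y x ≤ b := by
    intro x b h
    refine csSup_le (hYne.image _) ?_
    rintro _ ⟨y', hy', rfl⟩
    exact h y' hy'
  have h0φ : ∀ x ∈ X, 0 ≤ phiMax f Y x := by
    intro x hx
    obtain ⟨y, hy⟩ := hYne
    exact (hbound x hx y hy).1.trans (hle x hx y hy)
  have hφL : ∀ x ∈ X, ∀ x' ∈ X, phiMax f Y x ≤ phiMax f Y x' + L * ‖x - x'‖ := by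
    intro x hx x' hx'
    apply hub
    intro y hy
    have := le_of_abs_le (hLx y hy x hx x' hx')
    linarith [hle x' hx' y hy]
  have hcont : ContinuousOn (phiMax f Y) X := by
    have : LipschitzOnWith (Real.toNNReal L) (phiMax f Y) X := by
      apply LipschitzOnWith.of_le_add_mul
      intro x hx x' hx'
      rw [Real.coe_toNNReal _ hL.le, dist_eq_norm]
      exact hφL x hx x' hx'
    exact this.continuousOn
  have hprox : ∀ u, ∃ p ∈ X, ∀ x' ∈ X, phiMax f Y p + l * ‖u - p‖ ^ 2 ≤
        phiMax f Y x' + l * ‖u - x'‖ ^ 2 := by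
    intro u
    obtain ⟨p, hp, h⟩ := hXcomp.exists_isMinOn hXne
      (f := fun x' => phiMax f Y x' + l * ‖u - x'‖ ^ 2)
      (hcont.add (by fun_prop))
    exact ⟨p, hp, fun x' hx' => h hx'⟩
  have hxX : ∀ t, xs t ∈ X := by
    intro t
    cases t with
    | zero => exact hx0
    | succ t => exact (hxs t).1
  choose p hpX hp using fun t => hprox (xs t)
  have hη0 : 0 < η := by rw [hη]; positivity
  -- strong convexity
  have hstrong : ∀ t, phiMax f Y (p t) + 3 / 2 * l * ‖xs t - p t‖ ^ 2 ≤ phiMax f Y (xs t) := by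
    intro t
    apply aux_limit _ _ (l / 2 * ‖xs t - p t‖ ^ 2)
    intro s h0 h1
    have hm : p t + s • (xs t - p t) ∈ X := hXconv.add_smul_sub_mem (hpX t) (hxX t) ⟨h0.le, h1⟩
    have hw : phiMax f Y (p t + s • (xs t - p t)) ≤ (1 - s) * phiMax f Y (p t)
        + s * phiMax f Y (xs t) + l / 2 * (s * (1 - s)) * ‖xs t - p t‖ ^ 2 := by
      apply hub
      intro y hy
      have h2 := aux_weak X hXconv (fun u => f u y) (fun x => gradient (fun u => f u y) x) l
        (hG y hy) (hS y hy) (p t) (xs t) (hpX t) (hxX t) s h0.le h1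
      have h3 := mul_le_mul_of_nonneg_left (hle _ (hpX t) y hy) (sub_nonneg.2 h1)
      have h4 := mul_le_mul_of_nonneg_left (hle _ (hxX t) y hy) h0.le
      linarith
    have h5 := hp t _ hm
    have e : xs t - (p t + s • (xs t - p t)) = (1 - s) • (xs t - p t) := by module
    rw [e, norm_smul, mul_pow, Real.norm_eq_abs, sq_abs] at h5
    have : s * (phiMax f Y (p t) + 3 / 2 * l * ‖xs t - p t‖ ^ 2) ≤
      s * (phiMax f Y (xs t) + s * (l / 2 * ‖xs t - p t‖ ^ 2)) := by nlinarith
    exact le_of_mul_le_mul_left this h0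
  have hstep : ∀ t, phiMax f Y (p (t + 1)) + l * ‖xs (t + 1) - p (t + 1)‖ ^ 2 ≤
      phiMax f Y (p t) + l * ‖xs t - p t‖ ^ 2 + l * (η ^ 2 * L ^ 2)
        - 2 * η * l ^ 2 * ‖xs t - p t‖ ^ 2 := by
    intro t
    obtain ⟨hyY, hymax⟩ := hys t
    have hd := aux_dir X hXconv (fun u => f u (ys (t + 1)))
      (fun x => gradient (fun u => f u (ys (t + 1))) x) l L (hG _ hyY) (hS _ hyY) (hLx _ hyY)
      (xs t) (xs (t + 1)) (hxX t) (hxX (t + 1))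
    have h1 := aux_step X hXconv (xs t) _ (xs (t + 1)) (p t) η L hη0.le (hxX (t + 1)) (hpX t)
      (hxs t).2 hd
    have h2 := aux_lower X hXconv (fun u => f u (ys (t + 1)))
      (fun x => gradient (fun u => f u (ys (t + 1))) x) l (hG _ hyY) (hS _ hyY)
      (xs t) (p t) (hxX t) (hpX t)
    have h3 := hub (xs t) _ hymax
    have h4 := hle (p t) (hpX t) _ hyY
    have h5 := hstrong t
    have h6 := hp (t + 1) (p t) (hpX t)
    rw [norm_sub_rev (p t) (xs t)] at h2
    generalize inner ℝ (gradient (fun u => f u (ys (t + 1))) (xs t)) (p t - xs t) = I at *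
    have h7 : I ≤ -(l * ‖xs t - p t‖ ^ 2) := by linarith
    have h8 := mul_le_mul_of_nonneg_left h7 (mul_pos (mul_pos two_pos hη0) hl).le
    have h9 := mul_le_mul_of_nonneg_left h1 hl.le
    linarith
  by_contra hcon
  push Not at hcon
  have hbig : ∀ t < T, ε < ‖xs t - p t‖ := fun t ht => hcon t ht (p t) (hpX t) (hp t)
  have hdec : ∀ t < T, phiMax f Y (p (t + 1)) + l * ‖xs (t + 1) - p (t + 1)‖ ^ 2 <
      phiMax f Y (p t) + l * ‖xs t - p t‖ ^ 2 - ε ^ 4 * l ^ 3 / L ^ 2 := by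
    intro t ht
    have h1 := hstep t
    have h2 : ε ^ 2 < ‖xs t - p t‖ ^ 2 := by
      have := hbig t ht
      gcongr
    have h3 := mul_lt_mul_of_pos_left h2 (show 0 < 2 * η * l ^ 2 by positivity)
    have e1 : l * (η ^ 2 * L ^ 2) = ε ^ 4 * l ^ 3 / L ^ 2 := by
      rw [hη]; field_simp
    have e2 : 2 * η * l ^ 2 * ε ^ 2 = 2 * (ε ^ 4 * l ^ 3 / L ^ 2) := by
      rw [hη]; field_simp
    linarith
  have hsum : ∀ t, t ≤ T → 0 < t → phiMax f Y (p t) + l * ‖xs t - p t‖ ^ 2 <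
      phiMax f Y (p 0) + l * ‖xs 0 - p 0‖ ^ 2 - t * (ε ^ 4 * l ^ 3 / L ^ 2) := by
    intro t
    induction t with
    | zero => intro _ h; exact absurd h (lt_irrefl 0)
    | succ t ih =>
      intro h1 _
      have h2 := hdec t h1
      rcases Nat.eq_zero_or_pos t with h | h
      · subst h
        push_cast
        linarith
      · have := ih (by omega) h
        push_cast
        linarith
  have hfin := hsum T le_rfl hTpos
  have hlow : 0 ≤ phiMax f Y (p T) + l * ‖xs T - p T‖ ^ 2 :=
    add_nonneg (h0φ _ (hpX T)) (by positivity)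
  have hup : phiMax f Y (p 0) + l * ‖xs 0 - p 0‖ ^ 2 ≤ C := by
    have h1 := hp 0 (xs 0) hx0
    have h2 := hub (xs 0) C (fun y hy => (hbound _ hx0 y hy).2)
    simp only [sub_self, norm_zero] at h1
    linarith
  have hTC : C ≤ T * (ε ^ 4 * l ^ 3 / L ^ 2) := by
    rw [div_le_iff₀ (by positivity)] at hT
    rw [← mul_div_assoc, le_div_iff₀ (by positivity)]
    exact hT
  linarith
end

section
/- Let X ⊆ ℝ^d and Y ⊆ ℝ^m be nonempty convex compact sets, and let f : ℝ^d × ℝ^m → ℝ be differentiable on an open neighborhood of X×Y, L-Lipschitz and ℓ-smooth on X×Y (L, ℓ > 0), with 0 ≤ f ≤ C on X×Y for some C > 0. Fix ε > 0, set η := ε²·ℓ/L², and let T be a positive integer with T ≥ C·L²/(ε⁴·ℓ³). Then among the GDmax iterates x^(0), …, x^(T−1) with learning rate η, at least half of the indices t ∈ {0,…,T−1} (i.e., at least ⌈T/2⌉ of them) satisfy ‖x^(t) − prox_{φ/(2ℓ)}(x^(t))‖ ≤ √2·ε. Consequently, a uniformly random index from {0,…,T−1} is √2·ε-nearly stationary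 with probability at least 1/2, and for any δ > 0, among ⌈log₂(1/δ)⌉ independently uniformly drawn indices, with probability at least 1−δ at least one index t' satisfies ‖x^(t') − prox_{φ/(2ℓ)}(x^(t'))‖ ≤ √2·ε. -/
theorem aux_desc {d : ℕ} (X : Set (EuclideanSpace ℝ (Fin d))) (hXconv : Convex ℝ X)
    (g : EuclideanSpace ℝ (Fin d) → ℝ) (l : ℝ)
    (hd : ∀ x ∈ X, DifferentiableAt ℝ g x)
    (hs : ∀ x ∈ X, ∀ x' ∈ X, ‖gradient g x - gradient g x'‖ ≤ l * ‖x - x'‖)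
    (x x' : EuclideanSpace ℝ (Fin d)) (hx : x ∈ X) (hx' : x' ∈ X) :
    g x + inner ℝ (gradient g x) (x' - x) - l / 2 * ‖x' - x‖ ^ 2 ≤ g x' := by
  set v := x' - x with hv
  have hmem : ∀ s ∈ Set.Icc (0:ℝ) 1, x + s • v ∈ X := fun s hs =>
    hXconv.add_smul_sub_mem hx hx' hs
  have hder : ∀ s ∈ Set.Icc (0:ℝ) 1, HasDerivAt (fun s : ℝ => g (x + s • v) -
      s * inner ℝ (gradient g x) v + l / 2 * ‖v‖ ^ 2 * s ^ 2)
      (inner ℝ (gradient g (x + s • v)) v - inner ℝ (gradient g x) v + l * ‖v‖ ^ 2 * s) s := by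
    intro s hs
    have h1 := (hd _ (hmem s hs)).hasGradientAt.hasFDerivAt
    have h2 : HasDerivAt (fun s : ℝ => x + s • v) v s := by
      simpa using ((hasDerivAt_id s).smul_const v).const_add x
    have h3 := h1.comp_hasDerivAt s h2
    simp only [InnerProductSpace.toDual_apply_apply] at h3
    have h4 := (h3.sub ((hasDerivAt_id s).mul_const (inner ℝ (gradient g x) v))).add
      (((hasDerivAt_id s).pow 2).const_mul (l / 2 * ‖v‖ ^ 2))
    refine h4.congr_deriv ?_
    simp
    ring
  have hmono : MonotoneOn (fun s : ℝ => g (x + s • v) -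
      s * inner ℝ (gradient g x) v + l / 2 * ‖v‖ ^ 2 * s ^ 2) (Set.Icc 0 1) := by
    apply monotoneOn_of_deriv_nonneg (convex_Icc 0 1)
    · exact fun s hs => (hder s hs).continuousAt.continuousWithinAt
    · exact fun s hs => (hder s (interior_subset hs)).differentiableAt.differentiableWithinAt
    · intro s hs'
      have hs1 := interior_subset hs'
      rw [(hder s hs1).deriv, ← inner_sub_left]
      have h5 := abs_le.1 (abs_real_inner_le_norm (gradient g (x + s • v) - gradient g x) v)
      have h6 := hs _ (hmem s hs1) x hx
      have h7 : ‖x + s • v - x‖ = s * ‖v‖ := by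
        rw [add_sub_cancel_left, norm_smul, Real.norm_of_nonneg hs1.1]
      rw [h7] at h6
      have h8 := mul_le_mul_of_nonneg_right h6 (norm_nonneg v)
      nlinarith [h5.1]
  have := hmono (Set.left_mem_Icc.2 zero_le_one) (Set.right_mem_Icc.2 zero_le_one) zero_le_one
  have e : x + v = x' := by simp [hv]
  simp only [zero_smul, one_smul, e, add_zero] at this
  linarith

theorem aux_lip {d : ℕ} (X : Set (EuclideanSpace ℝ (Fin d))) (hXconv : Convex ℝ X)
    (g : EuclideanSpace ℝ (Fin d) → ℝ) (L : ℝ)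
    (hs : ∀ x ∈ X, ∀ x' ∈ X, |g x - g x'| ≤ L * ‖x - x'‖)
    (x x' : EuclideanSpace ℝ (Fin d)) (hd : DifferentiableAt ℝ g x) (hx : x ∈ X) (hx' : x' ∈ X) :
    - (L * ‖x' - x‖) ≤ inner ℝ (gradient g x) (x' - x) := by
  set v := x' - x with hv
  have hmem : ∀ s ∈ Set.Icc (0:ℝ) 1, x + s • v ∈ X := fun s hs =>
    hXconv.add_smul_sub_mem hx hx' hs
  have h1 := hd.hasGradientAt.hasFDerivAt
  have h2 : HasDerivAt (fun s : ℝ => x + s • v) v 0 := by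
    simpa using ((hasDerivAt_id (0:ℝ)).smul_const v).const_add x
  have h0 : x + (0:ℝ) • v = x := by simp
  rw [← h0] at h1
  have h3 := h1.comp_hasDerivAt (0:ℝ) h2
  rw [h0] at h3
  simp only [InnerProductSpace.toDual_apply_apply] at h3
  have h4 := hasDerivWithinAt_iff_tendsto_slope.1 (h3.hasDerivWithinAt (s := Set.Ioi 0))
  rw [Set.diff_singleton_eq_self (by simp)] at h4
  refine ge_of_tendsto h4 ?_
  filter_upwards [Ioo_mem_nhdsGT (zero_lt_one' ℝ)] with s hs1
  have h6 := hs _ (hmem s ⟨hs1.1.le, hs1.2.le⟩) x hx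
  have h7 : ‖x + s • v - x‖ = s * ‖v‖ := by
    rw [add_sub_cancel_left, norm_smul, Real.norm_of_nonneg hs1.1.le]
  rw [h7] at h6
  simp only [slope_def_field, Function.comp, zero_smul, add_zero, sub_zero]
  rw [le_div_iff₀ hs1.1]
  nlinarith [(abs_le.1 h6).1]

theorem aux_proj_s2 {d : ℕ} (X : Set (EuclideanSpace ℝ (Fin d))) (hXconv : Convex ℝ X)
    (x p g z : EuclideanSpace ℝ (Fin d)) (η L : ℝ) (hη : 0 < η) (hp : p ∈ X) (hz : z ∈ X)
    (hmin : ∀ x' ∈ X, ‖p - (x - η • g)‖ ≤ ‖x' - (x - η • g)‖)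
    (hg : - (L * ‖p - x‖) ≤ inner ℝ g (p - x)) :
    ‖p - z‖ ^ 2 ≤ ‖x - z‖ ^ 2 + 2 * η * inner ℝ g (z - x) + η ^ 2 * L ^ 2 := by
  have hin : inner ℝ ((x - η • g) - p) (z - p) ≤ 0 := by
    have hne : Nonempty X := ⟨⟨p, hp⟩⟩
    refine (norm_eq_iInf_iff_real_inner_le_zero hXconv hp).1 ?_ z hz
    apply le_antisymm
    · exact le_ciInf fun w => by
        rw [norm_sub_rev, norm_sub_rev _ (w : EuclideanSpace ℝ (Fin d))]; exact hmin w w.2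
    · exact ciInf_le ⟨0, by rintro _ ⟨w, rfl⟩; exact norm_nonneg _⟩ (⟨p, hp⟩ : X)
  have e1 : ‖x - z‖ ^ 2 = ‖p - x‖ ^ 2 + ‖p - z‖ ^ 2 - 2 * inner ℝ (p - x) (p - z) := by
    have : x - z = (p - z) - (p - x) := by abel
    rw [this, norm_sub_sq_real, real_inner_comm]; ring
  have e2 : inner ℝ ((x - η • g) - p) (z - p) = inner ℝ (p - x) (p - z)
      - η * (inner ℝ g (z - x) - inner ℝ g (p - x)) := by
    have a : (x - η • g) - p = - (p - x) - η • g := by abel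
    have b : z - p = - (p - z) := by abel
    have c : inner ℝ g (z - x) - inner ℝ g (p - x) = inner ℝ g (z - p) := by
      rw [← inner_sub_right]; congr 1; abel
    rw [c, a, inner_sub_left, inner_smul_left, b, inner_neg_left, inner_neg_right, inner_neg_right]
    simp only [conj_trivial]
    ring
  nlinarith [sq_nonneg (‖p - x‖ - η * L), mul_le_mul_of_nonneg_left hg hη.le]

/-- Under the GDmax setup, at least half of the indices
`t ∈ {0, …, T−1}` (at least `⌈T/2⌉` of them) give `√2·ε`-nearly stationary iterates.
Consequently a uniformly random index is good with probability at least `1/2`, and among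
`⌈log₂(1/δ)⌉` independent uniform draws, at least one is good with probability at least
`1 − δ` (failure probability `((T − |good|)/T)^{⌈log₂(1/δ)⌉} ≤ δ`). -/
theorem gdmax_random_iterate_nearly_stationary
    {d m : ℕ}
    (X : Set (EuclideanSpace ℝ (Fin d))) (Y : Set (EuclideanSpace ℝ (Fin m)))
    (hXne : X.Nonempty) (hXconv : Convex ℝ X) (hXcomp : IsCompact X)
    (hYne : Y.Nonempty) (hYconv : Convex ℝ Y) (hYcomp : IsCompact Y)
    (f : EuclideanSpace ℝ (Fin d) → EuclideanSpace ℝ (Fin m) → ℝ)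
    (L l C : ℝ) (hL : 0 < L) (hl : 0 < l) (hC : 0 < C)
    (hdiff : ∃ U : Set (EuclideanSpace ℝ (Fin d) × EuclideanSpace ℝ (Fin m)),
      IsOpen U ∧ X ×ˢ Y ⊆ U ∧ DifferentiableOn ℝ (fun p => f p.1 p.2) U)
    (hLip : ∀ x ∈ X, ∀ x' ∈ X, ∀ y ∈ Y, ∀ y' ∈ Y,
      |f x y - f x' y'| ≤ L * Real.sqrt (‖x - x'‖ ^ 2 + ‖y - y'‖ ^ 2))
    (hSmooth : ∀ x ∈ X, ∀ x' ∈ X, ∀ y ∈ Y, ∀ y' ∈ Y,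
      Real.sqrt (‖gradient (fun u => f u y) x - gradient (fun u => f u y') x'‖ ^ 2
          + ‖gradient (fun v => f x v) y - gradient (fun v => f x' v) y'‖ ^ 2)
        ≤ l * Real.sqrt (‖x - x'‖ ^ 2 + ‖y - y'‖ ^ 2))
    (hbound : ∀ x ∈ X, ∀ y ∈ Y, 0 ≤ f x y ∧ f x y ≤ C)
    (ε : ℝ) (hε : 0 < ε)
    (η : ℝ) (hη : η = ε ^ 2 * l / L ^ 2)
    (T : ℕ) (hTpos : 0 < T) (hT : C * L ^ 2 / (ε ^ 4 * l ^ 3) ≤ (T : ℝ))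
    (xs : ℕ → EuclideanSpace ℝ (Fin d)) (ys : ℕ → EuclideanSpace ℝ (Fin m))
    (hx0 : xs 0 ∈ X)
    (hys : ∀ t, ys (t + 1) ∈ Y ∧ ∀ y' ∈ Y, f (xs t) y' ≤ f (xs t) (ys (t + 1)))
    (hxs : ∀ t, xs (t + 1) ∈ X ∧ ∀ x' ∈ X,
      ‖xs (t + 1) - (xs t - η • gradient (fun u => f u (ys (t + 1))) (xs t))‖ ≤
        ‖x' - (xs t - η • gradient (fun u => f u (ys (t + 1))) (xs t))‖) :
    ∃ goodSet : Finset ℕ, goodSet ⊆ Finset.range T ∧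
      (∀ t ∈ goodSet, ∃ xt ∈ X,
        (∀ x' ∈ X, phiMax f Y xt + l * ‖xs t - xt‖ ^ 2 ≤
          phiMax f Y x' + l * ‖xs t - x'‖ ^ 2) ∧
        ‖xs t - xt‖ ≤ Real.sqrt 2 * ε) ∧
      ⌈(T : ℝ) / 2⌉₊ ≤ goodSet.card ∧
      (1 : ℝ) / 2 ≤ (goodSet.card : ℝ) / (T : ℝ) ∧
      ∀ δ : ℝ, 0 < δ →
        (((T : ℝ) - (goodSet.card : ℝ)) / (T : ℝ)) ^ ⌈Real.logb 2 (1 / δ)⌉₊ ≤ δ := by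
  obtain ⟨U, hUo, hUs, hUd⟩ := hdiff
  have hη0 : 0 < η := by rw [hη]; positivity
  have hxX : ∀ t, xs t ∈ X := by
    intro t; cases t with
    | zero => exact hx0
    | succ t => exact (hxs t).1
  have hD : ∀ y ∈ Y, ∀ x ∈ X, DifferentiableAt ℝ (fun u => f u y) x := by
    intro y hy x hx
    have h1 : DifferentiableAt ℝ (fun p : EuclideanSpace ℝ (Fin d) × EuclideanSpace ℝ (Fin m) =>
      f p.1 p.2) (x, y) := hUd.differentiableAt (hUo.mem_nhds (hUs ⟨hx, hy⟩))
    exact h1.comp x (f := fun u : EuclideanSpace ℝ (Fin d) => (u, y)) (by fun_prop)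
  have hLx : ∀ y ∈ Y, ∀ x ∈ X, ∀ x' ∈ X, |f x y - f x' y| ≤ L * ‖x - x'‖ := by
    intro y hy x hx x' hx'
    have := hLip x hx x' hx' y hy y hy
    simpa [Real.sqrt_sq (norm_nonneg _)] using this
  have hSx : ∀ y ∈ Y, ∀ x ∈ X, ∀ x' ∈ X,
      ‖gradient (fun u => f u y) x - gradient (fun u => f u y) x'‖ ≤ l * ‖x - x'‖ := by
    intro y hy x hx x' hx'
    have := hSmooth x hx x' hx' y hy y hy
    simp only [sub_self, norm_zero, ne_eq, OfNat.ofNat_ne_zero, not_false_eq_true, zero_pow,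
      add_zero, Real.sqrt_sq (norm_nonneg (x - x'))] at this
    refine le_trans ?_ this
    apply Real.le_sqrt_of_sq_le
    nlinarith [sq_nonneg ‖gradient (fun v => f x v) y - gradient (fun v => f x' v) y‖]
  have hdesc : ∀ y ∈ Y, ∀ x ∈ X, ∀ x' ∈ X, f x y + inner ℝ (gradient (fun u => f u y) x) (x' - x)
      - l / 2 * ‖x' - x‖ ^ 2 ≤ f x' y := fun y hy x hx x' hx' =>
    aux_desc X hXconv (fun u => f u y) l (hD y hy) (hSx y hy) x x' hx hx'
  have hbdd : ∀ x ∈ X, BddAbove ((fun y => f x y) '' Y) := by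
    intro x hx
    exact ⟨C, by rintro _ ⟨y, hy, rfl⟩; exact (hbound x hx y hy).2⟩
  have hle : ∀ x ∈ X, ∀ y ∈ Y, f x y ≤ phiMax f Y x := fun x hx y hy =>
    le_csSup (hbdd x hx) ⟨y, hy, rfl⟩
  have hub : ∀ x B, (∀ y ∈ Y, f x y ≤ B) → phiMax f Y x ≤ B := by
    intro x B h
    exact csSup_le (hYne.image _) (by rintro _ ⟨y, hy, rfl⟩; exact h y hy)
  have hphi0 : ∀ x ∈ X, 0 ≤ phiMax f Y x := by
    intro x hx
    obtain ⟨y, hy⟩ := hYne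
    exact (hbound x hx y hy).1.trans (hle x hx y hy)
  have hphit : ∀ t, phiMax f Y (xs t) = f (xs t) (ys (t+1)) := fun t =>
    le_antisymm (hub _ _ (hys t).2) (hle _ (hxX t) _ (hys t).1)
  have hphiL : ∀ x ∈ X, ∀ x' ∈ X, phiMax f Y x ≤ phiMax f Y x' + L * ‖x - x'‖ := by
    intro x hx x' hx'
    apply hub
    intro y hy
    have := (abs_le.1 (hLx y hy x hx x' hx')).2
    linarith [hle x' hx' y hy]
  have hcont : ContinuousOn (phiMax f Y) X := by
    have : LipschitzOnWith ⟨L, hL.le⟩ (phiMax f Y) X := by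
      apply LipschitzOnWith.of_le_add_mul
      intro x hx y hy
      rw [dist_eq_norm]
      exact hphiL x hx y hy
    exact this.continuousOn
  have hex : ∀ t, ∃ xt ∈ X, ∀ x' ∈ X, phiMax f Y xt + l * ‖xs t - xt‖ ^ 2 ≤
          phiMax f Y x' + l * ‖xs t - x'‖ ^ 2 := by
    intro t
    have hc : ContinuousOn (fun x => phiMax f Y x + l * ‖xs t - x‖ ^ 2) X :=
      hcont.add (by fun_prop)
    obtain ⟨xt, h1, h2⟩ := hXcomp.exists_isMinOn hXne hc
    exact ⟨xt, h1, fun x' hx' => h2 hx'⟩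
  choose p hpX hpmin using hex
  -- growth
  have hgrow : ∀ t, phiMax f Y (p t) + 3 / 2 * l * ‖xs t - p t‖ ^ 2 ≤ phiMax f Y (xs t) := by
    intro t
    set r := ‖xs t - p t‖ with hr
    have key : ∀ s ∈ Set.Ioo (0:ℝ) 1, phiMax f Y (p t) + 3 / 2 * l * r ^ 2 ≤
        phiMax f Y (xs t) + s * (l / 2 * r ^ 2) := by
      intro s hs
      have hzX : p t + s • (xs t - p t) ∈ X :=
        hXconv.add_smul_sub_mem (hpX t) (hxX t) ⟨hs.1.le, hs.2.le⟩
      set z := p t + s • (xs t - p t) with hz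
      have e1 : p t - z = - (s • (xs t - p t)) := by rw [hz]; abel
      have e2 : xs t - z = (1 - s) • (xs t - p t) := by rw [hz, sub_smul, one_smul]; abel
      have n1 : ‖p t - z‖ = s * r := by
        rw [e1, norm_neg, norm_smul, Real.norm_of_nonneg hs.1.le]
      have n2 : ‖xs t - z‖ = (1 - s) * r := by
        rw [e2, norm_smul, Real.norm_of_nonneg (by linarith [hs.2])]
      have hw : phiMax f Y z ≤ (1 - s) * phiMax f Y (p t) + s * phiMax f Y (xs t)
          + l / 2 * s * (1 - s) * r ^ 2 := by
        apply hub
        intro y hy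
        have a1 := hdesc y hy z hzX (p t) (hpX t)
        have a2 := hdesc y hy z hzX (xs t) (hxX t)
        rw [n1, e1, inner_neg_right, inner_smul_right] at a1
        rw [n2, e2, inner_smul_right] at a2
        have b1 := mul_le_mul_of_nonneg_left (a1.trans (hle _ (hpX t) y hy)) (by linarith [hs.2] : 0 ≤ 1 - s)
        have b2 := mul_le_mul_of_nonneg_left (a2.trans (hle _ (hxX t) y hy)) hs.1.le
        linarith
      have hm := hpmin t z hzX
      rw [n2, ← hr] at hm
      have : s * (phiMax f Y (p t) + 3 / 2 * l * r ^ 2) ≤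
        s * (phiMax f Y (xs t) + s * (l / 2 * r ^ 2)) := by linarith
      exact le_of_mul_le_mul_left this hs.1
    have ht : Filter.Tendsto (fun s : ℝ => phiMax f Y (xs t) + s * (l / 2 * r ^ 2))
        (nhdsWithin 0 (Set.Ioi 0)) (nhds (phiMax f Y (xs t) + 0 * (l / 2 * r ^ 2))) := by
      apply Filter.Tendsto.mono_left _ nhdsWithin_le_nhds
      exact Continuous.tendsto (by fun_prop) 0
    have := ge_of_tendsto ht (Filter.mem_of_superset (Ioo_mem_nhdsGT (zero_lt_one' ℝ)) key)
    linarith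
  let M : ℕ → ℝ := fun t => phiMax f Y (p t) + l * ‖xs t - p t‖ ^ 2
  have hstep : ∀ t, M (t + 1) + 2 * η * l ^ 2 * ‖xs t - p t‖ ^ 2 ≤ M t + l * η ^ 2 * L ^ 2 := by
    intro t
    have h1 := hpmin (t + 1) (p t) (hpX t)
    have hyY := (hys t).1
    have h2 := aux_proj_s2 X hXconv (xs t) (xs (t+1)) _ (p t) η L hη0 (hxX (t+1)) (hpX t) (hxs t).2
      (aux_lip X hXconv (fun u => f u (ys (t+1))) L (hLx _ hyY) (xs t) (xs (t+1))
        (hD _ hyY _ (hxX t)) (hxX t) (hxX (t+1)))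
    have h3 := hdesc _ hyY (xs t) (hxX t) (p t) (hpX t)
    rw [← hphit t, norm_sub_rev] at h3
    have h4 := hle (p t) (hpX t) _ hyY
    have h5 := hgrow t
    have h6 : inner ℝ (gradient (fun u => f u (ys (t+1))) (xs t)) (p t - xs t) ≤
      - (l * ‖xs t - p t‖ ^ 2) := by linarith
    have h7 := mul_le_mul_of_nonneg_left h2 hl.le
    have h8 := mul_le_mul_of_nonneg_left h6 (by positivity : 0 ≤ 2 * η * l)
    show phiMax f Y (p (t+1)) + l * ‖xs (t+1) - p (t+1)‖ ^ 2 + _ ≤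
      phiMax f Y (p t) + l * ‖xs t - p t‖ ^ 2 + _
    linarith
  have hsum : ∀ n : ℕ, M n + 2 * η * l ^ 2 * ∑ t ∈ Finset.range n, ‖xs t - p t‖ ^ 2 ≤
      M 0 + n * (l * η ^ 2 * L ^ 2) := by
    intro n
    induction n with
    | zero => simp
    | succ n ih =>
      rw [Finset.sum_range_succ]; push_cast
      linarith [hstep n]
  have hM0 : M 0 ≤ C := by
    have h := hpmin 0 (xs 0) hx0
    simp only [sub_self, norm_zero, ne_eq, OfNat.ofNat_ne_zero, not_false_eq_true, zero_pow,
      mul_zero, add_zero] at h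
    exact h.trans (hub _ _ fun y hy => (hbound _ hx0 y hy).2)
  have hMT : 0 ≤ M T := add_nonneg (hphi0 _ (hpX T)) (by positivity)
  have hTR : (0:ℝ) < T := by exact_mod_cast hTpos
  have hS : ∑ t ∈ Finset.range T, ‖xs t - p t‖ ^ 2 ≤ T * ε ^ 2 := by
    have h1 := hsum T
    have h2 : C ≤ T * (η * l ^ 2 * ε ^ 2) := by
      rw [div_le_iff₀ (by positivity)] at hT
      have : T * (η * l ^ 2 * ε ^ 2) = T * (ε ^ 4 * l ^ 3) / L ^ 2 := by rw [hη]; ring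
      rw [this, le_div_iff₀ (by positivity)]
      exact hT
    have h3 : l * η ^ 2 * L ^ 2 = η * l ^ 2 * ε ^ 2 := by rw [hη]; field_simp
    rw [h3] at h1
    have h4 : 2 * η * l ^ 2 * ∑ t ∈ Finset.range T, ‖xs t - p t‖ ^ 2 ≤
      2 * η * l ^ 2 * (T * ε ^ 2) := by linarith
    exact le_of_mul_le_mul_left h4 (by positivity)
  classical
  let G := (Finset.range T).filter fun t => ‖xs t - p t‖ ^ 2 ≤ 2 * ε ^ 2
  let B := (Finset.range T).filter fun t => ¬ ‖xs t - p t‖ ^ 2 ≤ 2 * ε ^ 2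
  have hcard : G.card + B.card = T := by
    have := Finset.card_filter_add_card_filter_not (s := Finset.range T)
      (fun t => ‖xs t - p t‖ ^ 2 ≤ 2 * ε ^ 2)
    rw [Finset.card_range] at this
    exact this
  have hB : (B.card : ℝ) * (2 * ε ^ 2) ≤ T * ε ^ 2 := by
    refine le_trans ?_ hS
    calc (B.card : ℝ) * (2 * ε ^ 2) = ∑ t ∈ B, 2 * ε ^ 2 := by simp
      _ ≤ ∑ t ∈ B, ‖xs t - p t‖ ^ 2 :=
        Finset.sum_le_sum fun t ht => (not_le.1 (Finset.mem_filter.1 ht).2).le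
      _ ≤ _ := Finset.sum_le_sum_of_subset_of_nonneg (Finset.filter_subset _ _)
        fun _ _ _ => by positivity
  have hB2 : (B.card : ℝ) * 2 ≤ T := by
    have : (B.card : ℝ) * 2 * ε ^ 2 ≤ T * ε ^ 2 := by linarith
    exact le_of_mul_le_mul_right this (by positivity)
  have hcR : (G.card : ℝ) + B.card = T := by exact_mod_cast hcard
  have hG : (T : ℝ) / 2 ≤ G.card := by linarith
  have hhalf : (1:ℝ) / 2 ≤ (G.card : ℝ) / T := by
    rw [le_div_iff₀ hTR]; linarith
  refine ⟨G, Finset.filter_subset _ _, ?_, Nat.ceil_le.2 hG, hhalf, ?_⟩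
  · intro t ht
    refine ⟨p t, hpX t, hpmin t, ?_⟩
    have h := (Finset.mem_filter.1 ht).2
    apply le_of_sq_le_sq _ (by positivity)
    rw [mul_pow, Real.sq_sqrt (by norm_num)]
    exact h
  · intro δ hδ
    have hq : ((T : ℝ) - G.card) / T ≤ 1 / 2 := by
      rw [sub_div, div_self hTR.ne']; linarith
    have hq0 : 0 ≤ ((T : ℝ) - G.card) / T := by
      apply div_nonneg _ hTR.le
      have : (0:ℝ) ≤ B.card := Nat.cast_nonneg _
      linarith
    refine (pow_le_pow_left₀ hq0 hq _).trans ?_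
    have h1 := Nat.le_ceil (Real.logb 2 (1 / δ))
    rw [Real.logb_le_iff_le_rpow (by norm_num) (by positivity), Real.rpow_natCast] at h1
    rw [one_div_pow]
    rw [div_le_iff₀ hδ] at h1
    rw [div_le_iff₀ (by positivity)]
    linarith
end

section
/- Let an adversarial team Markov game be given, with L := √(A₁+⋯+Aₙ+B)/(1−γ)², ℓ := 2(A₁+⋯+Aₙ+B)/(1−γ)³, c₂ := (1/(1−γ))·(√(A₁+⋯+Aₙ) + γ·S·√(A₁+⋯+Aₙ)/(1−γ) + γ·S·L + L) and c₁ := 4ℓ + c₂. Let x̂ be an ε-nearly stationary point of φ(x) := max over adversary policies y of V_ρ(x,y), and let v̂ ∈ ℝ^S be a minimizer of ρᵀv over {v ∈ ℝ^S : r(s,x̂,b) + γ·Σ_{s'} P(s'|s,x̂,b)·v(s') ≤ v(s) for all (s,b)}. Then there exists λ : S×B → ℝ with λ ≥ 0 satisfying: (i) for every team player k, every state s and every action a ∈ A_k, Σ_b λ(s,b)·[ r(s,(e_{k,a};x̂_{−k}),b) + γ·Σ_{s'} P(s'|s,(e_{k,a};x̂_{−k}),b)·v̂(s') − v̂(s)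 ] ≥ −c₁·ε; (ii) for every (s,b), −c₂·ε ≤ λ(s,b)·( r(s,x̂,b) + γ·Σ_{s'} P(s'|s,x̂,b)·v̂(s') − v̂(s) ) ≤ c₂·ε; (iii) ρ(s) ≤ Σ_b λ(s,b) ≤ 1/(1−γ) for every s. That is, the linear program LP_adv is feasible. -/
open Matrix

/-- An adversarial team Markov game. -/
structure AdvTeamGame where
  /-- finite state space -/
  S : Type
  [instSFintype : Fintype S]
  [instSNonempty : Nonempty S]
  [instSDecEq : DecidableEq S]
  /-- number of team players -/
  n : ℕ
  /-- action sets of the team players -/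
  A : Fin n → Type
  [instAFintype : ∀ k, Fintype (A k)]
  [instANonempty : ∀ k, Nonempty (A k)]
  [instADecEq : ∀ k, DecidableEq (A k)]
  /-- action set of the adversary -/
  B : Type
  [instBFintype : Fintype B]
  [instBNonempty : Nonempty B]
  /-- reward function (payoff of the adversary) -/
  r : S → (∀ k, A k) → B → ℝ
  r_pos : ∀ s a b, 0 < r s a b
  r_lt_one : ∀ s a b, r s a b < 1
  /-- transition probability function -/
  P : S → (∀ k, A k) → B → S → ℝ
  P_nonneg : ∀ s a b s', 0 ≤ P s a b s'
  P_sum_one : ∀ s a b, ∑ s', P s a b s' = 1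
  /-- discount factor -/
  γ : ℝ
  γ_nonneg : 0 ≤ γ
  γ_lt_one : γ < 1
  /-- full-support initial state distribution -/
  ρ : S → ℝ
  ρ_pos : ∀ s, 0 < ρ s
  ρ_sum_one : ∑ s, ρ s = 1

attribute [instance] AdvTeamGame.instSFintype AdvTeamGame.instSNonempty
  AdvTeamGame.instSDecEq AdvTeamGame.instAFintype AdvTeamGame.instANonempty
  AdvTeamGame.instADecEq AdvTeamGame.instBFintype AdvTeamGame.instBNonempty

namespace AdvTeamGame

variable (G : AdvTeamGame)

/-- A team policy: a probability vector over `A k` for each player `k` and state `s`. -/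
abbrev TeamPolicy := ∀ k : Fin G.n, G.S → G.A k → ℝ

/-- An adversary policy: a probability vector over `B` for each state `s`. -/
abbrev AdvPolicy := G.S → G.B → ℝ

def IsTeamPolicy (x : G.TeamPolicy) : Prop :=
  (∀ k s a, 0 ≤ x k s a) ∧ ∀ k s, ∑ a, x k s a = 1

def IsAdvPolicy (y : G.AdvPolicy) : Prop :=
  (∀ s b, 0 ≤ y s b) ∧ ∀ s, ∑ b, y s b = 1

/-- Expected reward `r(s, x, b)` at state `s` when the team plays `x` and the adversary `b`. -/
noncomputable def rTeam (s : G.S) (x : G.TeamPolicy) (b : G.B) : ℝ :=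
  ∑ a : ∀ k, G.A k, (∏ k, x k s (a k)) * G.r s a b

/-- Expected transition probability `P(s' | s, x, b)`. -/
noncomputable def PTeam (s : G.S) (x : G.TeamPolicy) (b : G.B) (s' : G.S) : ℝ :=
  ∑ a : ∀ k, G.A k, (∏ k, x k s (a k)) * G.P s a b s'

/-- Expected reward vector `r(x, y) ∈ ℝ^S` of a joint policy. -/
noncomputable def rVec (x : G.TeamPolicy) (y : G.AdvPolicy) : G.S → ℝ :=
  fun s => ∑ b, y s b * G.rTeam s x b

/-- Expected transition matrix `P(x, y) ∈ ℝ^{S×S}` of a joint policy. -/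
noncomputable def PMat (x : G.TeamPolicy) (y : G.AdvPolicy) : Matrix G.S G.S ℝ :=
  Matrix.of fun s s' => ∑ b, y s b * G.PTeam s x b s'

/-- Value function `V_ρ(x,y) = ρᵀ (I - γ P(x,y))⁻¹ r(x,y)`. -/
noncomputable def V (x : G.TeamPolicy) (y : G.AdvPolicy) : ℝ :=
  G.ρ ⬝ᵥ ((1 - G.γ • G.PMat x y)⁻¹ *ᵥ G.rVec x y)

/-- `φ(x) = max_y V_ρ(x,y)`, the best-response value of the adversary. -/
noncomputable def phi (x : G.TeamPolicy) : ℝ :=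
  sSup {v : ℝ | ∃ y, G.IsAdvPolicy y ∧ v = G.V x y}

/-- Euclidean norm of (the coordinates of) a team policy vector. -/
noncomputable def teamNorm (x : G.TeamPolicy) : ℝ :=
  Real.sqrt (∑ k, ∑ s, ∑ a, (x k s a) ^ 2)

/-- `A₁ + ⋯ + Aₙ` (sum of cardinalities of team action sets), as a real number. -/
noncomputable def totA : ℝ := ∑ k, (Fintype.card (G.A k) : ℝ)

/-- `S` (number of states), as a real number. -/
noncomputable def Scard : ℝ := (Fintype.card G.S : ℝ)

/-- `B` (number of adversary actions), as a real number. -/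
noncomputable def Bcard : ℝ := (Fintype.card G.B : ℝ)

/-- Lipschitz constant `L := √(A₁+⋯+Aₙ+B)/(1−γ)²`. -/
noncomputable def Lconst : ℝ := Real.sqrt (G.totA + G.Bcard) / (1 - G.γ) ^ 2

/-- Smoothness constant `ℓ := 2(A₁+⋯+Aₙ+B)/(1−γ)³`. -/
noncomputable def lconst : ℝ := 2 * (G.totA + G.Bcard) / (1 - G.γ) ^ 3

/-- `c₂ := (1/(1−γ))·(√(ΣA_k) + γ·S·√(ΣA_k)/(1−γ) + γ·S·L + L)`. -/
noncomputable def c2 : ℝ :=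
  (1 / (1 - G.γ)) *
    (Real.sqrt G.totA + G.γ * G.Scard * Real.sqrt G.totA / (1 - G.γ)
      + G.γ * G.Scard * G.Lconst + G.Lconst)

/-- `c₁ := 4ℓ + c₂`. -/
noncomputable def c1 : ℝ := 4 * G.lconst + G.c2

/-- `x̂` is an `ε`-nearly stationary point of `φ`: it is within distance `ε` of some
minimizer of `x' ↦ φ(x') + ℓ‖x̂ − x'‖²` over team policies. -/
def IsNearlyStationary (ε : ℝ) (xh : G.TeamPolicy) : Prop :=
  ∃ xt : G.TeamPolicy, G.IsTeamPolicy xt ∧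
    (∀ x' : G.TeamPolicy, G.IsTeamPolicy x' →
      G.phi xt + G.lconst * G.teamNorm (xh - xt) ^ 2 ≤
        G.phi x' + G.lconst * G.teamNorm (xh - x') ^ 2) ∧
    G.teamNorm (xh - xt) ≤ ε

/-- The team policy `(e_{k,a}; x_{−k})` in which player `k` deterministically plays `a`
and every other player follows `x`. -/
noncomputable def devPolicy (x : G.TeamPolicy) (k : Fin G.n) (a : G.A k) : G.TeamPolicy :=
  Function.update x k (fun _ a' => if a' = a then (1 : ℝ) else 0)

/-- Discounted state visitation measure `dᵀ = ρᵀ (I − γ P(x,y))⁻¹`. -/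
noncomputable def visitation (x : G.TeamPolicy) (y : G.AdvPolicy) : G.S → ℝ :=
  G.ρ ᵥ* (1 - G.γ • G.PMat x y)⁻¹

/-- The distribution mismatch coefficient `D`. -/
noncomputable def Dcoef : ℝ :=
  sSup {c : ℝ | ∃ x y, G.IsTeamPolicy x ∧ G.IsAdvPolicy y ∧
    c = ⨆ s, G.visitation x y s / G.ρ s}

end AdvTeamGame

section Generic

set_option linter.unusedSectionVars false

noncomputable def mE {n : ℕ} {A : Fin n → Type} [∀ k, Fintype (A k)]
    (p : ∀ k, A k → ℝ) (c : (∀ k, A k) → ℝ) : ℝ :=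
  ∑ a : ∀ k, A k, (∏ k, p k (a k)) * c a

def mProb {n : ℕ} {A : Fin n → Type} [∀ k, Fintype (A k)] (p : ∀ k, A k → ℝ) : Prop :=
  (∀ k a, 0 ≤ p k a) ∧ ∀ k, ∑ a, p k a = 1

noncomputable def dl {α : Type} [DecidableEq α] (a : α) : α → ℝ :=
  fun a' => if a' = a then (1 : ℝ) else 0

variable {n : ℕ} {A : Fin n → Type} [∀ k, Fintype (A k)] [∀ k, DecidableEq (A k)]

theorem mE_const {p : ∀ k, A k → ℝ} (hp : mProb p) (M : ℝ) : mE p (fun _ => M) = M := by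
  unfold mE
  rw [← Finset.sum_mul]
  have h := Finset.prod_univ_sum (fun k : Fin n => (Finset.univ : Finset (A k))) (fun k a => p k a)
  rw [Fintype.piFinset_univ] at h
  rw [← h]
  simp [hp.2]

theorem mE_mono {p : ∀ k, A k → ℝ} (hp : mProb p) {c d : (∀ k, A k) → ℝ}
    (h : ∀ a, c a ≤ d a) : mE p c ≤ mE p d := by
  unfold mE
  exact Finset.sum_le_sum fun a _ =>
    mul_le_mul_of_nonneg_left (h a) (Finset.prod_nonneg fun k _ => hp.1 k _)

theorem mE_abs {p : ∀ k, A k → ℝ} (hp : mProb p) {c : (∀ k, A k) → ℝ} {M : ℝ}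
    (h : ∀ a, |c a| ≤ M) : |mE p c| ≤ M := by
  rw [abs_le]
  constructor
  · rw [← mE_const hp (-M)]
    exact mE_mono hp fun a => (abs_le.1 (h a)).1
  · rw [← mE_const hp M]
    exact mE_mono hp fun a => (abs_le.1 (h a)).2

theorem mE_sub (p : ∀ k, A k → ℝ) (c d : (∀ k, A k) → ℝ) :
    mE p (fun a => c a - d a) = mE p c - mE p d := by
  simp [mE, mul_sub, Finset.sum_sub_distrib]

theorem prod_update_eq (p : ∀ k, A k → ℝ) (k : Fin n) (u : A k → ℝ) (a : ∀ k, A k) :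
    (∏ j, Function.update p k u j (a j)) = u (a k) * ∏ j ∈ Finset.univ.erase k, p j (a j) := by
  rw [← Finset.mul_prod_erase _ _ (Finset.mem_univ k)]
  congr 1
  · simp
  · refine Finset.prod_congr rfl fun j hj => ?_
    rw [Function.update_of_ne (Finset.ne_of_mem_erase hj)]

theorem mE_update (p : ∀ k, A k → ℝ) (k : Fin n) (u : A k → ℝ) (c : (∀ k, A k) → ℝ) :
    mE (Function.update p k u) c = ∑ a, u a * mE (Function.update p k (dl a)) c := by
  unfold mE
  simp_rw [prod_update_eq, Finset.mul_sum]
  rw [Finset.sum_comm]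
  refine Finset.sum_congr rfl fun a _ => ?_
  rw [Finset.sum_eq_single (a k)]
  · simp [dl]; ring
  · intro b _ hb
    simp [dl, hb.symm]
  · simp

theorem dl_nonneg {α : Type} [DecidableEq α] (a b : α) : 0 ≤ dl a b := by
  unfold dl; split_ifs <;> norm_num

theorem mProb_update {p : ∀ k, A k → ℝ} (hp : mProb p) (k : Fin n) {u : A k → ℝ}
    (h0 : ∀ a, 0 ≤ u a) (h1 : ∑ a, u a = 1) : mProb (Function.update p k u) := by
  constructor
  · intro j a
    by_cases h : j = k
    · subst h; simpa using h0 a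
    · rw [Function.update_of_ne h]; exact hp.1 j a
  · intro j
    by_cases h : j = k
    · subst h; simpa using h1
    · rw [Function.update_of_ne h]; exact hp.2 j

theorem mProb_dl {p : ∀ k, A k → ℝ} (hp : mProb p) (k : Fin n) (a : A k) :
    mProb (Function.update p k (dl a)) :=
  mProb_update hp k (dl_nonneg a) (by simp [dl])

theorem mE_lip {p p' : ∀ k, A k → ℝ} (hp : mProb p) (hp' : mProb p') {c : (∀ k, A k) → ℝ} {M : ℝ}
    (h : ∀ a, |c a| ≤ M) : |mE p c - mE p' c| ≤ M * ∑ k, ∑ a, |p k a - p' k a| := by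
  have key : ∀ T : Finset (Fin n), mProb (fun k => if k ∈ T then p k else p' k) ∧
      |mE (fun k => if k ∈ T then p k else p' k) c - mE p' c|
        ≤ M * ∑ k ∈ T, ∑ a, |p k a - p' k a| := by
    intro T
    induction T using Finset.induction_on with
    | empty => exact ⟨by simpa using hp', by simp⟩
    | insert k T hk ih =>
      obtain ⟨ih1, ih2⟩ := ih
      set q : ∀ k, A k → ℝ := fun k => if k ∈ T then p k else p' k with hq
      have e : (fun j => if j ∈ insert k T then p j else p' j) = Function.update q k (p k) := by
        funext j
        by_cases hj : j = k
        · subst hj; simp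
        · rw [Function.update_of_ne hj]; simp [hj, hq]
      have e2 : q = Function.update q k (p' k) := by
        have : q k = p' k := by simp [hq, hk]
        rw [← this, Function.update_eq_self]
      rw [e]
      refine ⟨mProb_update ih1 k (hp.1 k) (hp.2 k), ?_⟩
      have d : |mE (Function.update q k (p k)) c - mE q c| ≤ M * ∑ a, |p k a - p' k a| := by
        have : mE q c = mE (Function.update q k (p' k)) c := by rw [← e2]
        rw [this, mE_update q k (p k), mE_update q k (p' k), ← Finset.sum_sub_distrib,
          Finset.mul_sum]
        refine (Finset.abs_sum_le_sum_abs _ _).trans (Finset.sum_le_sum fun a _ => ?_)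
        rw [← sub_mul, abs_mul, mul_comm]
        exact mul_le_mul_of_nonneg_right (mE_abs (mProb_dl ih1 k a) h) (abs_nonneg _)
      rw [Finset.sum_insert hk, mul_add]
      exact (abs_sub_le _ (mE q c) _).trans (add_le_add d ih2)
  simpa using (key Finset.univ).2

theorem mE_hasDeriv (p d : ∀ k, A k → ℝ) (c : (∀ k, A k) → ℝ) :
    HasDerivAt (fun t : ℝ => mE (fun k a => p k a + t * d k a) c)
      (∑ k, mE (Function.update p k (d k)) c) 0 := by
  unfold mE
  rw [Finset.sum_comm]
  refine HasDerivAt.fun_sum fun a _ => ?_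
  rw [← Finset.sum_mul]
  refine HasDerivAt.mul_const ?_ _
  have := HasDerivAt.fun_finsetProd (u := Finset.univ) (x := (0:ℝ))
    (f := fun k t => p k (a k) + t * d k (a k)) (f' := fun k => d k (a k))
    (fun k _ => by
      simpa using ((hasDerivAt_id (0:ℝ)).mul_const (d k (a k))).const_add (p k (a k)))
  convert this using 1
  refine Finset.sum_congr rfl fun k _ => ?_
  rw [prod_update_eq]
  simp [mul_comm]

theorem gordan {ι E : Type} [Fintype ι] [Nonempty ι] [AddCommGroup E] [Module ℝ E] (f : ι → E → ℝ)
    (hadd : ∀ i x y, f i (x + y) = f i x + f i y)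
    (hsmul : ∀ i (c : ℝ) x, f i (c • x) = c * f i x) (hno : ¬ ∃ d, ∀ i, f i d < 0) :
    ∃ μ : ι → ℝ, (∀ i, 0 ≤ μ i) ∧ (∃ i, μ i ≠ 0) ∧ ∀ d, ∑ i, μ i * f i d = 0 := by
  classical
  let s : Set (ι → ℝ) := Set.univ.pi fun _ => Set.Iio 0
  let F : E →ₗ[ℝ] (ι → ℝ) :=
    { toFun := fun d i => f i d
      map_add' := fun x y => by funext i; exact hadd i x y
      map_smul' := fun c x => by funext i; exact hsmul i c x }
  let t : Set (ι → ℝ) := (LinearMap.range F : Submodule ℝ (ι → ℝ))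
  have hs1 : Convex ℝ s := convex_pi fun _ _ => convex_Iio 0
  have hs2 : IsOpen s := isOpen_set_pi Set.finite_univ fun _ _ => isOpen_Iio
  have ht : Convex ℝ t := Submodule.convex _
  have hd : Disjoint s t := by
    rw [Set.disjoint_left]
    rintro z hz ⟨d, rfl⟩
    exact hno ⟨d, fun i => hz i (Set.mem_univ i)⟩
  obtain ⟨g, u, h1, h2⟩ := geometric_hahn_banach_open hs1 hs2 ht hd
  have hu : u ≤ 0 := by simpa using h2 0 (Submodule.zero_mem _)
  have hz : ∀ z ∈ t, g z = 0 := by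
    intro z hz
    by_contra hne
    have := h2 (((u - 1) / g z) • z) (Submodule.smul_mem _ _ hz)
    rw [map_smul, smul_eq_mul, div_mul_cancel₀ _ hne] at this
    linarith
  have hg : ∀ z, g z = ∑ i, g (Pi.single i 1) * z i := by
    intro z
    conv_lhs => rw [← Finset.univ_sum_single z]
    rw [map_sum]
    refine Finset.sum_congr rfl fun i _ => ?_
    have : (Pi.single i (z i) : ι → ℝ) = z i • Pi.single i 1 := by
      rw [← Pi.single_smul]; simp
    rw [this, map_smul, smul_eq_mul, mul_comm]
  refine ⟨fun i => g (Pi.single i 1), ?_, ?_, ?_⟩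
  · intro i
    by_contra hi
    push Not at hi
    set S := ∑ j, g (Pi.single j 1) with hS
    set K : ℝ := (|S| + 1) / (- g (Pi.single i 1)) with hK
    have hKp : 0 < K := div_pos (by positivity) (by linarith)
    have := h1 (fun j => -1 - K * (Pi.single i 1 : ι → ℝ) j) (by
      intro j _
      have : 0 ≤ (Pi.single i 1 : ι → ℝ) j := by
        by_cases h : j = i
        · subst h; simp
        · simp [h]
      simp only [Set.mem_Iio]
      nlinarith)
    rw [hg] at this
    simp only [mul_sub, Finset.sum_sub_distrib] at this
    have e : ∑ j, g (Pi.single j 1) * (K * (Pi.single i 1 : ι → ℝ) j) = g (Pi.single i 1) * K := by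
      rw [Finset.sum_eq_single i] <;> simp +contextual
    have e2 : g (Pi.single i 1) * K = -(|S|+1) := by
      have hne := hi.ne
      rw [hK]; field_simp
    have e3 : ∑ j, g (Pi.single j 1) * (-1 : ℝ) = - S := by simp [hS]
    rw [e, e2, e3] at this
    have := le_abs_self S
    linarith
  · by_contra hall
    push Not at hall
    have := h1 (fun _ => -1) (by intro j _; simp)
    rw [hg] at this
    simp [hall] at this
    linarith
  · intro d
    have := hz (F d) ⟨d, rfl⟩
    rw [hg] at this
    exact this

end Generic
namespace AdvTeamGame

variable (G : AdvTeamGame)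

noncomputable def gq (s : G.S) (b : G.B) (v : G.S → ℝ) (a : ∀ k, G.A k) : ℝ :=
  G.r s a b + G.γ * ∑ s', G.P s a b s' * v s'

noncomputable def sl (x : G.TeamPolicy) (s : G.S) : ∀ k, G.A k → ℝ := fun k => x k s

theorem bell_eq (s : G.S) (x : G.TeamPolicy) (b : G.B) (v : G.S → ℝ) :
    G.rTeam s x b + G.γ * ∑ s', G.PTeam s x b s' * v s' = mE (G.sl x s) (G.gq s b v) := by
  unfold rTeam PTeam mE gq sl
  simp_rw [mul_add, Finset.sum_add_distrib, Finset.sum_mul, Finset.mul_sum]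
  rw [Finset.sum_comm]
  congr 1
  refine Finset.sum_congr rfl fun a _ => Finset.sum_congr rfl fun s' _ => ?_
  ring

theorem sl_prob {x : G.TeamPolicy} (hx : G.IsTeamPolicy x) (s : G.S) : mProb (G.sl x s) :=
  ⟨fun k a => hx.1 k s a, fun k => hx.2 k s⟩

theorem sl_dev (x : G.TeamPolicy) (k : Fin G.n) (a : G.A k) (s : G.S) :
    G.sl (G.devPolicy x k a) s = Function.update (G.sl x s) k (dl a) := by
  funext j
  unfold sl devPolicy
  by_cases h : j = k
  · subst h; simp; rfl
  · simp [h]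

theorem gq_mono (s : G.S) (b : G.B) {v w : G.S → ℝ} (h : ∀ s, v s ≤ w s) (a) :
    G.gq s b v a ≤ G.gq s b w a := by
  unfold gq
  have := Finset.sum_le_sum fun s' (_ : s' ∈ Finset.univ) =>
    mul_le_mul_of_nonneg_left (h s') (G.P_nonneg s a b s')
  have := mul_le_mul_of_nonneg_left this G.γ_nonneg
  linarith

theorem gq_const (s : G.S) (b : G.B) (M : ℝ) (a) :
    G.gq s b (fun _ => M) a = G.r s a b + G.γ * M := by
  unfold gq
  rw [← Finset.sum_mul, G.P_sum_one, one_mul]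

theorem gq_diff (s : G.S) (b : G.B) {v w : G.S → ℝ} {D : ℝ} (h : ∀ s, |v s - w s| ≤ D) (a) :
    |G.gq s b v a - G.gq s b w a| ≤ G.γ * D := by
  have e : G.gq s b v a - G.gq s b w a = G.γ * ∑ s', G.P s a b s' * (v s' - w s') := by
    unfold gq
    simp_rw [mul_sub, Finset.sum_sub_distrib]; ring
  rw [e, abs_mul, abs_of_nonneg G.γ_nonneg]
  refine mul_le_mul_of_nonneg_left ?_ G.γ_nonneg
  calc |∑ s', G.P s a b s' * (v s' - w s')| ≤ ∑ s', G.P s a b s' * D := by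
        refine (Finset.abs_sum_le_sum_abs _ _).trans (Finset.sum_le_sum fun s' _ => ?_)
        rw [abs_mul, abs_of_nonneg (G.P_nonneg s a b s')]
        exact mul_le_mul_of_nonneg_left (h s') (G.P_nonneg s a b s')
    _ = D := by rw [← Finset.sum_mul, G.P_sum_one, one_mul]

/-- `v` solves the Bellman optimality equation at `x`. -/
def IsOpt (x : G.TeamPolicy) (v : G.S → ℝ) : Prop :=
  (∀ s b, mE (G.sl x s) (G.gq s b v) ≤ v s) ∧ ∀ s, ∃ b, mE (G.sl x s) (G.gq s b v) = v s

theorem exists_opt {x : G.TeamPolicy} (hx : G.IsTeamPolicy x) : ∃ v, G.IsOpt x v := by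
  classical
  let T : (G.S → ℝ) → (G.S → ℝ) := fun v s =>
    Finset.univ.sup' Finset.univ_nonempty fun b => mE (G.sl x s) (G.gq s b v)
  have hT : ContractingWith ⟨G.γ, G.γ_nonneg⟩ T := by
    refine ⟨by exact G.γ_lt_one, LipschitzWith.of_dist_le_mul fun v w => ?_⟩
    have hD : ∀ s, |v s - w s| ≤ dist v w := fun s => by
      rw [← Real.dist_eq]; exact dist_le_pi_dist v w s
    have hD' : ∀ s b, |mE (G.sl x s) (G.gq s b v) - mE (G.sl x s) (G.gq s b w)|
        ≤ G.γ * dist v w := fun s b => by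
      rw [← mE_sub]
      exact mE_abs (G.sl_prob hx s) (G.gq_diff s b hD)
    change dist (T v) (T w) ≤ G.γ * dist v w
    rw [dist_pi_le_iff (mul_nonneg G.γ_nonneg dist_nonneg)]
    intro s
    rw [Real.dist_eq, abs_sub_le_iff]
    constructor
    · rw [sub_le_iff_le_add]
      refine Finset.sup'_le _ _ fun b _ => ?_
      have h1 := (abs_le.1 (hD' s b)).2
      have h2 := Finset.le_sup' (fun b => mE (G.sl x s) (G.gq s b w)) (Finset.mem_univ b)
      change _ ≤ T w s at h2
      linarith
    · rw [sub_le_iff_le_add]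
      refine Finset.sup'_le _ _ fun b _ => ?_
      have h1 := (abs_le.1 (hD' s b)).1
      have h2 := Finset.le_sup' (fun b => mE (G.sl x s) (G.gq s b v)) (Finset.mem_univ b)
      change _ ≤ T v s at h2
      linarith
  refine ⟨ContractingWith.fixedPoint T hT, ?_, ?_⟩
  · intro s b
    have h := congrFun hT.fixedPoint_isFixedPt s
    set v := ContractingWith.fixedPoint T hT
    rw [← h]
    exact Finset.le_sup' (fun b => mE (G.sl x s) (G.gq s b v)) (Finset.mem_univ b)
  · intro s
    have h := congrFun hT.fixedPoint_isFixedPt s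
    set v := ContractingWith.fixedPoint T hT
    obtain ⟨b, _, hb⟩ := Finset.exists_mem_eq_sup' (Finset.univ_nonempty (α := G.B))
      fun b => mE (G.sl x s) (G.gq s b v)
    exact ⟨b, by rw [← hb]; exact h⟩

theorem mE_gq_ge {p : ∀ k, G.A k → ℝ} (hp : mProb p) (s : G.S) (b : G.B) {v : G.S → ℝ} {m : ℝ}
    (h : ∀ s, m ≤ v s) : G.γ * m ≤ mE p (G.gq s b v) := by
  rw [← mE_const hp (G.γ * m)]
  refine mE_mono hp fun a => ?_
  have := G.gq_mono s b (v := fun _ => m) h a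
  rw [gq_const] at this
  linarith [G.r_pos s a b]

theorem mE_gq_le {p : ∀ k, G.A k → ℝ} (hp : mProb p) (s : G.S) (b : G.B) {v : G.S → ℝ} {m : ℝ}
    (h : ∀ s, v s ≤ m) : mE p (G.gq s b v) ≤ 1 + G.γ * m := by
  rw [← mE_const hp (1 + G.γ * m)]
  refine mE_mono hp fun a => ?_
  have := G.gq_mono s b (w := fun _ => m) h a
  rw [gq_const] at this
  linarith [G.r_lt_one s a b]

theorem opt_bound {x : G.TeamPolicy} (hx : G.IsTeamPolicy x) {v : G.S → ℝ} (hv : G.IsOpt x v) :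
    (∀ s, 0 ≤ v s) ∧ ∀ s, v s ≤ 1 / (1 - G.γ) := by
  have hγ := G.γ_lt_one
  constructor
  · obtain ⟨s0, h0⟩ := Finite.exists_min v
    obtain ⟨b, hb⟩ := hv.2 s0
    have := G.mE_gq_ge (G.sl_prob hx s0) s0 b h0
    rw [hb] at this
    have : 0 ≤ v s0 := by nlinarith
    intro s; linarith [h0 s]
  · obtain ⟨s0, h0⟩ := Finite.exists_max v
    obtain ⟨b, hb⟩ := hv.2 s0
    have := G.mE_gq_le (G.sl_prob hx s0) s0 b h0
    rw [hb] at this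
    have : v s0 ≤ 1 / (1 - G.γ) := by
      rw [le_div_iff₀ (by linarith)]; linarith
    intro s; linarith [h0 s]

theorem gq_abs {v : G.S → ℝ} (h : (∀ s, 0 ≤ v s) ∧ ∀ s, v s ≤ 1 / (1 - G.γ)) (s : G.S) (b : G.B) (a) :
    |G.gq s b v a| ≤ 1 / (1 - G.γ) := by
  have hγ := G.γ_lt_one
  have h1 := G.gq_mono s b (v := fun _ => 0) h.1 a
  have h2 := G.gq_mono s b (w := fun _ => 1 / (1 - G.γ)) h.2 a
  rw [gq_const] at h1 h2
  have h3 : 1 + G.γ * (1 / (1 - G.γ)) = 1 / (1 - G.γ) := by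
    have : 1 - G.γ ≠ 0 := by linarith
    field_simp; ring
  rw [abs_le]
  have : 0 < 1 / (1 - G.γ) := one_div_pos.2 (by linarith)
  constructor <;> linarith [G.r_pos s a b, G.r_lt_one s a b]

theorem bell_diff {p p' : ∀ k, G.A k → ℝ} (hp : mProb p) (hp' : mProb p') {v w : G.S → ℝ}
    (hv : (∀ s, 0 ≤ v s) ∧ ∀ s, v s ≤ 1 / (1 - G.γ)) {D δ : ℝ} (hD : ∀ s, |v s - w s| ≤ D)
    (hδ : ∑ k, ∑ a, |p k a - p' k a| ≤ δ) (s : G.S) (b : G.B) :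
    |mE p (G.gq s b v) - mE p' (G.gq s b w)| ≤ δ / (1 - G.γ) + G.γ * D := by
  have hγ := G.γ_lt_one
  have h1 := mE_lip hp hp' (G.gq_abs hv s b)
  have h2 : |mE p' (G.gq s b v) - mE p' (G.gq s b w)| ≤ G.γ * D := by
    rw [← mE_sub]
    exact mE_abs hp' (G.gq_diff s b hD)
  have h3 : 1 / (1 - G.γ) * ∑ k, ∑ a, |p k a - p' k a| ≤ δ / (1 - G.γ) := by
    rw [one_div_mul_eq_div]
    exact div_le_div_of_nonneg_right hδ (by linarith)
  exact (abs_sub_le _ (mE p' (G.gq s b v)) _).trans (by linarith)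

theorem opt_lip {x x' : G.TeamPolicy} (hx : G.IsTeamPolicy x) (hx' : G.IsTeamPolicy x')
    {v w : G.S → ℝ} (hv : G.IsOpt x v) (hw : G.IsOpt x' w) {δ : ℝ}
    (hδ : ∀ s, ∑ k, ∑ a, |G.sl x s k a - G.sl x' s k a| ≤ δ) (s : G.S) :
    |v s - w s| ≤ δ / (1 - G.γ) ^ 2 := by
  have hγ := G.γ_lt_one
  obtain ⟨s0, h0⟩ := Finite.exists_max fun s => |v s - w s|
  refine (h0 s).trans ?_
  have hb := fun b => abs_le.1 (G.bell_diff (G.sl_prob hx s0) (G.sl_prob hx' s0)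
    (G.opt_bound hx hv) h0 (hδ s0) s0 b)
  obtain ⟨b, e⟩ := hv.2 s0
  obtain ⟨b', e'⟩ := hw.2 s0
  have : |v s0 - w s0| ≤ δ / (1 - G.γ) + G.γ * |v s0 - w s0| := by
    rw [abs_le (a := v s0 - w s0)]
    have i1 := (hb b).2
    have i2 := (hb b').1
    have i3 := hv.1 s0 b'
    have i4 := hw.1 s0 b
    constructor <;> linarith
  have h1 : 0 < 1 - G.γ := by linarith
  have h2 : |v s0 - w s0| * (1 - G.γ) ≤ δ / (1 - G.γ) := by linarith
  rw [le_div_iff₀ h1] at h2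
  rw [le_div_iff₀ (pow_pos h1 2)]
  nlinarith

theorem feas_ge {x : G.TeamPolicy} (hx : G.IsTeamPolicy x) {y : G.AdvPolicy}
    (hy : G.IsAdvPolicy y) {v w : G.S → ℝ}
    (hv : ∀ s, ∑ b, y s b * mE (G.sl x s) (G.gq s b v) ≤ v s)
    (hw : ∀ s, ∑ b, y s b * mE (G.sl x s) (G.gq s b w) = w s) : ∀ s, w s ≤ v s := by
  have hγ := G.γ_lt_one
  obtain ⟨s0, h0⟩ := Finite.exists_min fun s => v s - w s
  have key : ∀ b, G.γ * (v s0 - w s0)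
      ≤ mE (G.sl x s0) (G.gq s0 b v) - mE (G.sl x s0) (G.gq s0 b w) := by
    intro b
    rw [← mE_sub, ← mE_const (G.sl_prob hx s0) (G.γ * (v s0 - w s0))]
    refine mE_mono (G.sl_prob hx s0) fun a => ?_
    have h1 := G.gq_mono s0 b (v := fun s => (v s0 - w s0)) h0 a
    have h2 : G.gq s0 b (fun s => v s - w s) a
        = G.gq s0 b v a - G.gq s0 b w a + G.r s0 a b := by
      unfold gq; simp_rw [mul_sub, Finset.sum_sub_distrib]; ring
    rw [h2, gq_const] at h1
    linarith
  have : G.γ * (v s0 - w s0) ≤ v s0 - w s0 := by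
    have h3 := hv s0
    have h4 := hw s0
    have h5 : ∑ b, y s0 b * (G.γ * (v s0 - w s0)) ≤ ∑ b, y s0 b *
        (mE (G.sl x s0) (G.gq s0 b v) - mE (G.sl x s0) (G.gq s0 b w)) :=
      Finset.sum_le_sum fun b _ => mul_le_mul_of_nonneg_left (key b) (hy.1 s0 b)
    rw [← Finset.sum_mul, hy.2, one_mul] at h5
    simp_rw [mul_sub (y s0 _), Finset.sum_sub_distrib] at h5
    linarith
  have : 0 ≤ v s0 - w s0 := by nlinarith
  intro s
  linarith [h0 s]

theorem PTeam_nonneg {x : G.TeamPolicy} (hx : G.IsTeamPolicy x) (s b s') :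
    0 ≤ G.PTeam s x b s' :=
  Finset.sum_nonneg fun a _ => mul_nonneg (Finset.prod_nonneg fun k _ => hx.1 k s _)
    (G.P_nonneg s a b s')

theorem PTeam_sum {x : G.TeamPolicy} (hx : G.IsTeamPolicy x) (s b) :
    ∑ s', G.PTeam s x b s' = 1 := by
  unfold PTeam
  rw [Finset.sum_comm]
  simp_rw [← Finset.mul_sum, G.P_sum_one]
  exact mE_const (G.sl_prob hx s) 1

theorem PMat_det {x : G.TeamPolicy} (hx : G.IsTeamPolicy x) {y : G.AdvPolicy}
    (hy : G.IsAdvPolicy y) : IsUnit (1 - G.γ • G.PMat x y).det := by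
  have hγ := G.γ_lt_one
  have hγ0 := G.γ_nonneg
  have hnn : ∀ s s', 0 ≤ G.PMat x y s s' := fun s s' =>
    Finset.sum_nonneg fun b _ => mul_nonneg (hy.1 s b) (G.PTeam_nonneg hx s b s')
  have hsum : ∀ s, ∑ s', G.PMat x y s s' = 1 := fun s => by
    simp only [PMat, Matrix.of_apply]
    rw [Finset.sum_comm]
    simp_rw [← Finset.mul_sum, G.PTeam_sum hx, mul_one, hy.2]
  rw [isUnit_iff_ne_zero]
  refine det_ne_zero_of_sum_row_lt_diag fun s => ?_
  have h1 : ∑ j ∈ Finset.univ.erase s, ‖(1 - G.γ • G.PMat x y) s j‖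
      = G.γ * (1 - G.PMat x y s s) := by
    rw [← hsum s, ← Finset.add_sum_erase _ _ (Finset.mem_univ s), add_sub_cancel_left,
      Finset.mul_sum]
    refine Finset.sum_congr rfl fun j hj => ?_
    have : s ≠ j := (Finset.ne_of_mem_erase hj).symm
    simp [Matrix.one_apply_ne this, abs_of_nonneg hγ0, abs_of_nonneg (hnn s j)]
  rw [h1]
  have h2 : (1 - G.γ • G.PMat x y) s s = 1 - G.γ * G.PMat x y s s := by simp
  rw [h2]
  refine lt_of_lt_of_le ?_ (Real.le_norm_self _)
  linarith

theorem bell_avg (x : G.TeamPolicy) (y : G.AdvPolicy) (v : G.S → ℝ) (s : G.S) :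
    ∑ b, y s b * mE (G.sl x s) (G.gq s b v)
      = G.rVec x y s + G.γ * (G.PMat x y *ᵥ v) s := by
  simp_rw [← bell_eq, mul_add, Finset.sum_add_distrib]
  congr 1
  simp only [Matrix.mulVec, dotProduct, PMat, Matrix.of_apply, Finset.mul_sum, Finset.sum_mul]
  rw [Finset.sum_comm]
  refine Finset.sum_congr rfl fun a _ => Finset.sum_congr rfl fun s' _ => ?_
  ring

theorem V_le {x : G.TeamPolicy} (hx : G.IsTeamPolicy x) {y : G.AdvPolicy}
    (hy : G.IsAdvPolicy y) {v : G.S → ℝ} (hv : ∀ s b, mE (G.sl x s) (G.gq s b v) ≤ v s) :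
    G.V x y ≤ G.ρ ⬝ᵥ v := by
  unfold V
  set w := (1 - G.γ • G.PMat x y)⁻¹ *ᵥ G.rVec x y with hw
  have h1 : (1 - G.γ • G.PMat x y) *ᵥ w = G.rVec x y := by
    rw [hw, Matrix.mulVec_mulVec, Matrix.mul_nonsing_inv _ (G.PMat_det hx hy), Matrix.one_mulVec]
  have h2 := G.feas_ge hx hy (v := v) (w := w) (fun s => ?_) (fun s => ?_)
  · exact Finset.sum_le_sum fun s _ => mul_le_mul_of_nonneg_left (h2 s) (G.ρ_pos s).le
  · calc _ ≤ ∑ b, y s b * v s :=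
          Finset.sum_le_sum fun b _ => mul_le_mul_of_nonneg_left (hv s b) (hy.1 s b)
      _ = v s := by rw [← Finset.sum_mul, hy.2, one_mul]
  · rw [bell_avg, ← h1, Matrix.sub_mulVec, Matrix.smul_mulVec, Matrix.one_mulVec]
    simp

theorem advPolicy_exists : ∃ y, G.IsAdvPolicy y := by
  classical
  exact ⟨fun _ => dl (Classical.arbitrary G.B), fun s b => dl_nonneg _ _, fun s => by simp [dl]⟩

theorem phi_le {x : G.TeamPolicy} (hx : G.IsTeamPolicy x) {v : G.S → ℝ}
    (hv : ∀ s b, mE (G.sl x s) (G.gq s b v) ≤ v s) : G.phi x ≤ G.ρ ⬝ᵥ v := by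
  obtain ⟨y, hy⟩ := G.advPolicy_exists
  refine csSup_le ⟨_, y, hy, rfl⟩ ?_
  rintro _ ⟨y, hy, rfl⟩
  exact G.V_le hx hy hv

theorem le_phi {x : G.TeamPolicy} (hx : G.IsTeamPolicy x) {v : G.S → ℝ}
    (hv : G.IsOpt x v) : G.ρ ⬝ᵥ v ≤ G.phi x := by
  classical
  choose β hβ using hv.2
  have hy : G.IsAdvPolicy fun s => dl (β s) :=
    ⟨fun s b => dl_nonneg _ _, fun s => by simp [dl]⟩
  refine le_csSup ⟨G.ρ ⬝ᵥ v, ?_⟩ ⟨_, hy, ?_⟩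
  · rintro _ ⟨y, hy, rfl⟩
    exact G.V_le hx hy hv.1
  · unfold V
    have h1 : (1 - G.γ • G.PMat x fun s => dl (β s)) *ᵥ v = G.rVec x fun s => dl (β s) := by
      funext s
      have := G.bell_avg x (fun s => dl (β s)) v s
      simp only [dl, ite_mul, one_mul, zero_mul, Finset.sum_ite_eq', Finset.mem_univ, if_true] at this
      rw [hβ] at this
      rw [Matrix.sub_mulVec, Matrix.smul_mulVec, Matrix.one_mulVec]
      simp only [Pi.sub_apply, Pi.smul_apply, smul_eq_mul]
      rw [sub_eq_iff_eq_add]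
      exact this
    rw [← h1, Matrix.mulVec_mulVec, Matrix.nonsing_inv_mul _ (G.PMat_det hx hy), Matrix.one_mulVec]

theorem opt_of_min {x : G.TeamPolicy} (hx : G.IsTeamPolicy x) {v : G.S → ℝ}
    (hv : ∀ s b, mE (G.sl x s) (G.gq s b v) ≤ v s)
    (hmin : ∀ w : G.S → ℝ, (∀ s b, mE (G.sl x s) (G.gq s b w) ≤ w s) → G.ρ ⬝ᵥ v ≤ G.ρ ⬝ᵥ w) :
    G.IsOpt x v := by
  classical
  obtain ⟨w, hw⟩ := G.exists_opt hx
  choose β hβ using hw.2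
  have hy : G.IsAdvPolicy fun s => dl (β s) :=
    ⟨fun s b => dl_nonneg _ _, fun s => by simp [dl]⟩
  have h := G.feas_ge hx hy (v := v) (w := w) (fun s => by simpa [dl] using hv s _)
    (fun s => by simpa [dl] using hβ s)
  have h2 := hmin w hw.1
  have h3 : ∑ s, G.ρ s * (v s - w s) ≤ 0 := by
    simp only [mul_sub, Finset.sum_sub_distrib]
    exact sub_nonpos.2 h2
  have h4 : ∀ s ∈ Finset.univ, 0 ≤ G.ρ s * (v s - w s) := fun s _ =>
    mul_nonneg (G.ρ_pos s).le (sub_nonneg.2 (h s))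
  have h5 := (Finset.sum_eq_zero_iff_of_nonneg h4).1 (le_antisymm h3 (Finset.sum_nonneg h4))
  have : v = w := by
    funext s
    rcases mul_eq_zero.1 (h5 s (Finset.mem_univ s)) with h6 | h6
    · exact absurd h6 (G.ρ_pos s).ne'
    · linarith
  rw [this]; exact hw

end AdvTeamGame
theorem deriv_neg_ev {g : ℝ → ℝ} {g' : ℝ} (h : HasDerivAt g g' 0) (hg : g' < 0) :
    ∀ᶠ t in nhdsWithin (0:ℝ) (Set.Ioi 0), g t < g 0 := by
  have h1 := hasDerivAt_iff_tendsto_slope_zero.1 h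
  have h2 : Filter.Tendsto (fun t : ℝ => t⁻¹ • (g (0 + t) - g 0)) (nhdsWithin (0:ℝ) (Set.Ioi 0))
      (nhds g') := h1.mono_left (nhdsWithin_mono _ fun t ht => ne_of_gt ht)
  have h3 := h2.eventually (gt_mem_nhds hg)
  filter_upwards [h3, self_mem_nhdsWithin] with t ht ht0
  have ht0' : 0 < t := ht0
  simp only [zero_add, smul_eq_mul] at ht
  have := mul_neg_of_pos_of_neg ht0' ht
  rw [mul_inv_cancel_left₀ ht0'.ne'] at this
  linarith

namespace AdvTeamGame

variable (G : AdvTeamGame)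

theorem teamNorm_sq (x : G.TeamPolicy) : G.teamNorm x ^ 2 = ∑ k, ∑ s, ∑ a, (x k s a) ^ 2 :=
  Real.sq_sqrt (Finset.sum_nonneg fun _ _ => Finset.sum_nonneg fun _ _ =>
    Finset.sum_nonneg fun _ _ => sq_nonneg _)

noncomputable def dxx (xt w : G.TeamPolicy) : G.TeamPolicy := fun k s a =>
  w k s a - (∑ a', w k s a') * xt k s a

theorem dxx_add (xt w w' : G.TeamPolicy) : G.dxx xt (w + w') = G.dxx xt w + G.dxx xt w' := by
  funext k s a
  simp only [dxx, Pi.add_apply, Finset.sum_add_distrib]; ring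

theorem dxx_smul (xt w : G.TeamPolicy) (c : ℝ) : G.dxx xt (c • w) = c • G.dxx xt w := by
  funext k s a
  simp only [dxx, Pi.smul_apply, smul_eq_mul, ← Finset.mul_sum]; ring

noncomputable def gk (xt : G.TeamPolicy) (v : G.S → ℝ) (s : G.S) (b : G.B) (k : Fin G.n)
    (a : G.A k) : ℝ := mE (Function.update (G.sl xt s) k (dl a)) (G.gq s b v)

theorem gk_avg (xt : G.TeamPolicy) (v : G.S → ℝ) (s : G.S) (b : G.B) (k : Fin G.n) :
    ∑ a, xt k s a * G.gk xt v s b k a = mE (G.sl xt s) (G.gq s b v) := by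
  have := mE_update (G.sl xt s) k (G.sl xt s k) (G.gq s b v)
  rw [Function.update_eq_self] at this
  rw [this]; rfl

theorem bell_deriv (xt d : G.TeamPolicy) (v dv : G.S → ℝ) (s : G.S) (b : G.B) :
    HasDerivAt (fun t : ℝ => mE (G.sl (fun k s a => xt k s a + t * d k s a) s)
        (G.gq s b (fun s => v s + t * dv s)) - (v s + t * dv s))
      (∑ k, ∑ a, d k s a * G.gk xt v s b k a + G.γ * ∑ s', G.PTeam s xt b s' * dv s' - dv s) 0 := by
  set c : (∀ k, G.A k) → ℝ := fun a => G.γ * ∑ s', G.P s a b s' * dv s' with hc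
  have e : (fun t : ℝ => mE (G.sl (fun k s a => xt k s a + t * d k s a) s)
        (G.gq s b (fun s => v s + t * dv s)) - (v s + t * dv s))
      = fun t : ℝ => mE (fun k a => G.sl xt s k a + t * G.sl d s k a) (G.gq s b v)
        + t * mE (fun k a => G.sl xt s k a + t * G.sl d s k a) c - (v s + t * dv s) := by
    funext t
    congr 1
    unfold mE
    rw [Finset.mul_sum, ← Finset.sum_add_distrib]
    refine Finset.sum_congr rfl fun a _ => ?_
    have : G.gq s b (fun s => v s + t * dv s) a = G.gq s b v a + t * c a := by
      simp only [gq, hc, mul_add, Finset.sum_add_distrib, Finset.mul_sum]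
      rw [add_assoc]
      congr 2
      refine Finset.sum_congr rfl fun s' _ => ?_
      ring
    rw [this]
    simp only [sl]
    ring
  rw [e]
  have h1 := mE_hasDeriv (G.sl xt s) (G.sl d s) (G.gq s b v)
  have h2 := (hasDerivAt_id (0:ℝ)).mul (mE_hasDeriv (G.sl xt s) (G.sl d s) c)
  have h3 := ((hasDerivAt_id (0:ℝ)).mul_const (dv s)).const_add (v s)
  refine HasDerivAt.congr_deriv (f := fun t : ℝ => _) ((h1.add h2).sub h3) ?_
  simp only [one_mul, id, zero_mul, add_zero]
  congr 2
  · refine Finset.sum_congr rfl fun k _ => ?_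
    rw [mE_update]; rfl
  · unfold mE PTeam
    simp only [hc, Finset.mul_sum, Finset.sum_mul, sl]
    rw [Finset.sum_comm]
    refine Finset.sum_congr rfl fun a _ => Finset.sum_congr rfl fun s' _ => ?_
    ring

noncomputable def fT (xt : G.TeamPolicy) (v : G.S → ℝ) (s : G.S) (b : G.B)
    (d : G.TeamPolicy × (G.S → ℝ) × ℝ) : ℝ :=
  ∑ k, ∑ a, G.dxx xt d.1 k s a * G.gk xt v s b k a + G.γ * ∑ s', G.PTeam s xt b s' * d.2.1 s'
    - d.2.1 s + d.2.2 * (mE (G.sl xt s) (G.gq s b v) - v s)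

noncomputable def fO (xh xt : G.TeamPolicy) (d : G.TeamPolicy × (G.S → ℝ) × ℝ) : ℝ :=
  ∑ s, G.ρ s * d.2.1 s
    + 2 * G.lconst * ∑ k, ∑ s, ∑ a, (xt k s a - xh k s a) * G.dxx xt d.1 k s a

noncomputable def fAll (xh xt : G.TeamPolicy) (v : G.S → ℝ) :
    ((G.S × G.B) ⊕ ((Σ k, G.S × G.A k) ⊕ Bool)) → (G.TeamPolicy × (G.S → ℝ) × ℝ) → ℝ
  | Sum.inl (s, b), d => G.fT xt v s b d
  | Sum.inr (Sum.inl ⟨k, s, a⟩), d => - d.1 k s a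
  | Sum.inr (Sum.inr true), d => G.fO xh xt d
  | Sum.inr (Sum.inr false), d => - d.2.2

theorem fAll_add (xh xt : G.TeamPolicy) (v : G.S → ℝ) (i) (x y) :
    G.fAll xh xt v i (x + y) = G.fAll xh xt v i x + G.fAll xh xt v i y := by
  rcases i with ⟨s, b⟩ | ⟨k, s, a⟩ | _ | _
  · simp only [fAll, fT, Prod.fst_add, Prod.snd_add, dxx_add, Pi.add_apply, add_mul, mul_add,
      Finset.sum_add_distrib]
    ring
  · simp only [fAll, Prod.fst_add, Pi.add_apply]; ring
  · simp only [fAll, Prod.snd_add]; ring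
  · simp only [fAll, fO, Prod.fst_add, Prod.snd_add, dxx_add, Pi.add_apply, mul_add,
      Finset.sum_add_distrib]
    ring

theorem fAll_smul (xh xt : G.TeamPolicy) (v : G.S → ℝ) (i) (c : ℝ) (x) :
    G.fAll xh xt v i (c • x) = c * G.fAll xh xt v i x := by
  rcases i with ⟨s, b⟩ | ⟨k, s, a⟩ | _ | _
  · simp only [fAll, fT, Prod.smul_fst, Prod.smul_snd, dxx_smul, Pi.smul_apply, smul_eq_mul,
      mul_assoc, mul_left_comm _ c, ← Finset.mul_sum]
    ring
  · simp only [fAll, Prod.smul_fst, Pi.smul_apply, smul_eq_mul]; ring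
  · simp only [fAll, Prod.smul_snd, smul_eq_mul]; ring
  · simp only [fAll, fO, Prod.smul_fst, Prod.smul_snd, dxx_smul, Pi.smul_apply, smul_eq_mul,
      mul_left_comm _ c, ← Finset.mul_sum]
    ring

theorem no_dir {xh xt : G.TeamPolicy} (hxt : G.IsTeamPolicy xt) {v : G.S → ℝ}
    (hv : G.IsOpt xt v)
    (hmin : ∀ x' : G.TeamPolicy, G.IsTeamPolicy x' →
      G.phi xt + G.lconst * G.teamNorm (xh - xt) ^ 2 ≤
        G.phi x' + G.lconst * G.teamNorm (xh - x') ^ 2) :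
    ¬ ∃ d, ∀ i, G.fAll xh xt v i d < 0 := by
  rintro ⟨⟨w, dv, τ⟩, h⟩
  have hT : ∀ s b, G.fT xt v s b (w, dv, τ) < 0 := fun s b => h (Sum.inl (s, b))
  have hw : ∀ k s a, 0 < w k s a := fun k s a => by
    have := h (Sum.inr (Sum.inl ⟨k, s, a⟩))
    simp only [fAll] at this; linarith
  have hO : G.fO xh xt (w, dv, τ) < 0 := h (Sum.inr (Sum.inr true))
  have hτ : 0 < τ := by
    have := h (Sum.inr (Sum.inr false))
    simp only [fAll] at this; linarith
  set d := G.dxx xt w with hd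
  set xT : ℝ → G.TeamPolicy := fun t k s a => xt k s a + t * d k s a with hxT
  set vT : ℝ → G.S → ℝ := fun t s => v s + t * dv s with hvT
  have E1 : ∀ᶠ t in nhdsWithin (0:ℝ) (Set.Ioi 0), ∀ s b,
      mE (G.sl (xT t) s) (G.gq s b (vT t)) - vT t s
        + t * (τ * (mE (G.sl xt s) (G.gq s b v) - v s)) < mE (G.sl xt s) (G.gq s b v) - v s := by
    rw [Filter.eventually_all]; intro s
    rw [Filter.eventually_all]; intro b
    have h1 := (G.bell_deriv xt d v dv s b).add
      ((hasDerivAt_id (0:ℝ)).mul_const (τ * (mE (G.sl xt s) (G.gq s b v) - v s)))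
    have := deriv_neg_ev h1 (by have := hT s b; simp only [fT] at this; linarith)
    simpa using this
  have E2 : ∀ᶠ t in nhdsWithin (0:ℝ) (Set.Ioi 0), ∀ k s, t * ∑ a, w k s a < 1 := by
    rw [Filter.eventually_all]; intro k
    rw [Filter.eventually_all]; intro s
    have : Filter.Tendsto (fun t : ℝ => t * ∑ a, w k s a) (nhdsWithin (0:ℝ) (Set.Ioi 0))
        (nhds 0) := by
      have : Filter.Tendsto (fun t : ℝ => t * ∑ a, w k s a) (nhds 0)
        (nhds (0 * ∑ a, w k s a)) := (continuous_id.mul continuous_const).tendsto 0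
      rw [zero_mul] at this
      exact this.mono_left nhdsWithin_le_nhds
    exact this.eventually (gt_mem_nhds one_pos)
  have E2' : ∀ᶠ t in nhdsWithin (0:ℝ) (Set.Ioi 0), t * τ < 1 := by
    have : Filter.Tendsto (fun t : ℝ => t * τ) (nhdsWithin (0:ℝ) (Set.Ioi 0))
        (nhds 0) := by
      have : Filter.Tendsto (fun t : ℝ => t * τ) (nhds 0)
        (nhds (0 * τ)) := (continuous_id.mul continuous_const).tendsto 0
      rw [zero_mul] at this
      exact this.mono_left nhdsWithin_le_nhds
    exact this.eventually (gt_mem_nhds one_pos)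
  have E3 : ∀ᶠ t in nhdsWithin (0:ℝ) (Set.Ioi 0),
      ∑ s, G.ρ s * vT t s + G.lconst * ∑ k, ∑ s, ∑ a, (xh k s a - xT t k s a) ^ 2
      < ∑ s, G.ρ s * v s + G.lconst * ∑ k, ∑ s, ∑ a, (xh k s a - xt k s a) ^ 2 := by
    have hl : ∀ p q : ℝ, HasDerivAt (fun t : ℝ => p + t * q) q 0 := fun p q => by
      simpa using ((hasDerivAt_id (0:ℝ)).mul_const q).const_add p
    have h1 : HasDerivAt (fun t : ℝ => ∑ s, G.ρ s * vT t s) (∑ s, G.ρ s * dv s) 0 :=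
      HasDerivAt.fun_sum fun s _ => (hl (v s) (dv s)).const_mul (G.ρ s)
    have h2 : HasDerivAt (fun t : ℝ => ∑ k, ∑ s, ∑ a, (xh k s a - xT t k s a) ^ 2)
        (∑ k, ∑ s, ∑ a, 2 * ((xt k s a - xh k s a) * d k s a)) 0 := by
      refine HasDerivAt.fun_sum fun k _ => HasDerivAt.fun_sum fun s _ =>
        HasDerivAt.fun_sum fun a _ => ?_
      have := ((hl (xt k s a) (d k s a)).const_sub (xh k s a)).fun_pow 2
      refine HasDerivAt.congr_deriv this ?_
      simp; ring
    have h3 := h1.add (h2.const_mul G.lconst)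
    have := deriv_neg_ev h3 (by
      simp only [fO] at hO
      simp only [← Finset.mul_sum]
      linarith)
    simpa [hxT, hvT] using this
  obtain ⟨t, ⟨⟨⟨⟨e1, e2⟩, e2'⟩, e3⟩, ht⟩⟩ :=
    ((((E1.and E2).and E2').and E3).and self_mem_nhdsWithin).exists
  have ht0 : 0 < t := ht
  have hpol : G.IsTeamPolicy (xT t) := by
    constructor
    · intro k s a
      have : xT t k s a = xt k s a * (1 - t * ∑ a, w k s a) + t * w k s a := by
        simp only [hxT, hd, dxx]; ring
      rw [this]
      have := e2 k s
      exact add_nonneg (mul_nonneg (hxt.1 k s a) (by linarith)) (mul_pos ht0 (hw k s a)).le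
    · intro k s
      simp only [hxT, hd, dxx, Finset.sum_add_distrib, ← Finset.mul_sum, Finset.sum_sub_distrib,
        hxt.2 k s]
      ring
  have hfe : ∀ s b, mE (G.sl (xT t) s) (G.gq s b (vT t)) ≤ vT t s := by
    intro s b
    have h1 := e1 s b
    have h2 := hv.1 s b
    nlinarith
  have h1 := G.phi_le hpol hfe
  have h2 := G.le_phi hxt hv
  have h3 := hmin _ hpol
  rw [teamNorm_sq, teamNorm_sq] at h3
  simp only [dotProduct, Pi.sub_apply] at h1 h2 h3
  linarith

theorem kkt {xh xt : G.TeamPolicy} (hxt : G.IsTeamPolicy xt) {v : G.S → ℝ}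
    (hv : G.IsOpt xt v)
    (hmin : ∀ x' : G.TeamPolicy, G.IsTeamPolicy x' →
      G.phi xt + G.lconst * G.teamNorm (xh - xt) ^ 2 ≤
        G.phi x' + G.lconst * G.teamNorm (xh - x') ^ 2) :
    ∃ lam : G.S → G.B → ℝ, (∀ s b, 0 ≤ lam s b) ∧
      (∀ s b, lam s b * (mE (G.sl xt s) (G.gq s b v) - v s) = 0) ∧
      (∀ s, ∑ b, lam s b = G.ρ s + G.γ * ∑ s', ∑ b, lam s' b * G.PTeam s' xt b s) ∧
      ∀ k s a, 0 ≤ ∑ b, lam s b * (G.gk xt v s b k a - v s)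
        + 2 * G.lconst * ((xt k s a - xh k s a)
          - ∑ a', xt k s a' * (xt k s a' - xh k s a')) := by
  classical
  have hγ := G.γ_lt_one
  obtain ⟨μ, hμ, ⟨i0, hi0⟩, hz⟩ := gordan (G.fAll xh xt v) (G.fAll_add xh xt v)
    (G.fAll_smul xh xt v) (G.no_dir hxt hv hmin)
  set l : G.S → G.B → ℝ := fun s b => μ (Sum.inl (s, b)) with hl
  set η : ∀ k, G.S → G.A k → ℝ := fun k s a => μ (Sum.inr (Sum.inl ⟨k, s, a⟩)) with hη
  set m := μ (Sum.inr (Sum.inr true)) with hm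
  set m' := μ (Sum.inr (Sum.inr false)) with hm'
  have hz' : ∀ d, ∑ s, ∑ b, l s b * G.fT xt v s b d - ∑ k, ∑ s, ∑ a, η k s a * d.1 k s a
      + m * G.fO xh xt d - m' * d.2.2 = 0 := by
    intro d
    have := hz d
    rw [Fintype.sum_sum_type, Fintype.sum_sum_type, Fintype.sum_prod_type, Fintype.sum_sigma,
      Fintype.sum_bool] at this
    simp only [Fintype.sum_prod_type, fAll, mul_neg, Finset.sum_neg_distrib] at this
    linarith
  have dx0 : G.dxx xt 0 = 0 := by funext k s a; simp [dxx]
  have hdv : ∀ dv : G.S → ℝ, ∑ s, ∑ b, l s b * (G.γ * ∑ s', G.PTeam s xt b s' * dv s' - dv s)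
      + m * ∑ s, G.ρ s * dv s = 0 := by
    intro dv
    have := hz' (0, dv, 0)
    simpa [fT, fO, dx0] using this
  have hτ : ∑ s, ∑ b, l s b * (mE (G.sl xt s) (G.gq s b v) - v s) = m' := by
    have := hz' (0, 0, 1)
    simp [fT, fO, dx0] at this
    linarith
  have hw : ∀ w : G.TeamPolicy,
      ∑ s, ∑ b, l s b * ∑ k, ∑ a, G.dxx xt w k s a * G.gk xt v s b k a
      + m * (2 * G.lconst * ∑ k, ∑ s, ∑ a, (xt k s a - xh k s a) * G.dxx xt w k s a)
      = ∑ k, ∑ s, ∑ a, η k s a * w k s a := by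
    intro w
    have := hz' (w, 0, 0)
    simp [fT, fO] at this
    linarith
  have hl0 : ∀ s b, 0 ≤ l s b := fun s b => hμ _
  have hη0 : ∀ k s a, 0 ≤ η k s a := fun k s a => hμ _
  have hmp : 0 < m := by
    refine lt_of_le_of_ne (hμ _) fun hm0 => ?_
    have h1 := hdv (fun _ => 1)
    simp only [mul_one, G.PTeam_sum hxt, G.ρ_sum_one, ← hm0, add_zero, ← Finset.sum_mul] at h1
    have h2 : ∑ s, ∑ b, l s b = 0 := by
      rcases mul_eq_zero.1 h1 with h | h
      · exact h
      · linarith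
    have h3 : ∀ s b, l s b = 0 := by
      intro s b
      have h4 := (Finset.sum_eq_zero_iff_of_nonneg fun s _ =>
        Finset.sum_nonneg fun b _ => hl0 s b).1 h2 s (Finset.mem_univ s)
      exact (Finset.sum_eq_zero_iff_of_nonneg fun b _ => hl0 s b).1 h4 b (Finset.mem_univ b)
    have h5 : m' = 0 := by rw [← hτ]; simp [h3]
    have h6 := hw (fun _ _ _ => 1)
    simp only [h3, ← hm0, zero_mul, Finset.sum_const_zero, add_zero, mul_one] at h6
    have h7 : ∀ k s a, η k s a = 0 := by
      intro k s a
      have h4 := (Finset.sum_eq_zero_iff_of_nonneg fun k _ => Finset.sum_nonneg fun s _ =>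
        Finset.sum_nonneg fun a _ => hη0 k s a).1 h6.symm k (Finset.mem_univ k)
      have h4 := (Finset.sum_eq_zero_iff_of_nonneg fun s _ =>
        Finset.sum_nonneg fun a _ => hη0 k s a).1 h4 s (Finset.mem_univ s)
      exact (Finset.sum_eq_zero_iff_of_nonneg fun a _ => hη0 k s a).1 h4 a (Finset.mem_univ a)
    rcases i0 with ⟨s, b⟩ | ⟨k, s, a⟩ | _ | _
    · exact hi0 (h3 s b)
    · exact hi0 (h7 k s a)
    · exact hi0 h5
    · exact hi0 hm0.symm
  have hcs : ∀ s b, l s b * (mE (G.sl xt s) (G.gq s b v) - v s) = 0 := by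
    have hn : ∀ s b, 0 ≤ l s b * (v s - mE (G.sl xt s) (G.gq s b v)) := fun s b =>
      mul_nonneg (hl0 s b) (sub_nonneg.2 (hv.1 s b))
    have h1 : ∑ s, ∑ b, l s b * (v s - mE (G.sl xt s) (G.gq s b v)) = 0 := by
      apply le_antisymm _ (Finset.sum_nonneg fun s _ => Finset.sum_nonneg fun b _ => hn s b)
      have : ∑ s, ∑ b, l s b * (v s - mE (G.sl xt s) (G.gq s b v)) = - m' := by
        rw [← hτ, ← Finset.sum_neg_distrib]
        refine Finset.sum_congr rfl fun s _ => ?_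
        rw [← Finset.sum_neg_distrib]
        refine Finset.sum_congr rfl fun b _ => ?_
        ring
      rw [this]
      have : 0 ≤ m' := hμ _
      linarith
    intro s b
    have h4 := (Finset.sum_eq_zero_iff_of_nonneg fun s _ =>
        Finset.sum_nonneg fun b _ => hn s b).1 h1 s (Finset.mem_univ s)
    have := (Finset.sum_eq_zero_iff_of_nonneg fun b _ => hn s b).1 h4 b (Finset.mem_univ b)
    linarith
  refine ⟨fun s b => l s b / m, fun s b => div_nonneg (hl0 s b) hmp.le, fun s b => ?_,
    fun s => ?_, fun k s a => ?_⟩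
  · rw [div_mul_eq_mul_div, hcs, zero_div]
  · have h1 := hdv (Pi.single s 1)
    have h2 : ∑ s', G.ρ s' * (Pi.single s 1 : G.S → ℝ) s' = G.ρ s := by
      simp [Pi.single_apply]
    have h3 : ∀ s'' b, ∑ s', G.PTeam s'' xt b s' * (Pi.single s 1 : G.S → ℝ) s'
        = G.PTeam s'' xt b s := by
      intro s'' b; simp [Pi.single_apply]
    have h4 : ∑ s', ∑ b, l s' b * (Pi.single s 1 : G.S → ℝ) s' = ∑ b, l s b := by
      simp_rw [← Finset.sum_mul]; simp [Pi.single_apply]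
    rw [h2] at h1
    simp only [h3, mul_sub, Finset.sum_sub_distrib, h4, mul_left_comm _ G.γ,
      ← Finset.mul_sum] at h1
    simp only [div_mul_eq_mul_div, ← Finset.sum_div]
    field_simp
    linarith
  · have h1 := hw (Pi.single k (Pi.single s (Pi.single a 1)))
    have hdx : ∀ k' s' a', G.dxx xt (Pi.single k (Pi.single s (Pi.single a 1))) k' s' a'
        = (Pi.single k (Pi.single s (fun a' => dl a a' - xt k s a')) : G.TeamPolicy) k' s' a' := by
      intro k' s' a'
      by_cases hk : k' = k
      · subst hk
        by_cases hs : s' = s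
        · subst hs
          simp [dxx, dl, Pi.single_apply]
        · simp [dxx, hs]
      · simp [dxx, hk]
    have hk1 : ∀ (c : ∀ k, G.S → G.A k → ℝ) (u : G.A k → ℝ),
        ∑ k', ∑ s', ∑ a', c k' s' a' * (Pi.single k (Pi.single s u) : G.TeamPolicy) k' s' a'
        = ∑ a', c k s a' * u a' := by
      intro c u
      rw [Fintype.sum_eq_single k, Fintype.sum_eq_single s]
      · simp
      · intro s' hs; simp [hs]
      · intro k' hk; simp [hk]
    have hR := hk1 η (Pi.single a 1)
    have hM := hk1 (fun k s a => xt k s a - xh k s a) (fun a' => dl a a' - xt k s a')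
    have hL : ∑ s', ∑ b, l s' b * ∑ k', ∑ a',
        (Pi.single k (Pi.single s (fun a' => dl a a' - xt k s a')) : G.TeamPolicy) k' s' a'
          * G.gk xt v s' b k' a'
        = ∑ b, l s b * (G.gk xt v s b k a - mE (G.sl xt s) (G.gq s b v)) := by
      rw [Fintype.sum_eq_single s]
      · refine Finset.sum_congr rfl fun b _ => ?_
        congr 1
        rw [Fintype.sum_eq_single k]
        · rw [← gk_avg G xt v s b k]
          simp [sub_mul, Finset.sum_sub_distrib, dl]
        · intro k' hk; simp [hk]
      · intro s' hs
        refine Finset.sum_eq_zero fun b _ => ?_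
        rw [Finset.sum_eq_zero, mul_zero]
        intro k' _
        refine Finset.sum_eq_zero fun a' _ => ?_
        by_cases hk : k' = k
        · subst hk; simp [hs]
        · simp [hk]
    simp only [hdx] at h1
    rw [hL, hM, hR] at h1
    have hR' : ∑ a', η k s a' * (Pi.single a 1 : G.A k → ℝ) a' = η k s a := by
      simp [Pi.single_apply]
    have hM' : ∑ a', (xt k s a' - xh k s a') * (dl a a' - xt k s a')
        = (xt k s a - xh k s a) - ∑ a', xt k s a' * (xt k s a' - xh k s a') := by
      simp [mul_sub, Finset.sum_sub_distrib, dl, mul_comm]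
    have hL' : ∑ b, l s b * (G.gk xt v s b k a - mE (G.sl xt s) (G.gq s b v))
        = ∑ b, l s b * (G.gk xt v s b k a - v s) := by
      refine Finset.sum_congr rfl fun b _ => ?_
      linarith [hcs s b]
    rw [hR', hM', hL'] at h1
    have h2 := hη0 k s a
    rw [← h1] at h2
    have h3 : ∑ b, l s b / m * (G.gk xt v s b k a - v s)
        = (∑ b, l s b * (G.gk xt v s b k a - v s)) / m := by
      rw [Finset.sum_div]
      exact Finset.sum_congr rfl fun b _ => by ring
    rw [h3]
    have h4 := div_nonneg h2 hmp.le
    rw [add_div, mul_div_cancel_left₀ _ hmp.ne'] at h4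
    exact h4

end AdvTeamGame
namespace AdvTeamGame

variable (G : AdvTeamGame)

theorem l1_le {x x' : G.TeamPolicy} {ε : ℝ} (h : G.teamNorm (x - x') ≤ ε) (s : G.S) :
    ∑ k, ∑ a, |G.sl x s k a - G.sl x' s k a| ≤ Real.sqrt G.totA * ε := by
  refine le_trans ?_ (mul_le_mul_of_nonneg_left h (Real.sqrt_nonneg _))
  unfold teamNorm
  rw [← Real.sqrt_mul (by unfold totA; positivity)]
  refine Real.le_sqrt_of_sq_le ?_
  have e : ∑ k, ∑ a, |G.sl x s k a - G.sl x' s k a|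
      = ∑ i : (Σ k, G.A k), |G.sl x s i.1 i.2 - G.sl x' s i.1 i.2| := by
    rw [Fintype.sum_sigma]
  rw [e]
  refine sq_sum_le_card_mul_sum_sq.trans ?_
  have hc : ((Finset.univ : Finset (Σ k, G.A k)).card : ℝ) = G.totA := by
    simp [totA]
  rw [hc]
  refine mul_le_mul_of_nonneg_left ?_ (by unfold totA; positivity)
  rw [Fintype.sum_sigma]
  refine Finset.sum_le_sum fun k _ => ?_
  have := Finset.single_le_sum (f := fun s => ∑ a, ((x - x') k s a) ^ 2)
    (fun s _ => Finset.sum_nonneg fun a _ => sq_nonneg _) (Finset.mem_univ s)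
  simpa [sl, sq_abs] using this

theorem coord_le {x x' : G.TeamPolicy} {ε : ℝ} (h : G.teamNorm (x - x') ≤ ε) (k : Fin G.n)
    (s : G.S) (a : G.A k) : |x' k s a - x k s a| ≤ ε := by
  refine le_trans ?_ h
  unfold teamNorm
  refine Real.le_sqrt_of_sq_le ?_
  rw [sq_abs]
  have h1 := Finset.single_le_sum (f := fun a => ((x - x') k s a) ^ 2)
    (fun a _ => sq_nonneg _) (Finset.mem_univ a)
  have h2 := Finset.single_le_sum (f := fun s => ∑ a, ((x - x') k s a) ^ 2)
    (fun s _ => Finset.sum_nonneg fun a _ => sq_nonneg _) (Finset.mem_univ s)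
  have h3 := Finset.single_le_sum (f := fun k => ∑ s, ∑ a, ((x - x') k s a) ^ 2)
    (fun s _ => Finset.sum_nonneg fun a _ => Finset.sum_nonneg fun a _ => sq_nonneg _)
    (Finset.mem_univ k)
  simp only [Pi.sub_apply] at h1 h2 h3 ⊢
  nlinarith

theorem const_bound {ε : ℝ} (hε : 0 ≤ ε) :
    1 / (1 - G.γ) * (Real.sqrt G.totA * ε / (1 - G.γ)
      + G.γ * (Real.sqrt G.totA * ε / (1 - G.γ) ^ 2) + Real.sqrt G.totA * ε / (1 - G.γ) ^ 2)
      ≤ G.c2 * ε := by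
  have hγ : 0 < 1 - G.γ := by linarith [G.γ_lt_one]
  have hγ0 := G.γ_nonneg
  have hS : 1 ≤ G.Scard := by
    unfold Scard; exact_mod_cast Fintype.card_pos
  have hA : 0 ≤ Real.sqrt G.totA := Real.sqrt_nonneg _
  have hL : Real.sqrt G.totA / (1 - G.γ) ^ 2 ≤ G.Lconst := by
    unfold Lconst
    refine div_le_div_of_nonneg_right (Real.sqrt_le_sqrt ?_) (by positivity)
    have : 0 ≤ G.Bcard := by unfold Bcard; positivity
    linarith
  have hL0 : 0 ≤ Real.sqrt G.totA / (1 - G.γ) ^ 2 := by positivity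
  set L := G.Lconst
  unfold c2
  rw [mul_assoc]
  refine mul_le_mul_of_nonneg_left ?_ (by positivity)
  set R := Real.sqrt G.totA / (1 - G.γ) ^ 2
  set Q := Real.sqrt G.totA / (1 - G.γ) with hQ
  have hQ0 : 0 ≤ Q := by positivity
  have e1 : Q = Real.sqrt G.totA + G.γ * Q := by
    rw [hQ]; field_simp; ring
  have h1 : G.γ * Q ≤ G.γ * G.Scard * Q := by
    have := mul_le_mul_of_nonneg_right hS (mul_nonneg hγ0 hQ0)
    linarith
  have h2 : G.γ * R ≤ G.γ * G.Scard * G.Lconst := by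
    have h3 : 1 * R ≤ G.Scard * L := mul_le_mul hS hL hL0 (by linarith)
    have := mul_le_mul_of_nonneg_left h3 hγ0
    linarith
  have : Q + G.γ * R + R ≤ Real.sqrt G.totA + G.γ * G.Scard * Real.sqrt G.totA / (1 - G.γ)
      + G.γ * G.Scard * L + L := by
    rw [mul_div_assoc]
    linarith
  refine le_trans (le_of_eq ?_) (mul_le_mul_of_nonneg_right this hε)
  simp only [Q, R]; ring

end AdvTeamGame

open AdvTeamGame in
/-- For any `ε`-nearly stationary point `x̂` of `φ` and corresponding
optimal value vector `v̂`, the linear program `LP_adv` is feasible: there exist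
nonnegative multipliers `λ` satisfying constraints (i), (ii), (iii). -/
theorem lp_adv_feasible
    (G : AdvTeamGame) (ε : ℝ)
    (xh : G.TeamPolicy) (hxh : G.IsTeamPolicy xh)
    (hstat : G.IsNearlyStationary ε xh)
    (vh : G.S → ℝ)
    (hvh_feas : ∀ s b, G.rTeam s xh b + G.γ * ∑ s', G.PTeam s xh b s' * vh s' ≤ vh s)
    (hvh_opt : ∀ v : G.S → ℝ,
      (∀ s b, G.rTeam s xh b + G.γ * ∑ s', G.PTeam s xh b s' * v s' ≤ v s) →
      G.ρ ⬝ᵥ vh ≤ G.ρ ⬝ᵥ v) :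
    ∃ lam : G.S → G.B → ℝ,
      (∀ s b, 0 ≤ lam s b) ∧
      (∀ (k : Fin G.n) (s : G.S) (a : G.A k),
        -(G.c1 * ε) ≤ ∑ b, lam s b *
          (G.rTeam s (G.devPolicy xh k a) b
            + G.γ * ∑ s', G.PTeam s (G.devPolicy xh k a) b s' * vh s' - vh s)) ∧
      (∀ s b,
        -(G.c2 * ε) ≤
            lam s b * (G.rTeam s xh b + G.γ * ∑ s', G.PTeam s xh b s' * vh s' - vh s) ∧
          lam s b * (G.rTeam s xh b + G.γ * ∑ s', G.PTeam s xh b s' * vh s' - vh s) ≤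
            G.c2 * ε) ∧
      (∀ s, G.ρ s ≤ ∑ b, lam s b ∧ ∑ b, lam s b ≤ 1 / (1 - G.γ)) := by
  have hγ : 0 < 1 - G.γ := by linarith [G.γ_lt_one]
  obtain ⟨xt, hxt, hmin, hε'⟩ := hstat
  have hε : 0 ≤ ε := le_trans (Real.sqrt_nonneg _) hε'
  simp only [bell_eq] at hvh_feas hvh_opt ⊢
  have hvo : G.IsOpt xh vh := G.opt_of_min hxh hvh_feas hvh_opt
  obtain ⟨v, hv⟩ := G.exists_opt hxt
  obtain ⟨lam, h0, hcs, hflow, hst⟩ := G.kkt hxt hv hmin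
  have hl1 := fun s => G.l1_le hε' s
  have hD := G.opt_lip hxh hxt hvo hv hl1
  have hb := G.opt_bound hxh hvo
  have hcb := G.const_bound hε
  set δ := Real.sqrt G.totA * ε with hδ
  set C := δ / (1 - G.γ) + G.γ * (δ / (1 - G.γ) ^ 2) + δ / (1 - G.γ) ^ 2 with hC
  have hC0 : 0 ≤ C := by
    have := G.γ_nonneg
    have : 0 ≤ δ := by positivity
    positivity
  have hdiff : ∀ (p p' : ∀ k, G.A k → ℝ), mProb p → mProb p' →
      ∑ k, ∑ a, |p k a - p' k a| ≤ δ → ∀ s b,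
      |(mE p (G.gq s b vh) - vh s) - (mE p' (G.gq s b v) - v s)| ≤ C := by
    intro p p' hp hp' h s b
    have h1 := abs_le.1 (G.bell_diff hp hp' hb hD h s b)
    have h2 := abs_le.1 (hD s)
    rw [abs_le]
    constructor <;> linarith
  have hge : ∀ s, G.ρ s ≤ ∑ b, lam s b := by
    intro s
    rw [hflow s]
    have : 0 ≤ G.γ * ∑ s', ∑ b, lam s' b * G.PTeam s' xt b s :=
      mul_nonneg G.γ_nonneg (Finset.sum_nonneg fun s' _ => Finset.sum_nonneg fun b _ =>
        mul_nonneg (h0 s' b) (G.PTeam_nonneg hxt s' b s))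
    linarith
  have htot : ∑ s, ∑ b, lam s b = 1 / (1 - G.γ) := by
    have h1 : ∑ s, ∑ b, lam s b = 1 + G.γ * ∑ s, ∑ b, lam s b := by
      conv_lhs => rw [Finset.sum_congr rfl fun s _ => hflow s]
      rw [Finset.sum_add_distrib, G.ρ_sum_one, ← Finset.mul_sum, Finset.sum_comm]
      congr 2
      refine Finset.sum_congr rfl fun s _ => ?_
      rw [Finset.sum_comm]
      refine Finset.sum_congr rfl fun b _ => ?_
      rw [← Finset.mul_sum, G.PTeam_sum hxt, mul_one]
    rw [eq_div_iff hγ.ne']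
    linarith
  have hle : ∀ s, ∑ b, lam s b ≤ 1 / (1 - G.γ) := by
    intro s
    rw [← htot]
    exact Finset.single_le_sum (f := fun s => ∑ b, lam s b)
      (fun s _ => Finset.sum_nonneg fun b _ => h0 s b) (Finset.mem_univ s)
  have hle1 : ∀ s b, lam s b ≤ 1 / (1 - G.γ) := fun s b =>
    (Finset.single_le_sum (f := fun b => lam s b) (fun b _ => h0 s b) (Finset.mem_univ b)).trans
      (hle s)
  refine ⟨lam, h0, fun k s a => ?_, fun s b => ⟨?_, ?_⟩, fun s => ⟨hge s, hle s⟩⟩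
  · rw [sl_dev]
    have h1 := hst k s a
    have hsum : ∑ j, ∑ a', |Function.update (G.sl xh s) k (dl a) j a'
        - Function.update (G.sl xt s) k (dl a) j a'| ≤ δ := by
      refine le_trans (Finset.sum_le_sum fun j _ => Finset.sum_le_sum fun a' _ => ?_) (hl1 s)
      by_cases hj : j = k
      · subst hj; simp
      · rw [Function.update_of_ne hj, Function.update_of_ne hj]
    have h2 : ∀ b, lam s b * (G.gk xt v s b k a - v s) - lam s b * C ≤
        lam s b * (mE (Function.update (G.sl xh s) k (dl a)) (G.gq s b vh) - vh s) := by
      intro b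
      have h3 := (abs_le.1 (hdiff _ _ (mProb_dl (G.sl_prob hxh s) k a)
        (mProb_dl (G.sl_prob hxt s) k a) hsum s b)).1
      rw [← mul_sub]
      refine mul_le_mul_of_nonneg_left ?_ (h0 s b)
      simp only [gk]
      linarith
    have h3 := Finset.sum_le_sum fun b (_ : b ∈ Finset.univ) => h2 b
    rw [Finset.sum_sub_distrib, ← Finset.sum_mul] at h3
    have h4 := mul_le_mul_of_nonneg_right (hle s) hC0
    have h5 := (abs_le.1 (G.coord_le hε' k s a)).2
    have h6 : -ε ≤ ∑ a', xt k s a' * (xt k s a' - xh k s a') := by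
      have : ∑ a', xt k s a' * (-ε) ≤ ∑ a', xt k s a' * (xt k s a' - xh k s a') :=
        Finset.sum_le_sum fun a' _ => mul_le_mul_of_nonneg_left
          (abs_le.1 (G.coord_le hε' k s a')).1 (hxt.1 k s a')
      rwa [← Finset.sum_mul, hxt.2, one_mul] at this
    have hl : 0 ≤ G.lconst := by
      unfold lconst totA Bcard; positivity
    have h7 : 2 * G.lconst * ((xt k s a - xh k s a)
        - ∑ a', xt k s a' * (xt k s a' - xh k s a')) ≤ 2 * G.lconst * (2 * ε) :=
      mul_le_mul_of_nonneg_left (by linarith) (by positivity)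
    unfold c1
    linarith
  · have h1 := (abs_le.1 (hdiff _ _ (G.sl_prob hxh s) (G.sl_prob hxt s) (hl1 s) s b)).1
    have h2 := mul_le_mul_of_nonneg_left h1 (h0 s b)
    rw [mul_sub, hcs, sub_zero] at h2
    have h4 := mul_le_mul_of_nonneg_right (hle1 s b) hC0
    linarith
  · have h1 := mul_nonneg (h0 s b) (sub_nonneg.2 (hvh_feas s b))
    have h2 : 0 ≤ 1 / (1 - G.γ) * C := by positivity
    linarith
end

section
/- Let an adversarial team Markov game be given and set ℓ := 2(A₁+⋯+Aₙ+B)/(1−γ)³. Fix any team policy x̂, let x̃ be a minimizer over team policies of x' ↦ φ(x') + ℓ·‖x̂ − x'‖², where φ(x) := max over adversary policies y of V_ρ(x,y), and let ṽ ∈ ℝ^S be a minimizer of ρᵀv over K(x̃) := {v ∈ ℝ^S : r(s,x̃,b) + γ·Σ_{s'} P(s'|s,x̃,b)·v(s') ≤ v(s) for all (s,b)}. Then (x̃, ṽ) is a global minimum of the program Q-NLP: for every team policy x and every v ∈ K(x) := {v ∈ ℝ^S : r(s,x,b) + γ·Σ_{s'} P(s'|s,x,b)·v(s') ≤ v(s)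 for all (s,b)}, one has ρᵀv + ℓ·‖x − x̂‖² ≥ ρᵀṽ + ℓ·‖x̃ − x̂‖². -/
open Matrix

namespace AdvTeamGame

theorem aux_team_sum (G : AdvTeamGame) (x : G.TeamPolicy) (hx : G.IsTeamPolicy x) (s : G.S) :
    ∑ a : ∀ k, G.A k, (∏ k, x k s (a k)) = 1 := by
  have h := Finset.prod_univ_sum (fun k => (Finset.univ : Finset (G.A k))) (fun k a => x k s a)
  rw [Fintype.piFinset_univ] at h
  rw [← h]
  exact Finset.prod_eq_one fun k _ => hx.2 k s

theorem aux_P_nonneg (G : AdvTeamGame) (x : G.TeamPolicy) (hx : G.IsTeamPolicy x) (s : G.S)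
    (b : G.B) (s' : G.S) : 0 ≤ G.PTeam s x b s' :=
  Finset.sum_nonneg fun a _ =>
    mul_nonneg (Finset.prod_nonneg fun k _ => hx.1 k s (a k)) (G.P_nonneg s a b s')

theorem aux_P_sum (G : AdvTeamGame) (x : G.TeamPolicy) (hx : G.IsTeamPolicy x) (s : G.S)
    (b : G.B) : ∑ s', G.PTeam s x b s' = 1 := by
  unfold PTeam
  rw [Finset.sum_comm]
  simp_rw [← Finset.mul_sum, G.P_sum_one, mul_one]
  exact aux_team_sum G x hx s

theorem aux_M_nonneg (G : AdvTeamGame) (x : G.TeamPolicy) (hx : G.IsTeamPolicy x)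
    (y : G.AdvPolicy) (hy : G.IsAdvPolicy y) (s s' : G.S) : 0 ≤ G.PMat x y s s' :=
  Finset.sum_nonneg fun b _ => mul_nonneg (hy.1 s b) (aux_P_nonneg G x hx s b s')

theorem aux_M_sum (G : AdvTeamGame) (x : G.TeamPolicy) (hx : G.IsTeamPolicy x)
    (y : G.AdvPolicy) (hy : G.IsAdvPolicy y) (s : G.S) : ∑ s', G.PMat x y s s' = 1 := by
  simp only [PMat, Matrix.of_apply]
  rw [Finset.sum_comm]
  simp_rw [← Finset.mul_sum, aux_P_sum G x hx, mul_one]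
  exact hy.2 s

theorem aux_max (G : AdvTeamGame) (x : G.TeamPolicy) (hx : G.IsTeamPolicy x)
    (y : G.AdvPolicy) (hy : G.IsAdvPolicy y) (w : G.S → ℝ)
    (hw : ∀ s, G.γ * ∑ s', G.PMat x y s s' * w s' ≤ w s) : ∀ s, 0 ≤ w s := by
  obtain ⟨s0, h0⟩ := Finite.exists_min w
  have h1 : w s0 ≤ ∑ s', G.PMat x y s0 s' * w s' := by
    calc w s0 = ∑ s', G.PMat x y s0 s' * w s0 := by
          rw [← Finset.sum_mul, aux_M_sum G x hx y hy, one_mul]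
      _ ≤ _ := Finset.sum_le_sum fun s' _ =>
          mul_le_mul_of_nonneg_left (h0 s') (aux_M_nonneg G x hx y hy s0 s')
  have h2 := mul_le_mul_of_nonneg_left h1 G.γ_nonneg
  have h3 := hw s0
  have h4 := G.γ_lt_one
  have h5 : 0 ≤ w s0 := by
    by_contra! h
    nlinarith
  exact fun s => h5.trans (h0 s)

theorem aux_apply (G : AdvTeamGame) (x : G.TeamPolicy) (y : G.AdvPolicy) (w : G.S → ℝ) (s : G.S) :
    ((1 - G.γ • G.PMat x y) *ᵥ w) s = w s - G.γ * ∑ s', G.PMat x y s s' * w s' := by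
  rw [Matrix.sub_mulVec, Matrix.one_mulVec, Matrix.smul_mulVec]
  simp [Matrix.mulVec, dotProduct]

theorem aux_unit (G : AdvTeamGame) (x : G.TeamPolicy) (hx : G.IsTeamPolicy x)
    (y : G.AdvPolicy) (hy : G.IsAdvPolicy y) : IsUnit (1 - G.γ • G.PMat x y) := by
  rw [← Matrix.mulVec_injective_iff_isUnit]
  have key : ∀ u v : G.S → ℝ,
      (1 - G.γ • G.PMat x y) *ᵥ u = (1 - G.γ • G.PMat x y) *ᵥ v → ∀ s, v s ≤ u s := by
    intro u v h s
    have := aux_max G x hx y hy (u - v) (fun s => by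
      have h1 := aux_apply G x y (u - v) s
      rw [Matrix.mulVec_sub, h, sub_self] at h1
      simp only [Pi.zero_apply] at h1
      linarith) s
    simpa using this
  intro u v h
  exact funext fun s => le_antisymm (key v u h.symm s) (key u v h s)

/-- weak duality -/
theorem aux_le (G : AdvTeamGame) (x : G.TeamPolicy) (hx : G.IsTeamPolicy x)
    (y : G.AdvPolicy) (hy : G.IsAdvPolicy y) (v : G.S → ℝ)
    (hv : ∀ s b, G.rTeam s x b + G.γ * ∑ s', G.PTeam s x b s' * v s' ≤ v s) :
    G.V x y ≤ G.ρ ⬝ᵥ v := by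
  have hdet := (Matrix.isUnit_iff_isUnit_det _).1 (aux_unit G x hx y hy)
  set u := (1 - G.γ • G.PMat x y)⁻¹ *ᵥ G.rVec x y with hu
  have hu' : (1 - G.γ • G.PMat x y) *ᵥ u = G.rVec x y := by
    rw [hu, Matrix.mulVec_mulVec, Matrix.mul_nonsing_inv _ hdet, Matrix.one_mulVec]
  have hle : ∀ s, 0 ≤ (v - u) s := by
    apply aux_max G x hx y hy
    intro s
    have h1 := aux_apply G x y u s
    rw [hu'] at h1
    have h2 : ∑ b, y s b * (G.rTeam s x b + G.γ * ∑ s', G.PTeam s x b s' * v s')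
        ≤ ∑ b, y s b * v s :=
      Finset.sum_le_sum fun b _ => mul_le_mul_of_nonneg_left (hv s b) (hy.1 s b)
    rw [← Finset.sum_mul, hy.2, one_mul] at h2
    have h3 : ∑ b, y s b * (G.rTeam s x b + G.γ * ∑ s', G.PTeam s x b s' * v s')
        = G.rVec x y s + G.γ * ∑ s', G.PMat x y s s' * v s' := by
      simp only [rVec, PMat, Matrix.of_apply, mul_add, Finset.sum_add_distrib, Finset.mul_sum,
        Finset.sum_mul]
      congr 1
      rw [Finset.sum_comm]
      exact Finset.sum_congr rfl fun _ _ => Finset.sum_congr rfl fun _ _ => by ring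
    have h4 : ∑ s', G.PMat x y s s' * (v - u) s' =
        ∑ s', G.PMat x y s s' * v s' - ∑ s', G.PMat x y s s' * u s' := by
      simp [mul_sub, Finset.sum_sub_distrib]
    rw [h4, Pi.sub_apply, mul_sub]
    linarith
  unfold V
  exact Finset.sum_le_sum fun s _ => mul_le_mul_of_nonneg_left
    (by have := hle s; simp only [Pi.sub_apply] at this; linarith) (G.ρ_pos s).le

/-- at the optimum some constraint is tight in each state -/
theorem aux_tight (G : AdvTeamGame) (x : G.TeamPolicy) (hx : G.IsTeamPolicy x) (v : G.S → ℝ)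
    (hv : ∀ s b, G.rTeam s x b + G.γ * ∑ s', G.PTeam s x b s' * v s' ≤ v s)
    (hopt : ∀ w : G.S → ℝ,
      (∀ s b, G.rTeam s x b + G.γ * ∑ s', G.PTeam s x b s' * w s' ≤ w s) →
      G.ρ ⬝ᵥ v ≤ G.ρ ⬝ᵥ w) (s : G.S) :
    ∃ b, G.rTeam s x b + G.γ * ∑ s', G.PTeam s x b s' * v s' = v s := by
  by_contra! hne
  obtain ⟨b0, h0⟩ := Finite.exists_max
    (fun b => G.rTeam s x b + G.γ * ∑ s', G.PTeam s x b s' * v s')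
  have hlt := lt_of_le_of_ne (hv s b0) (hne b0)
  set c := G.rTeam s x b0 + G.γ * ∑ s', G.PTeam s x b0 s' * v s' with hc
  have hwv : ∀ t, Function.update v s c t ≤ v t := by
    intro t
    by_cases h : t = s
    · subst h; simpa using hlt.le
    · simp [h]
  have h1 := hopt (Function.update v s c) (by
    intro t b
    have hm : G.rTeam t x b + G.γ * ∑ s', G.PTeam t x b s' * Function.update v s c s' ≤
        G.rTeam t x b + G.γ * ∑ s', G.PTeam t x b s' * v s' := by
      have := mul_le_mul_of_nonneg_left (Finset.sum_le_sum fun s' (_ : s' ∈ Finset.univ) =>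
        mul_le_mul_of_nonneg_left (hwv s') (aux_P_nonneg G x hx t b s')) G.γ_nonneg
      linarith
    refine hm.trans ?_
    by_cases h : t = s
    · subst h; simpa using h0 b
    · simpa [h] using hv t b)
  have h2 : G.ρ ⬝ᵥ Function.update v s c < G.ρ ⬝ᵥ v :=
    Finset.sum_lt_sum (fun t _ => mul_le_mul_of_nonneg_left (hwv t) (G.ρ_pos t).le)
      ⟨s, Finset.mem_univ _, mul_lt_mul_of_pos_left (by simpa using hlt) (G.ρ_pos s)⟩
  linarith

theorem aux_exists (G : AdvTeamGame) (x : G.TeamPolicy) (hx : G.IsTeamPolicy x) (v : G.S → ℝ)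
    (h : ∀ s, ∃ b, G.rTeam s x b + G.γ * ∑ s', G.PTeam s x b s' * v s' = v s) :
    ∃ y, G.IsAdvPolicy y ∧ G.ρ ⬝ᵥ v = G.V x y := by
  classical
  choose β hβ using h
  have hy : G.IsAdvPolicy (fun s b => if b = β s then 1 else 0) :=
    ⟨fun s b => by dsimp only; split_ifs <;> norm_num, fun s => by simp⟩
  refine ⟨_, hy, ?_⟩
  set y : G.AdvPolicy := fun s b => if b = β s then 1 else 0 with hyd
  have hdet := (Matrix.isUnit_iff_isUnit_det _).1 (aux_unit G x hx y hy)
  have hr : G.rVec x y = (1 - G.γ • G.PMat x y) *ᵥ v := by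
    funext s
    rw [aux_apply]
    have := hβ s
    simp only [rVec, PMat, Matrix.of_apply, hyd, ite_mul, one_mul, zero_mul,
      Finset.sum_ite_eq', Finset.sum_ite_eq, Finset.mem_univ, if_true]
    linarith
  unfold V
  rw [hr, Matrix.mulVec_mulVec, Matrix.nonsing_inv_mul _ hdet, Matrix.one_mulVec]

theorem aux_norm (G : AdvTeamGame) (x z : G.TeamPolicy) : G.teamNorm (x - z) = G.teamNorm (z - x) := by
  unfold teamNorm
  congr 1
  refine Finset.sum_congr rfl fun k _ => Finset.sum_congr rfl fun s _ =>
    Finset.sum_congr rfl fun a _ => ?_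
  simp only [Pi.sub_apply]
  ring

end AdvTeamGame

open AdvTeamGame in
/-- Let `x̃` minimize `x' ↦ φ(x') + ℓ‖x̂ − x'‖²` over team policies and let
`ṽ` minimize `ρᵀv` over the feasible set `K(x̃)`. Then `(x̃, ṽ)` is a global minimum of the
program Q-NLP. -/
theorem qnlp_global_minimum
    (G : AdvTeamGame)
    (xh : G.TeamPolicy) (hxh : G.IsTeamPolicy xh)
    (xt : G.TeamPolicy) (hxt : G.IsTeamPolicy xt)
    (hxt_min : ∀ x' : G.TeamPolicy, G.IsTeamPolicy x' →
      G.phi xt + G.lconst * G.teamNorm (xh - xt) ^ 2 ≤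
        G.phi x' + G.lconst * G.teamNorm (xh - x') ^ 2)
    (vt : G.S → ℝ)
    (hvt_feas : ∀ s b, G.rTeam s xt b + G.γ * ∑ s', G.PTeam s xt b s' * vt s' ≤ vt s)
    (hvt_opt : ∀ v : G.S → ℝ,
      (∀ s b, G.rTeam s xt b + G.γ * ∑ s', G.PTeam s xt b s' * v s' ≤ v s) →
      G.ρ ⬝ᵥ vt ≤ G.ρ ⬝ᵥ v) :
    ∀ x : G.TeamPolicy, G.IsTeamPolicy x →
      ∀ v : G.S → ℝ,
        (∀ s b, G.rTeam s x b + G.γ * ∑ s', G.PTeam s x b s' * v s' ≤ v s) →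
        G.ρ ⬝ᵥ vt + G.lconst * G.teamNorm (xt - xh) ^ 2 ≤
          G.ρ ⬝ᵥ v + G.lconst * G.teamNorm (x - xh) ^ 2 := by
  intro x hx v hv
  have h1 : G.ρ ⬝ᵥ vt ≤ G.phi xt := by
    refine le_csSup ⟨G.ρ ⬝ᵥ vt, ?_⟩
      (aux_exists G xt hxt vt (aux_tight G xt hxt vt hvt_feas hvt_opt))
    rintro _ ⟨y, hy, rfl⟩
    exact aux_le G xt hxt y hy vt hvt_feas
  have h2 : G.phi x ≤ G.ρ ⬝ᵥ v := by
    classical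
    refine csSup_le ⟨_, fun s b => if b = Classical.arbitrary G.B then 1 else 0,
      ⟨fun s b => ?_, fun s => ?_⟩, rfl⟩ ?_
    · dsimp only; split_ifs <;> norm_num
    · simp
    · rintro _ ⟨y, hy, rfl⟩
      exact aux_le G x hx y hy v hv
  have h3 := hxt_min x hx
  rw [aux_norm G xt xh, aux_norm G x xh]
  linarith
end

section
/- Let an adversarial team Markov game be given with full-support initial distribution ρ, and fix a team policy x. Suppose λ : S×B → ℝ satisfies λ(s,b) ≥ 0 for all (s,b) and the stationarity equations: for every state s̄, ρ(s̄) + γ·Σ_{s∈S} Σ_{b∈B} λ(s,b)·P(s̄|s,x,b) − Σ_{b∈B} λ(s̄,b) = 0. Then Σ_{b∈B} λ(s,b) > 0 for every state s; and if the adversary policy y is defined by y_s(b) := λ(s,b)/Σ_{b'∈B} λ(s,b'), then for every state s, Σ_{b∈B} λ(s,b) = d^{x,y}_ρ(s), where the discounted visitation measure d^{x,y}_ρ is defined by (d^{x,y}_ρ)ᵀ := ρᵀ(I − γ·P(x,y))⁻¹. -/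
open Matrix

open AdvTeamGame in
/-- If nonnegative multipliers `λ` satisfy the dual stationarity
equations, then every per-state mass `Σ_b λ(s,b)` is positive, and normalizing `λ`
yields an adversary policy `y` whose discounted visitation measure under `(x, y)`
coincides with the per-state mass of `λ`. -/
theorem lagrange_multipliers_are_visitation
    (G : AdvTeamGame) (x : G.TeamPolicy) (hx : G.IsTeamPolicy x)
    (lam : G.S → G.B → ℝ) (hlam_nonneg : ∀ s b, 0 ≤ lam s b)
    (hstat : ∀ sb : G.S,
      G.ρ sb + G.γ * ∑ s, ∑ b, lam s b * G.PTeam s x b sb - ∑ b, lam sb b = 0) :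
    (∀ s, 0 < ∑ b, lam s b) ∧
      ∀ y : G.AdvPolicy, (∀ s b, y s b = lam s b / ∑ b', lam s b') →
        ∀ s, ∑ b, lam s b = G.visitation x y s := by
  have hPn : ∀ s b s', 0 ≤ G.PTeam s x b s' := fun s b s' =>
    Finset.sum_nonneg fun a _ =>
      mul_nonneg (Finset.prod_nonneg fun k _ => hx.1 k s (a k)) (G.P_nonneg s a b s')
  have hPs : ∀ s b, ∑ s', G.PTeam s x b s' = 1 := by
    intro s b
    unfold AdvTeamGame.PTeam
    rw [Finset.sum_comm]
    simp_rw [← Finset.mul_sum, G.P_sum_one, mul_one]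
    have h := Finset.prod_univ_sum (fun k : Fin G.n => (Finset.univ : Finset (G.A k)))
      (fun k a => x k s a)
    rw [Fintype.piFinset_univ] at h
    rw [← h]
    simp [hx.2]
  have hpos : ∀ s, 0 < ∑ b, lam s b := by
    intro s
    have h1 := hstat s
    have h2 : 0 ≤ G.γ * ∑ s', ∑ b, lam s' b * G.PTeam s' x b s :=
      mul_nonneg G.γ_nonneg (Finset.sum_nonneg fun s' _ => Finset.sum_nonneg fun b _ =>
        mul_nonneg (hlam_nonneg s' b) (hPn s' b s))
    have h3 := G.ρ_pos s
    linarith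
  refine ⟨hpos, fun y hy => ?_⟩
  have hyn : ∀ s b, 0 ≤ y s b := fun s b => by
    rw [hy]; exact div_nonneg (hlam_nonneg s b) (hpos s).le
  have hys : ∀ s, ∑ b, y s b = 1 := fun s => by
    simp_rw [hy, ← Finset.sum_div]; exact div_self (hpos s).ne'
  have hMn : ∀ s s', 0 ≤ G.PMat x y s s' := fun s s' =>
    Finset.sum_nonneg fun b _ => mul_nonneg (hyn s b) (hPn s b s')
  have hMs : ∀ s, ∑ s', G.PMat x y s s' = 1 := by
    intro s
    simp only [AdvTeamGame.PMat, Matrix.of_apply]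
    rw [Finset.sum_comm]
    simp_rw [← Finset.mul_sum, hPs, mul_one, hys]
  have hdet : (1 - G.γ • G.PMat x y).det ≠ 0 := by
    apply det_ne_zero_of_sum_row_lt_diag
    intro k
    have h1 : ∑ j ∈ Finset.univ.erase k, ‖(1 - G.γ • G.PMat x y) k j‖
        = ∑ j ∈ Finset.univ.erase k, G.γ * G.PMat x y k j := by
      apply Finset.sum_congr rfl
      intro j hj
      have hjk : k ≠ j := (Finset.ne_of_mem_erase hj).symm
      simp [Matrix.one_apply_ne hjk, abs_of_nonneg G.γ_nonneg, abs_of_nonneg (hMn k j)]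
    have h2 : (1 - G.γ • G.PMat x y) k k = 1 - G.γ * G.PMat x y k k := by simp
    have h3 := Finset.add_sum_erase Finset.univ (fun j => G.PMat x y k j) (Finset.mem_univ k)
    rw [hMs] at h3
    rw [h1, h2, ← Finset.mul_sum, Real.norm_eq_abs]
    refine lt_of_lt_of_le ?_ (le_abs_self _)
    have h4 := G.γ_lt_one
    have h5 : ∑ j ∈ Finset.univ.erase k, G.PMat x y k j = 1 - G.PMat x y k k := by linarith
    rw [h5]
    linarith
  have hunit : IsUnit (1 - G.γ • G.PMat x y).det := isUnit_iff_ne_zero.mpr hdet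
  have key : (fun s => ∑ b, lam s b) ᵥ* (1 - G.γ • G.PMat x y) = G.ρ := by
    rw [Matrix.vecMul_sub, Matrix.vecMul_one, Matrix.vecMul_smul]
    funext t
    have h1 : ((fun s => ∑ b, lam s b) ᵥ* G.PMat x y) t
        = ∑ s, ∑ b, lam s b * G.PTeam s x b t := by
      simp only [Matrix.vecMul, dotProduct, AdvTeamGame.PMat, Matrix.of_apply]
      refine Finset.sum_congr rfl fun s _ => ?_
      rw [Finset.mul_sum]
      refine Finset.sum_congr rfl fun b _ => ?_
      rw [hy, ← mul_assoc, mul_div_cancel₀ _ (hpos s).ne']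
    have h2 := hstat t
    simp only [Pi.sub_apply, Pi.smul_apply, smul_eq_mul, h1]
    linarith
  intro s
  unfold AdvTeamGame.visitation
  rw [← key, Matrix.vecMul_vecMul, Matrix.mul_nonsing_inv _ hunit, Matrix.vecMul_one]
end

section
/- Let an adversarial team Markov game be given. Then the value function is Lipschitz continuous on the set of joint policies with constant √(A₁+⋯+Aₙ+B)/(1−γ)²: for all joint policies (x,y) and (x',y'), |V_ρ(x,y) − V_ρ(x',y')| ≤ (√(A₁+⋯+Aₙ+B)/(1−γ)²)·‖(x,y) − (x',y')‖, where the norm is the Euclidean norm of the concatenated policy coordinate vectors. -/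
open Matrix

namespace AdvTeamGame

/-- Euclidean distance between two joint policies (concatenated coordinate vectors). -/
noncomputable def jointDist (G : AdvTeamGame) (x x' : G.TeamPolicy)
    (y y' : G.AdvPolicy) : ℝ :=
  Real.sqrt ((∑ k, ∑ s, ∑ a, (x k s a - x' k s a) ^ 2) + ∑ s, ∑ b, (y s b - y' s b) ^ 2)

end AdvTeamGame

namespace LipAux

theorem prod_sum_one {n : ℕ} {A : Fin n → Type} [∀ k, Fintype (A k)]
    (x : ∀ k, A k → ℝ) (h : ∀ k, ∑ a, x k a = 1) :
    ∑ a : ∀ k, A k, ∏ k, x k (a k) = 1 := by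
  classical
  rw [← Fintype.prod_sum]
  simp [h]

theorem l1_prod : ∀ {n : ℕ} {A : Fin n → Type} [∀ k, Fintype (A k)]
    (x x' : ∀ k, A k → ℝ), (∀ k a, 0 ≤ x k a) → (∀ k a, 0 ≤ x' k a) →
    (∀ k, ∑ a, x k a = 1) → (∀ k, ∑ a, x' k a = 1) →
    ∑ a : ∀ k, A k, |∏ k, x k (a k) - ∏ k, x' k (a k)| ≤ ∑ k, ∑ a, |x k a - x' k a| := by
  intro n
  induction n with
  | zero => intro A _ x x' _ _ _ _; simp
  | succ n ih =>
    intro A _ x x' h h' h1 h1'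
    rw [← (Fin.consEquiv A).sum_comp, Fintype.sum_prod_type, Fin.sum_univ_succ]
    have key : ∀ (a : A 0) (f : ∀ i : Fin n, A i.succ),
        |∏ k, x k (Fin.consEquiv A (a, f) k) - ∏ k, x' k (Fin.consEquiv A (a, f) k)| ≤
        |x 0 a - x' 0 a| * (∏ k : Fin n, x k.succ (f k)) +
        x' 0 a * |∏ k : Fin n, x k.succ (f k) - ∏ k : Fin n, x' k.succ (f k)| := by
      intro a f
      rw [Fin.prod_univ_succ, Fin.prod_univ_succ]
      simp only [Fin.consEquiv_apply, Fin.cons_zero, Fin.cons_succ]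
      have hp : 0 ≤ ∏ k : Fin n, x k.succ (f k) := Finset.prod_nonneg fun k _ => h _ _
      generalize (∏ k : Fin n, x k.succ (f k)) = p at *
      generalize (∏ k : Fin n, x' k.succ (f k)) = q at *
      calc |x 0 a * p - x' 0 a * q| = |(x 0 a - x' 0 a) * p + x' 0 a * (p - q)| := by ring_nf
        _ ≤ _ := abs_add_le _ _
        _ = _ := by rw [abs_mul, abs_mul, abs_of_nonneg hp, abs_of_nonneg (h' 0 a)]
    refine (Finset.sum_le_sum fun a _ => Finset.sum_le_sum fun f _ => key a f).trans ?_
    simp only [Finset.sum_add_distrib, ← Finset.mul_sum, ← Finset.sum_mul]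
    rw [prod_sum_one (fun k : Fin n => x k.succ) (fun k => h1 _), h1', mul_one, one_mul]
    gcongr
    exact ih (fun k : Fin n => x k.succ) (fun k => x' k.succ) (fun k => h _) (fun k => h' _)
      (fun k => h1 _) (fun k => h1' _)

theorem fix_bound {S : Type} [Fintype S] [Nonempty S] (P : S → S → ℝ) (γ C : ℝ)
    (hP : ∀ s s', 0 ≤ P s s') (hP1 : ∀ s, ∑ s', P s s' = 1) (h0 : 0 ≤ γ) (h1 : γ < 1)
    (d e : S → ℝ) (hd : ∀ s, d s = e s + γ * ∑ s', P s s' * d s') (he : ∀ s, |e s| ≤ C) (s : S) :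
    |d s| ≤ C / (1 - γ) := by
  obtain ⟨m, hm⟩ := Finite.exists_max (fun s => |d s|)
  refine (hm s).trans ?_
  rw [le_div_iff₀ (by linarith)]
  have h2 : |∑ s', P m s' * d s'| ≤ |d m| := by
    calc _ ≤ ∑ s', |P m s' * d s'| := Finset.abs_sum_le_sum_abs _ _
      _ ≤ ∑ s', P m s' * |d m| := Finset.sum_le_sum fun s' _ => by
          rw [abs_mul, abs_of_nonneg (hP _ _)]
          exact mul_le_mul_of_nonneg_left (hm s') (hP _ _)
      _ = |d m| := by rw [← Finset.sum_mul, hP1, one_mul]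
  have h3 : |d m| ≤ C + γ * |d m| := by
    conv_lhs => rw [hd m]
    refine (abs_add_le _ _).trans (add_le_add (he m) ?_)
    rw [abs_mul, abs_of_nonneg h0]
    exact mul_le_mul_of_nonneg_left h2 h0
  linarith

variable (G : AdvTeamGame)

/-- Joint weight. -/
noncomputable def w (x : G.TeamPolicy) (y : G.AdvPolicy) (s : G.S) (b : G.B)
    (a : ∀ k, G.A k) : ℝ := y s b * ∏ k, x k s (a k)

theorem w_nonneg {x : G.TeamPolicy} {y : G.AdvPolicy} (hx : G.IsTeamPolicy x)
    (hy : G.IsAdvPolicy y) (s b a) : 0 ≤ w G x y s b a :=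
  mul_nonneg (hy.1 _ _) (Finset.prod_nonneg fun k _ => hx.1 _ _ _)

theorem w_sum {x : G.TeamPolicy} {y : G.AdvPolicy} (hx : G.IsTeamPolicy x)
    (hy : G.IsAdvPolicy y) (s) : ∑ b, ∑ a, w G x y s b a = 1 := by
  simp only [w, ← Finset.mul_sum]
  rw [prod_sum_one (fun k => x k s) (fun k => hx.2 k s)]
  simp [hy.2 s]

theorem rVec_eq (x : G.TeamPolicy) (y : G.AdvPolicy) (s) :
    G.rVec x y s = ∑ b, ∑ a, w G x y s b a * G.r s a b := by
  simp only [AdvTeamGame.rVec, AdvTeamGame.rTeam, w, Finset.mul_sum, mul_assoc]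

theorem PMat_eq (x : G.TeamPolicy) (y : G.AdvPolicy) (s s') :
    G.PMat x y s s' = ∑ b, ∑ a, w G x y s b a * G.P s a b s' := by
  simp only [AdvTeamGame.PMat, AdvTeamGame.PTeam, w, Finset.mul_sum, mul_assoc, Matrix.of_apply]

theorem PMat_nonneg {x : G.TeamPolicy} {y : G.AdvPolicy} (hx : G.IsTeamPolicy x)
    (hy : G.IsAdvPolicy y) (s s') : 0 ≤ G.PMat x y s s' := by
  rw [PMat_eq]
  exact Finset.sum_nonneg fun b _ => Finset.sum_nonneg fun a _ =>
    mul_nonneg (w_nonneg G hx hy _ _ _) (G.P_nonneg _ _ _ _)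

theorem PMat_sum {x : G.TeamPolicy} {y : G.AdvPolicy} (hx : G.IsTeamPolicy x)
    (hy : G.IsAdvPolicy y) (s) : ∑ s', G.PMat x y s s' = 1 := by
  simp only [PMat_eq]
  rw [Finset.sum_comm, ← w_sum G hx hy s]
  refine Finset.sum_congr rfl fun b _ => ?_
  rw [Finset.sum_comm]
  refine Finset.sum_congr rfl fun a _ => ?_
  rw [← Finset.mul_sum, G.P_sum_one, mul_one]

/-- Value vector. -/
noncomputable def W (x : G.TeamPolicy) (y : G.AdvPolicy) : G.S → ℝ :=
  (1 - G.γ • G.PMat x y)⁻¹ *ᵥ G.rVec x y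

theorem W_eq {x : G.TeamPolicy} {y : G.AdvPolicy} (hx : G.IsTeamPolicy x)
    (hy : G.IsAdvPolicy y) (s) :
    W G x y s = G.rVec x y s + G.γ * ∑ s', G.PMat x y s s' * W G x y s' := by
  have hu : IsUnit (1 - G.γ • G.PMat x y) := by
    rw [← Matrix.mulVec_injective_iff_isUnit]
    intro u v huv
    have h0 : (1 - G.γ • G.PMat x y) *ᵥ (u - v) = 0 := by
      rw [Matrix.mulVec_sub]; exact sub_eq_zero.2 huv
    have := fix_bound (G.PMat x y) G.γ 0 (PMat_nonneg G hx hy) (PMat_sum G hx hy)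
      G.γ_nonneg G.γ_lt_one (u - v) 0 (fun s => by
        have := congrFun h0 s
        rw [Matrix.sub_mulVec, Matrix.one_mulVec, Matrix.smul_mulVec] at this
        simp only [Matrix.mulVec, dotProduct, Pi.sub_apply, Pi.smul_apply, Pi.zero_apply,
          smul_eq_mul] at this ⊢
        linarith) (by simp)
    funext s
    have := this s
    simp only [zero_div, abs_nonpos_iff, Pi.sub_apply] at this
    linarith
  have h : (1 - G.γ • G.PMat x y) *ᵥ W G x y = G.rVec x y := by
    rw [W, Matrix.mulVec_mulVec, Matrix.mul_nonsing_inv _ ((Matrix.isUnit_iff_isUnit_det _).1 hu),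
      Matrix.one_mulVec]
  have := congrFun h s
  rw [Matrix.sub_mulVec, Matrix.one_mulVec, Matrix.smul_mulVec] at this
  simp only [Matrix.mulVec, dotProduct, Pi.sub_apply, Pi.smul_apply, smul_eq_mul] at this
  linarith

theorem W_bound {x : G.TeamPolicy} {y : G.AdvPolicy} (hx : G.IsTeamPolicy x)
    (hy : G.IsAdvPolicy y) (s) : |W G x y s| ≤ 1 / (1 - G.γ) := by
  refine fix_bound (G.PMat x y) G.γ 1 (PMat_nonneg G hx hy) (PMat_sum G hx hy)
      G.γ_nonneg G.γ_lt_one (W G x y) (G.rVec x y) (W_eq G hx hy) (fun s => ?_) s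
  rw [rVec_eq, abs_of_nonneg, ← w_sum G hx hy s]
  · exact Finset.sum_le_sum fun b _ => Finset.sum_le_sum fun a _ =>
      mul_le_of_le_one_right (w_nonneg G hx hy _ _ _) (G.r_lt_one _ _ _).le
  · exact Finset.sum_nonneg fun b _ => Finset.sum_nonneg fun a _ =>
      mul_nonneg (w_nonneg G hx hy _ _ _) (G.r_pos _ _ _).le

theorem w_l1 {x x' : G.TeamPolicy} {y y' : G.AdvPolicy} (hx : G.IsTeamPolicy x)
    (hx' : G.IsTeamPolicy x') (hy : G.IsAdvPolicy y) (s) :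
    ∑ b, ∑ a, |w G x y s b a - w G x' y' s b a| ≤
      (∑ k, ∑ a, |x k s a - x' k s a|) + ∑ b, |y s b - y' s b| := by
  have key : ∀ b (a : ∀ k, G.A k), |w G x y s b a - w G x' y' s b a| ≤
      y s b * |∏ k, x k s (a k) - ∏ k, x' k s (a k)| +
        |y s b - y' s b| * ∏ k, x' k s (a k) := by
    intro b a
    have hp : 0 ≤ ∏ k, x' k s (a k) := Finset.prod_nonneg fun k _ => hx'.1 _ _ _
    unfold w
    generalize (∏ k, x k s (a k)) = p at *
    generalize (∏ k, x' k s (a k)) = q at *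
    calc |y s b * p - y' s b * q| = |y s b * (p - q) + (y s b - y' s b) * q| := by ring_nf
      _ ≤ _ := abs_add_le _ _
      _ = _ := by rw [abs_mul, abs_mul, abs_of_nonneg hp, abs_of_nonneg (hy.1 s b)]
  refine (Finset.sum_le_sum fun b _ => Finset.sum_le_sum fun a _ => key b a).trans ?_
  simp only [Finset.sum_add_distrib, ← Finset.mul_sum, ← Finset.sum_mul]
  rw [prod_sum_one (fun k => x' k s) (fun k => hx'.2 k s), hy.2 s, mul_one, one_mul]
  gcongr
  exact l1_prod (fun k => x k s) (fun k => x' k s) (fun k => hx.1 k s) (fun k => hx'.1 k s)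
      (fun k => hx.2 k s) (fun k => hx'.2 k s)

theorem cs (x x' : G.TeamPolicy) (y y' : G.AdvPolicy) (s) :
    (∑ k, ∑ a, |x k s a - x' k s a|) + ∑ b, |y s b - y' s b| ≤
      Real.sqrt (G.totA + G.Bcard) * G.jointDist x x' y y' := by
  have h := Finset.sum_mul_sq_le_sq_mul_sq (Finset.univ : Finset ((Σ k, G.A k) ⊕ G.B))
    (fun _ => (1 : ℝ))
    (Sum.elim (fun p => |x p.1 s p.2 - x' p.1 s p.2|) (fun b => |y s b - y' s b|))
  simp only [Fintype.sum_sum_type, Fintype.sum_sigma, Sum.elim_inl, Sum.elim_inr, one_mul,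
    one_pow, sq_abs, Finset.sum_const, Finset.card_univ, nsmul_eq_mul, mul_one,
    Fintype.card_sum, Fintype.card_sigma, Nat.cast_add, Nat.cast_sum] at h
  unfold AdvTeamGame.jointDist
  rw [← Real.sqrt_mul (by unfold AdvTeamGame.totA AdvTeamGame.Bcard; positivity)]
  refine Real.le_sqrt_of_sq_le (h.trans ?_)
  unfold AdvTeamGame.totA AdvTeamGame.Bcard
  gcongr with k
  · exact Finset.single_le_sum (f := fun s => ∑ a, (x k s a - x' k s a) ^ 2)
      (fun s _ => by positivity) (Finset.mem_univ s)
  · exact Finset.single_le_sum (f := fun s => ∑ b, (y s b - y' s b) ^ 2)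
      (fun s _ => by positivity) (Finset.mem_univ s)

theorem Q_eq (x : G.TeamPolicy) (y : G.AdvPolicy) (v : G.S → ℝ) (s) :
    G.rVec x y s + G.γ * ∑ s', G.PMat x y s s' * v s' =
      ∑ b, ∑ a, w G x y s b a * (G.r s a b + G.γ * ∑ s', G.P s a b s' * v s') := by
  have : ∑ s', G.PMat x y s s' * v s' = ∑ b, ∑ a, w G x y s b a * ∑ s', G.P s a b s' * v s' := by
    simp only [PMat_eq, Finset.sum_mul]
    rw [Finset.sum_comm]
    refine Finset.sum_congr rfl fun b _ => ?_
    rw [Finset.sum_comm]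
    refine Finset.sum_congr rfl fun a _ => ?_
    simp only [Finset.mul_sum, mul_assoc]
  rw [this, rVec_eq, Finset.mul_sum, ← Finset.sum_add_distrib]
  refine Finset.sum_congr rfl fun b _ => ?_
  rw [Finset.mul_sum, ← Finset.sum_add_distrib]
  refine Finset.sum_congr rfl fun a _ => ?_
  ring

theorem Q_bound {v : G.S → ℝ} (hv : ∀ s, |v s| ≤ 1 / (1 - G.γ)) (s a b) :
    |G.r s a b + G.γ * ∑ s', G.P s a b s' * v s'| ≤ 1 / (1 - G.γ) := by
  have h1 : |∑ s', G.P s a b s' * v s'| ≤ 1 / (1 - G.γ) := by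
    calc _ ≤ ∑ s', |G.P s a b s' * v s'| := Finset.abs_sum_le_sum_abs _ _
      _ ≤ ∑ s', G.P s a b s' * (1 / (1 - G.γ)) := Finset.sum_le_sum fun s' _ => by
          rw [abs_mul, abs_of_nonneg (G.P_nonneg _ _ _ _)]
          exact mul_le_mul_of_nonneg_left (hv s') (G.P_nonneg _ _ _ _)
      _ = _ := by rw [← Finset.sum_mul, G.P_sum_one, one_mul]
  have h2 : 1 / (1 - G.γ) = 1 + G.γ * (1 / (1 - G.γ)) := by
    have : 1 - G.γ ≠ 0 := by linarith [G.γ_lt_one]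
    field_simp
    ring
  rw [h2]
  refine (abs_add_le _ _).trans (add_le_add ?_ ?_)
  · rw [abs_of_pos (G.r_pos _ _ _)]; exact (G.r_lt_one _ _ _).le
  · rw [abs_mul, abs_of_nonneg G.γ_nonneg]
    exact mul_le_mul_of_nonneg_left h1 G.γ_nonneg

theorem W_diff {x x' : G.TeamPolicy} {y y' : G.AdvPolicy} (hx : G.IsTeamPolicy x)
    (hx' : G.IsTeamPolicy x') (hy : G.IsAdvPolicy y) (hy' : G.IsAdvPolicy y') (s) :
    |W G x y s - W G x' y' s| ≤ G.Lconst * G.jointDist x x' y y' := by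
  have hg : 0 < 1 - G.γ := by linarith [G.γ_lt_one]
  have := fix_bound (G.PMat x y) G.γ
      (Real.sqrt (G.totA + G.Bcard) * G.jointDist x x' y y' * (1 / (1 - G.γ)))
      (PMat_nonneg G hx hy) (PMat_sum G hx hy)
      G.γ_nonneg G.γ_lt_one (fun s => W G x y s - W G x' y' s)
      (fun s => (G.rVec x y s + G.γ * ∑ s', G.PMat x y s s' * W G x' y' s') -
        (G.rVec x' y' s + G.γ * ∑ s', G.PMat x' y' s s' * W G x' y' s'))
      (fun s => by
        rw [W_eq G hx hy s, ← W_eq G hx' hy' s]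
        simp only [mul_sub, Finset.sum_sub_distrib]
        ring)
      (fun s => by
        rw [Q_eq, Q_eq]
        simp only [← Finset.sum_sub_distrib, ← sub_mul]
        refine (Finset.abs_sum_le_sum_abs _ _).trans ?_
        refine (Finset.sum_le_sum fun b _ => (Finset.abs_sum_le_sum_abs _ _).trans
          (Finset.sum_le_sum fun a _ => (abs_mul _ _).le.trans (mul_le_mul_of_nonneg_left
            (Q_bound G (W_bound G hx' hy') s a b) (abs_nonneg _)))).trans ?_
        simp only [← Finset.sum_mul]
        exact mul_le_mul_of_nonneg_right ((w_l1 G hx hx' hy s).trans (cs G x x' y y' s))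
          (by positivity))
      s
  refine this.trans (le_of_eq ?_)
  unfold AdvTeamGame.Lconst
  field_simp

end LipAux

open AdvTeamGame in
/-- The value function is Lipschitz continuous on the set of joint
policies with constant `√(A₁+⋯+Aₙ+B)/(1−γ)²`. -/
theorem value_function_lipschitz (G : AdvTeamGame)
    (x x' : G.TeamPolicy) (hx : G.IsTeamPolicy x) (hx' : G.IsTeamPolicy x')
    (y y' : G.AdvPolicy) (hy : G.IsAdvPolicy y) (hy' : G.IsAdvPolicy y') :
    |G.V x y - G.V x' y'| ≤ G.Lconst * G.jointDist x x' y y' := by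
  have hV : ∀ x y, G.V x y = ∑ s, G.ρ s * LipAux.W G x y s := fun _ _ => rfl
  rw [hV, hV, ← Finset.sum_sub_distrib]
  calc _ ≤ ∑ s, |G.ρ s * LipAux.W G x y s - G.ρ s * LipAux.W G x' y' s| :=
        Finset.abs_sum_le_sum_abs _ _
    _ ≤ ∑ s, G.ρ s * (G.Lconst * G.jointDist x x' y y') := Finset.sum_le_sum fun s _ => by
        rw [← mul_sub, abs_mul, abs_of_pos (G.ρ_pos s)]
        exact mul_le_mul_of_nonneg_left (LipAux.W_diff G hx hx' hy hy' s) (G.ρ_pos s).le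
    _ = _ := by rw [← Finset.sum_mul, G.ρ_sum_one, one_mul]
end

section
/- Let X ⊆ ℝ^d and Y ⊆ ℝ^m be nonempty convex compact sets, and let f : ℝ^d × ℝ^m → ℝ be differentiable on an open neighborhood of X×Y, L-Lipschitz and ℓ-smooth on X×Y (L, ℓ > 0). Let φ(x) := max_{y∈Y} f(x,y) and let φ_{1/(2ℓ)} denote its Moreau envelope. Fix x ∈ X and η > 0, let y⁺ ∈ argmax_{y∈Y} f(x,y), set x⁺ := proj_X( x − η·∇_x f(x, y⁺) ), and let x̃ := prox_{φ/(2ℓ)}(x). Then φ_{1/(2ℓ)}(x⁺) ≤ φ_{1/(2ℓ)}(x) + 2ηℓ·( φ(x̃) − φ(x) + (ℓ/2)‖x − x̃‖² ) + η²·ℓ·L². -/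
open scoped RealInnerProductSpace in
theorem aux_deriv {d : ℕ} (h : EuclideanSpace ℝ (Fin d) → ℝ) (x v : EuclideanSpace ℝ (Fin d)) (t : ℝ)
    (hd : DifferentiableAt ℝ h (x + t • v)) :
    HasDerivAt (fun s : ℝ => h (x + s • v)) (inner ℝ (gradient h (x + t • v)) v) t := by
  have h1 := hd.hasGradientAt.hasFDerivAt
  have h2 : HasDerivAt (fun s : ℝ => x + s • v) v t := by
    simpa using ((hasDerivAt_id t).smul_const v).const_add x
  have h3 := h1.comp_hasDerivAt t h2
  have e : (InnerProductSpace.toDual ℝ (EuclideanSpace ℝ (Fin d)) (gradient h (x + t • v))) v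
      = inner ℝ (gradient h (x + t • v)) v := InnerProductSpace.toDual_apply_apply
  rw [e] at h3
  exact h3

theorem aux_lower_s12 {d : ℕ} (h : EuclideanSpace ℝ (Fin d) → ℝ) (x v : EuclideanSpace ℝ (Fin d)) (l : ℝ)
    (hd : ∀ t ∈ Set.Icc (0:ℝ) 1, DifferentiableAt ℝ h (x + t • v))
    (hg : ∀ t ∈ Set.Icc (0:ℝ) 1, ‖gradient h (x + t • v) - gradient h x‖ ≤ l * (t * ‖v‖)) :
    h x + inner ℝ (gradient h x) v - l / 2 * ‖v‖ ^ 2 ≤ h (x + v) := by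
  set c : ℝ := inner ℝ (gradient h x) v with hc
  have hder : ∀ t ∈ Set.Icc (0:ℝ) 1, HasDerivAt
      (fun s : ℝ => h (x + s • v) - s * c + l / 2 * ‖v‖ ^ 2 * s ^ 2)
      (inner ℝ (gradient h (x + t • v)) v - c + l / 2 * ‖v‖ ^ 2 * (2 * t)) t := by
    intro t ht
    have a1 := aux_deriv h x v t (hd t ht)
    have a2 : HasDerivAt (fun s : ℝ => s * c) c t := by
      simpa using (hasDerivAt_id t).mul_const c
    have a3 : HasDerivAt (fun s : ℝ => l / 2 * ‖v‖ ^ 2 * s ^ 2) (l / 2 * ‖v‖ ^ 2 * (2 * t)) t := by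
      simpa using (hasDerivAt_pow 2 t).const_mul (l / 2 * ‖v‖ ^ 2)
    exact (a1.sub a2).add a3
  have hmono : MonotoneOn (fun s : ℝ => h (x + s • v) - s * c + l / 2 * ‖v‖ ^ 2 * s ^ 2)
      (Set.Icc (0:ℝ) 1) := by
    apply monotoneOn_of_deriv_nonneg (convex_Icc 0 1)
    · intro t ht
      exact (hder t ht).continuousAt.continuousWithinAt
    · intro t ht
      exact (hder t (interior_subset ht)).differentiableAt.differentiableWithinAt
    · intro t ht
      have ht' := interior_subset ht
      rw [(hder t ht').deriv]
      have b1 := abs_real_inner_le_norm (gradient h (x + t • v) - gradient h x) v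
      have b2 := mul_le_mul_of_nonneg_right (hg t ht') (norm_nonneg v)
      rw [inner_sub_left] at b1
      have b3 := neg_abs_le (inner ℝ (gradient h (x + t • v)) v - inner ℝ (gradient h x) v)
      nlinarith
  have := hmono (Set.left_mem_Icc.2 zero_le_one) (Set.right_mem_Icc.2 zero_le_one) zero_le_one
  simp at this
  linarith

theorem aux_dir_s12 {d : ℕ} (h : EuclideanSpace ℝ (Fin d) → ℝ) (x w : EuclideanSpace ℝ (Fin d)) (L : ℝ)
    (hd : DifferentiableAt ℝ h x)
    (hg : ∀ t ∈ Set.Icc (0:ℝ) 1, |h (x + t • w) - h x| ≤ L * (t * ‖w‖)) :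
    -(L * ‖w‖) ≤ inner ℝ (gradient h x) w := by
  have h1 := aux_deriv h x w 0 (by simpa using hd)
  have h2 := h1.tendsto_slope_zero_right
  simp only [zero_smul, add_zero, zero_add] at h2
  apply ge_of_tendsto h2
  filter_upwards [Ioo_mem_nhdsGT (zero_lt_one (α := ℝ))] with t ht
  have h3 := (abs_le.1 (hg t ⟨ht.1.le, ht.2.le⟩)).1
  rw [smul_eq_mul, inv_mul_eq_div, le_div_iff₀ ht.1]
  linarith

/-- One-step descent inequality for the Moreau envelope of
`φ(x) = max_{y∈Y} f(x,y)` under a GDmax step: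
`φ_{1/(2ℓ)}(x⁺) ≤ φ_{1/(2ℓ)}(x) + 2ηℓ(φ(x̃) − φ(x) + (ℓ/2)‖x − x̃‖²) + η²ℓL²`. -/
theorem moreau_envelope_descent_step
    {d m : ℕ}
    (X : Set (EuclideanSpace ℝ (Fin d))) (Y : Set (EuclideanSpace ℝ (Fin m)))
    (hXne : X.Nonempty) (hXconv : Convex ℝ X) (hXcomp : IsCompact X)
    (hYne : Y.Nonempty) (hYconv : Convex ℝ Y) (hYcomp : IsCompact Y)
    (f : EuclideanSpace ℝ (Fin d) → EuclideanSpace ℝ (Fin m) → ℝ)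
    (L l : ℝ) (hL : 0 < L) (hl : 0 < l)
    (hdiff : ∃ U : Set (EuclideanSpace ℝ (Fin d) × EuclideanSpace ℝ (Fin m)),
      IsOpen U ∧ X ×ˢ Y ⊆ U ∧ DifferentiableOn ℝ (fun p => f p.1 p.2) U)
    (hLip : ∀ x ∈ X, ∀ x' ∈ X, ∀ y ∈ Y, ∀ y' ∈ Y,
      |f x y - f x' y'| ≤ L * Real.sqrt (‖x - x'‖ ^ 2 + ‖y - y'‖ ^ 2))
    (hSmooth : ∀ x ∈ X, ∀ x' ∈ X, ∀ y ∈ Y, ∀ y' ∈ Y,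
      Real.sqrt (‖gradient (fun u => f u y) x - gradient (fun u => f u y') x'‖ ^ 2
          + ‖gradient (fun v => f x v) y - gradient (fun v => f x' v) y'‖ ^ 2)
        ≤ l * Real.sqrt (‖x - x'‖ ^ 2 + ‖y - y'‖ ^ 2))
    (x : EuclideanSpace ℝ (Fin d)) (hx : x ∈ X)
    (η : ℝ) (hη : 0 < η)
    -- y⁺ ∈ argmax_{y ∈ Y} f(x, y)
    (yp : EuclideanSpace ℝ (Fin m)) (hypY : yp ∈ Y) (hyp : ∀ y' ∈ Y, f x y' ≤ f x yp)
    -- x⁺ = proj_X (x − η ∇_x f(x, y⁺))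
    (xp : EuclideanSpace ℝ (Fin d)) (hxpX : xp ∈ X)
    (hxp : ∀ x' ∈ X,
      ‖xp - (x - η • gradient (fun u => f u yp) x)‖ ≤
        ‖x' - (x - η • gradient (fun u => f u yp) x)‖)
    -- x̃ = prox_{φ/(2ℓ)}(x)
    (xt : EuclideanSpace ℝ (Fin d)) (hxtX : xt ∈ X)
    (hxt : ∀ x' ∈ X, phiMax f Y xt + l * ‖x - xt‖ ^ 2 ≤
      phiMax f Y x' + l * ‖x - x'‖ ^ 2) :
    moreauEnv f X Y l xp ≤
      moreauEnv f X Y l x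
        + 2 * η * l * (phiMax f Y xt - phiMax f Y x + (l / 2) * ‖x - xt‖ ^ 2)
        + η ^ 2 * l * L ^ 2 := by
  obtain ⟨U, hUo, hXU, hUd⟩ := hdiff
  set h : EuclideanSpace ℝ (Fin d) → ℝ := fun u => f u yp with hh
  set g := gradient h x with hgdef
  have hdiffX : ∀ u ∈ X, DifferentiableAt ℝ h u := by
    intro u hu
    have h1 : DifferentiableAt ℝ (fun p : EuclideanSpace ℝ (Fin d) × EuclideanSpace ℝ (Fin m) =>
        f p.1 p.2) (u, yp) :=
      hUd.differentiableAt (hUo.mem_nhds (hXU ⟨hu, hypY⟩))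
    have h2 : DifferentiableAt ℝ (fun u : EuclideanSpace ℝ (Fin d) => (u, yp)) u := by fun_prop
    exact h1.comp u h2
  have hLipx : ∀ u ∈ X, ∀ u' ∈ X, ∀ y ∈ Y, |f u y - f u' y| ≤ L * ‖u - u'‖ := by
    intro u hu u' hu' y hy
    have := hLip u hu u' hu' y hy y hy
    simpa using this
  have hSmx : ∀ u ∈ X, ∀ u' ∈ X, ‖gradient h u - gradient h u'‖ ≤ l * ‖u - u'‖ := by
    intro u hu u' hu'
    have h1 := hSmooth u hu u' hu' yp hypY yp hypY
    have h2 : Real.sqrt (‖u - u'‖ ^ 2 + ‖yp - yp‖ ^ 2) = ‖u - u'‖ := by simp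
    rw [h2] at h1
    exact (Real.le_sqrt_of_sq_le (le_add_of_nonneg_right (by positivity))).trans h1
  have hseg : ∀ z ∈ X, ∀ t ∈ Set.Icc (0:ℝ) 1, x + t • (z - x) ∈ X := by
    intro z hz t ht
    exact hXconv.add_smul_sub_mem hx hz ht
  have hphile : ∀ u ∈ X, f u yp ≤ phiMax f Y u := by
    intro u hu
    refine le_csSup ⟨f x yp + L * ‖u - x‖, ?_⟩ ⟨yp, hypY, rfl⟩
    rintro _ ⟨y, hy, rfl⟩
    have h1 := (abs_le.1 (hLipx u hu x hx y hy)).2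
    have h2 := hyp y hy
    simp only
    linarith
  have hphix : phiMax f Y x = f x yp := by
    apply le_antisymm _ (hphile x hx)
    apply csSup_le (hYne.image _)
    rintro _ ⟨y, hy, rfl⟩
    exact hyp y hy
  have hlow : h x + inner ℝ g (xt - x) - l / 2 * ‖xt - x‖ ^ 2 ≤ h (x + (xt - x)) := by
    apply aux_lower_s12
    · intro t ht
      exact hdiffX _ (hseg xt hxtX t ht)
    · intro t ht
      have := hSmx _ (hseg xt hxtX t ht) x hx
      rwa [add_sub_cancel_left, norm_smul, Real.norm_of_nonneg ht.1] at this
  have hdir : -(L * ‖xp - x‖) ≤ inner ℝ g (xp - x) := by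
    apply aux_dir_s12
    · exact hdiffX x hx
    · intro t ht
      have := hLipx _ (hseg xp hxpX t ht) x hx yp hypY
      rwa [add_sub_cancel_left, norm_smul, Real.norm_of_nonneg ht.1] at this
  have hvar : inner ℝ ((x - η • g) - xp) (xt - xp) ≤ 0 := by
    have h1 : ‖(x - η • g) - xp‖ = ⨅ w : X, ‖(x - η • g) - w‖ := by
      have : Nonempty X := ⟨⟨x, hx⟩⟩
      apply le_antisymm
      · apply le_ciInf
        intro w
        rw [norm_sub_rev, norm_sub_rev _ (w : EuclideanSpace ℝ (Fin d))]
        exact hxp w w.2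
      · exact ciInf_le (f := fun w : X => ‖(x - η • g) - w‖)
          ⟨0, by rintro _ ⟨w, rfl⟩; exact norm_nonneg _⟩ ⟨xp, hxpX⟩
    exact (norm_eq_iInf_iff_real_inner_le_zero hXconv hxpX).1 h1 xt hxtX
  have henvx : phiMax f Y xt + l * ‖x - xt‖ ^ 2 ≤ moreauEnv f X Y l x := by
    apply le_csInf (hXne.image _)
    rintro _ ⟨z, hz, rfl⟩
    exact hxt z hz
  have henvp : moreauEnv f X Y l xp ≤ phiMax f Y xt + l * ‖xp - xt‖ ^ 2 := by
    obtain ⟨C, hC⟩ := hXcomp.isBounded.exists_norm_le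
    refine csInf_le ⟨f x yp - L * (C + C), ?_⟩ ⟨xt, hxtX, rfl⟩
    rintro _ ⟨z, hz, rfl⟩
    have h1 := (abs_le.1 (hLipx z hz x hx yp hypY)).1
    have h2 := hphile z hz
    have h3 : ‖z - x‖ ≤ C + C := (norm_sub_le _ _).trans (add_le_add (hC z hz) (hC x hx))
    have h4 := mul_le_mul_of_nonneg_left h3 hL.le
    have h5 : 0 ≤ l * ‖xp - z‖ ^ 2 := by positivity
    simp only
    linarith
  have hlow2 : inner ℝ g (xt - x) ≤ phiMax f Y xt - phiMax f Y x + l / 2 * ‖x - xt‖ ^ 2 := by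
    have h1 := hphile xt hxtX
    rw [add_sub_cancel, norm_sub_rev] at hlow
    simp only [hh] at hlow
    linarith
  have hkey : ‖xp - xt‖ ^ 2 ≤ ‖x - xt‖ ^ 2 + 2 * η * inner ℝ g (xt - x) + η ^ 2 * L ^ 2 := by
    have e1 : (x - η • g) - xp = -(xp - x) - η • g := by abel
    have e2 : xt - xp = (xt - x) - (xp - x) := by abel
    have e3 : xp - xt = (xp - x) - (xt - x) := by abel
    rw [e1, e2] at hvar
    rw [e3, norm_sub_rev x xt, norm_sub_sq_real]
    generalize xp - x = a at *
    generalize xt - x = b at *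
    simp only [inner_sub_left, inner_sub_right, inner_neg_left, inner_smul_left,
      real_inner_self_eq_norm_sq, conj_trivial] at hvar ⊢
    have h6 := mul_le_mul_of_nonneg_left hdir hη.le
    have h7 := sq_nonneg (‖a‖ - η * L)
    nlinarith
  have h8 := mul_le_mul_of_nonneg_left hkey hl.le
  have h9 := mul_le_mul_of_nonneg_left hlow2 (by positivity : 0 ≤ 2 * η * l)
  nlinarith
end

section
/- Let S be a nonempty finite type, let P be a row-stochastic S×S real matrix, let γ ∈ [0,1), and let r, v, c ∈ ℝ^S. Define V := (I − γ·P)⁻¹·r. If r + γ·P·v ≤ v + c entrywise, then V ≤ v + (I − γ·P)⁻¹·c entrywise. Similarly, if r + γ·P·v ≥ v + c entrywise, then V ≥ v + (I − γ·P)⁻¹·c entrywise. -/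
open Matrix

/-- A matrix is row-stochastic if all entries are nonnegative and each row sums to 1. -/
def RowStochastic {S : Type*} [Fintype S] (P : Matrix S S ℝ) : Prop :=
  (∀ s s', 0 ≤ P s s') ∧ ∀ s, ∑ s', P s s' = 1

theorem aux_min {S : Type*} [Fintype S] [Nonempty S]
    (P : Matrix S S ℝ) (hP : RowStochastic P)
    (γ : ℝ) (hγ0 : 0 ≤ γ) (hγ1 : γ < 1) (x : S → ℝ)
    (hx : ∀ s, γ * (P *ᵥ x) s ≤ x s) : ∀ s, 0 ≤ x s := by
  obtain ⟨m, hm⟩ := Finite.exists_min x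
  have h1 : x m ≤ (P *ᵥ x) m := by
    have h2 : ∑ s', P m s' * x m ≤ ∑ s', P m s' * x s' :=
      Finset.sum_le_sum fun i _ => mul_le_mul_of_nonneg_left (hm i) (hP.1 m i)
    rw [← Finset.sum_mul, hP.2 m, one_mul] at h2
    exact h2
  have h3 := mul_le_mul_of_nonneg_left h1 hγ0
  have h4 := hx m
  have h5 : 0 ≤ x m := by
    by_contra hneg
    push Not at hneg
    nlinarith
  intro s
  exact h5.trans (hm s)

theorem aux_apply {S : Type*} [Fintype S] [DecidableEq S]
    (P : Matrix S S ℝ) (γ : ℝ) (x : S → ℝ) (s : S) :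
    ((1 - γ • P) *ᵥ x) s = x s - γ * (P *ᵥ x) s := by
  simp [Matrix.sub_mulVec, Matrix.smul_mulVec]

theorem aux_unit {S : Type*} [Fintype S] [Nonempty S] [DecidableEq S]
    (P : Matrix S S ℝ) (hP : RowStochastic P)
    (γ : ℝ) (hγ0 : 0 ≤ γ) (hγ1 : γ < 1) : IsUnit (1 - γ • P).det := by
  rw [isUnit_iff_ne_zero]
  intro h0
  obtain ⟨x, hx0, hx⟩ := Matrix.exists_mulVec_eq_zero_iff.mpr h0
  apply hx0
  have h : ∀ s, x s - γ * (P *ᵥ x) s = 0 := fun s => by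
    rw [← aux_apply, hx]; rfl
  have h1 := aux_min P hP γ hγ0 hγ1 x (fun s => by linarith [h s])
  have h2 := aux_min P hP γ hγ0 hγ1 (-x) (fun s => by
    rw [Matrix.mulVec_neg]
    simp only [Pi.neg_apply]
    linarith [h s])
  funext s
  have a := h1 s
  have b := h2 s
  simp only [Pi.neg_apply] at b
  simp only [Pi.zero_apply]
  linarith

theorem aux_main {S : Type*} [Fintype S] [Nonempty S] [DecidableEq S]
    (P : Matrix S S ℝ) (hP : RowStochastic P)
    (γ : ℝ) (hγ0 : 0 ≤ γ) (hγ1 : γ < 1) (r v c : S → ℝ)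
    (h : ∀ s, r s + γ * (P *ᵥ v) s ≤ v s + c s) (s : S) :
    ((1 - γ • P)⁻¹ *ᵥ r) s ≤ v s + ((1 - γ • P)⁻¹ *ᵥ c) s := by
  have hu := aux_unit P hP γ hγ0 hγ1
  have key : (1 - γ • P) *ᵥ (v + (1 - γ • P)⁻¹ *ᵥ c - (1 - γ • P)⁻¹ *ᵥ r)
      = (1 - γ • P) *ᵥ v + c - r := by
    rw [Matrix.mulVec_sub, Matrix.mulVec_add, Matrix.mulVec_mulVec, Matrix.mulVec_mulVec,
      Matrix.mul_nonsing_inv _ hu, Matrix.one_mulVec, Matrix.one_mulVec]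
  have := aux_min P hP γ hγ0 hγ1 (v + (1 - γ • P)⁻¹ *ᵥ c - (1 - γ • P)⁻¹ *ᵥ r) (fun t => by
    have e := congrFun key t
    rw [aux_apply] at e
    simp only [Pi.add_apply, Pi.sub_apply] at e ⊢
    rw [aux_apply] at e
    linarith [h t]) s
  simp only [Pi.add_apply, Pi.sub_apply] at this
  linarith

/-- If `r + γPv ≤ v + c` entrywise, then the value vector
`V := (I − γP)⁻¹ r` satisfies `V ≤ v + (I − γP)⁻¹ c` entrywise, and symmetrically
for `≥`. -/
theorem value_vector_inequality
    {S : Type*} [Fintype S] [Nonempty S] [DecidableEq S]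
    (P : Matrix S S ℝ) (hP : RowStochastic P)
    (γ : ℝ) (hγ0 : 0 ≤ γ) (hγ1 : γ < 1)
    (r v c : S → ℝ) :
    ((∀ s, r s + γ * (P *ᵥ v) s ≤ v s + c s) →
      ∀ s, ((1 - γ • P)⁻¹ *ᵥ r) s ≤ v s + ((1 - γ • P)⁻¹ *ᵥ c) s) ∧
    ((∀ s, v s + c s ≤ r s + γ * (P *ᵥ v) s) →
      ∀ s, v s + ((1 - γ • P)⁻¹ *ᵥ c) s ≤ ((1 - γ • P)⁻¹ *ᵥ r) s) := by
  refine ⟨aux_main P hP γ hγ0 hγ1 r v c, fun h s => ?_⟩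
  have := aux_main P hP γ hγ0 hγ1 (-r) (-v) (-c) (fun t => by
    rw [Matrix.mulVec_neg]
    simp only [Pi.neg_apply]
    linarith [h t]) s
  rw [Matrix.mulVec_neg, Matrix.mulVec_neg] at this
  simp only [Pi.neg_apply] at this
  linarith
end

section
/- Let S be a nonempty finite type, let P be a row-stochastic S×S real matrix, let γ ∈ [0,1), and let ρ ∈ ℝ^S be a probability vector (entries nonnegative, summing to 1). Define the discounted visitation measure d ∈ ℝ^S by dᵀ := ρᵀ·(I − γ·P)⁻¹. Then for every s ∈ S, ρ(s) ≤ d(s) ≤ 1/(1−γ). -/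
open Matrix

lemma vmb_sum {S : Type*} [Fintype S] (P : Matrix S S ℝ) (hP : RowStochastic P) (x : S → ℝ) :
    ∑ s, ∑ t, x t * P t s = ∑ t, x t := by
  rw [Finset.sum_comm]
  refine Finset.sum_congr rfl fun t _ => ?_
  rw [← Finset.mul_sum, hP.2, mul_one]

lemma vmb_nonneg {S : Type*} [Fintype S] (P : Matrix S S ℝ) (hP : RowStochastic P)
    (γ : ℝ) (hγ0 : 0 ≤ γ) (hγ1 : γ < 1) (x : S → ℝ)
    (h : ∀ s, γ * ∑ t, x t * P t s ≤ x s) : ∀ s, 0 ≤ x s := by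
  have hn : ∀ s, max (-x s) 0 ≤ γ * ∑ t, max (-x t) 0 * P t s := by
    intro s
    apply max_le
    · have h1 : -∑ t, x t * P t s ≤ ∑ t, max (-x t) 0 * P t s := by
        rw [← Finset.sum_neg_distrib]
        refine Finset.sum_le_sum fun t _ => ?_
        rw [← neg_mul]
        exact mul_le_mul_of_nonneg_right (le_max_left _ _) (hP.1 t s)
      have h2 := mul_le_mul_of_nonneg_left h1 hγ0
      have h3 := h s
      linarith
    · exact mul_nonneg hγ0 (Finset.sum_nonneg fun t _ => mul_nonneg (le_max_right _ _) (hP.1 t s))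
  have hs := Finset.sum_le_sum (s := Finset.univ) fun s _ => hn s
  rw [← Finset.mul_sum, vmb_sum P hP (fun t => max (-x t) 0)] at hs
  intro s
  have h1 : max (-x s) 0 ≤ ∑ t, max (-x t) 0 :=
    Finset.single_le_sum (f := fun t => max (-x t) 0) (fun t _ => le_max_right _ _)
      (Finset.mem_univ s)
  have h2 := le_max_left (-x s) 0
  have h3 : ∑ t, max (-x t) 0 ≤ 0 := by nlinarith
  linarith

lemma vmb_apply {S : Type*} [Fintype S] [DecidableEq S] (P : Matrix S S ℝ) (γ : ℝ) (x : S → ℝ)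
    (s : S) : (x ᵥ* (1 - γ • P)) s = x s - γ * ∑ t, x t * P t s := by
  rw [Matrix.vecMul_sub, Matrix.vecMul_one, Matrix.vecMul_smul]
  rfl

/-- The discounted visitation measure `dᵀ := ρᵀ (I − γP)⁻¹` of a
probability vector `ρ` satisfies `ρ(s) ≤ d(s) ≤ 1/(1−γ)` for every state `s`. -/
theorem visitation_measure_bounds
    {S : Type*} [Fintype S] [Nonempty S] [DecidableEq S]
    (P : Matrix S S ℝ) (hP : RowStochastic P)
    (γ : ℝ) (hγ0 : 0 ≤ γ) (hγ1 : γ < 1)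
    (ρ : S → ℝ) (hρ_nonneg : ∀ s, 0 ≤ ρ s) (hρ_sum : ∑ s, ρ s = 1) :
    ∀ s, ρ s ≤ (ρ ᵥ* (1 - γ • P)⁻¹) s ∧ (ρ ᵥ* (1 - γ • P)⁻¹) s ≤ 1 / (1 - γ) := by
  have hdet : (1 - γ • P).det ≠ 0 := by
    intro h0
    obtain ⟨v, hv, hv0⟩ := Matrix.exists_vecMul_eq_zero_iff.mpr h0
    have h1 : ∀ s, v s - γ * ∑ t, v t * P t s = 0 := fun s => by
      rw [← vmb_apply, hv0]; rfl
    have hp := vmb_nonneg P hP γ hγ0 hγ1 v (fun s => by linarith [h1 s])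
    have hm := vmb_nonneg P hP γ hγ0 hγ1 (fun s => -v s) (fun s => by
      simp only [neg_mul, Finset.sum_neg_distrib]
      linarith [h1 s])
    exact hv (funext fun s => le_antisymm (neg_nonneg.mp (hm s)) (hp s))
  have hd : (ρ ᵥ* (1 - γ • P)⁻¹) ᵥ* (1 - γ • P) = ρ := by
    rw [Matrix.vecMul_vecMul, Matrix.nonsing_inv_mul _ (isUnit_iff_ne_zero.mpr hdet),
      Matrix.vecMul_one]
  generalize ρ ᵥ* (1 - γ • P)⁻¹ = d at hd
  have he : ∀ s, d s - γ * ∑ t, d t * P t s = ρ s := fun s => by rw [← vmb_apply, hd]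
  have hpos := vmb_nonneg P hP γ hγ0 hγ1 d (fun s => by linarith [he s, hρ_nonneg s])
  have hsum : ∑ s, d s - γ * ∑ s, d s = 1 := by
    rw [← hρ_sum, ← Finset.sum_congr rfl fun s _ => he s, Finset.sum_sub_distrib,
      ← Finset.mul_sum, vmb_sum P hP]
  intro s
  constructor
  · have : 0 ≤ γ * ∑ t, d t * P t s :=
      mul_nonneg hγ0 (Finset.sum_nonneg fun t _ => mul_nonneg (hpos t) (hP.1 t s))
    linarith [he s]
  · have h1 : d s ≤ ∑ t, d t :=
      Finset.single_le_sum (fun t _ => hpos t) (Finset.mem_univ s)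
    rw [le_div_iff₀ (by linarith)]
    nlinarith
end
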